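/- arXiv:1904.10686 — 2 statements merged into one kernel-verified Lean document; each statement's English description precedes it below -/
import Mathlib

section
/- Let G be a finite group, H an abelian normal subgroup of G, and d a positive integer. Let φ : H × H → ℂˣ be a map that is multiplicative in each variable, satisfies φ(h,h) = 1 for all h ∈ H, and is G-invariant, i.e., φ(g h g⁻¹, g h' g⁻¹) = φ(h,h') for all g ∈ G and h, h' ∈ H. Then there exists a division ring D of characteristic zero, finite-dimensional as a vector space over its center K, equipped with a faithful G-grading, together with a ring embedding ι : ℂ → D whose image is contained in K ∩ D_e, such that, writing L for the center of D_e: (i) dim_L(D_e) = d²; (ii) H = {g ∈ G : x·l = l·x for every x ∈ D_g and every l ∈ L}; and (iii) for all h, h' ∈ H there exist nonzero elements x ∈ D_h and y ∈ D_{h'}, each commuting with every element of D_e, such that x y = ι(φ(h,h')) · y x. -/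
variable {G : Type*} [Group G] [DecidableEq G] {D : Type*} [DivisionRing D]

/-- A faithful `G`-grading on `D`: a family of additive subgroups forming an internal
direct sum decomposition, multiplicative, with all components nonzero. -/
structure IsFaithfulGrading (𝒜 : G → AddSubgroup D) : Prop where
  one_mem : (1 : D) ∈ 𝒜 1
  mul_mem : ∀ {g h : G} {x y : D}, x ∈ 𝒜 g → y ∈ 𝒜 h → x * y ∈ 𝒜 (g * h)
  isInternal : DirectSum.IsInternal 𝒜
  faithful : ∀ g, 𝒜 g ≠ ⊥

/-- `L`, the center of the identity component `D_e`, as a set. -/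
def Lset (𝒜 : G → AddSubgroup D) : Set D := {x | x ∈ 𝒜 1 ∧ ∀ y ∈ 𝒜 1, x * y = y * x}

/-- The kernel of the conjugation action of `G` on `L`, as a set:
`{g ∈ G : x·l = l·x for every x ∈ D_g and every l ∈ L}`. -/
def Hset (𝒜 : G → AddSubgroup D) : Set G := {g | ∀ x ∈ 𝒜 g, ∀ l ∈ Lset 𝒜, x * l = l * x}

/-- The identity component `D_e` as a subring of `D`. -/
def De (𝒜 : G → AddSubgroup D) (hG : IsFaithfulGrading 𝒜) : Subring D where
  carrier := 𝒜 1
  zero_mem' := zero_mem _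
  one_mem' := hG.one_mem
  add_mem' := fun ha hb => add_mem ha hb
  neg_mem' := fun ha => neg_mem ha
  mul_mem' := fun ha hb => by simpa using hG.mul_mem ha hb

/-- `L`, the center of the identity component, as a subring of `D`. -/
def Lring (𝒜 : G → AddSubgroup D) (hG : IsFaithfulGrading 𝒜) : Subring D where
  carrier := Lset 𝒜
  zero_mem' := ⟨zero_mem _, fun y _ => by rw [zero_mul, mul_zero]⟩
  one_mem' := ⟨hG.one_mem, fun y _ => by rw [one_mul, mul_one]⟩
  add_mem' := fun ha hb => ⟨add_mem ha.1 hb.1, fun y hy => by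
    rw [add_mul, mul_add, ha.2 y hy, hb.2 y hy]⟩
  neg_mem' := fun ha => ⟨neg_mem ha.1, fun y hy => by rw [neg_mul, mul_neg, ha.2 y hy]⟩
  mul_mem' := fun {a b} ha hb => ⟨by simpa using hG.mul_mem ha.1 hb.1,
    fun y hy => by rw [mul_assoc, hb.2 y hy, ← mul_assoc, ha.2 y hy, mul_assoc]⟩

lemma Lring_le_De (𝒜 : G → AddSubgroup D) (hG : IsFaithfulGrading 𝒜) :
    Lring 𝒜 hG ≤ De 𝒜 hG := fun _ hx => hx.1

/-- `dim_L D_e`, the dimension of the identity component over its center `L`. -/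
noncomputable def dimLDe (𝒜 : G → AddSubgroup D) (hG : IsFaithfulGrading 𝒜) : ℕ :=
  letI : Module ↥(Lring 𝒜 hG) ↥(De 𝒜 hG) :=
    (Subring.inclusion (Lring_le_De 𝒜 hG)).toModule
  Module.finrank ↥(Lring 𝒜 hG) ↥(De 𝒜 hG)

namespace GDA
set_option linter.style.haveILetI false
set_option linter.unusedSimpArgs false

/-- every alternating bicharacter on a finite abelian group is the commutator of a bicharacter -/
theorem exists_alpha {A : Type*} [CommGroup A] [Finite A] (φ : A → A → ℂˣ)
    (hmul₁ : ∀ a b c, φ (a * b) c = φ a c * φ b c)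
    (hmul₂ : ∀ a b c, φ a (b * c) = φ a b * φ a c)
    (halt : ∀ a, φ a a = 1) :
    ∃ α : A → A → ℂˣ, (∀ a b c, α (a * b) c = α a c * α b c) ∧
      (∀ a b c, α a (b * c) = α a b * α a c) ∧ ∀ a b, α a b = φ a b * α b a := by
  classical
  have h1l : ∀ a, φ 1 a = 1 := fun a => by
    have := hmul₁ 1 1 a
    simpa using this
  have h1r : ∀ a, φ a 1 = 1 := fun a => by
    have := hmul₂ a 1 1
    simpa using this
  have hanti : ∀ a b, φ a b * φ b a = 1 := fun a b => by
    have := halt (a * b)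
    rw [hmul₁, hmul₂, hmul₂, halt, halt] at this
    simpa using this
  obtain ⟨ι, _, n, hn, ⟨e⟩⟩ := CommGroup.equiv_prod_multiplicative_zmod_of_finite A
  obtain ⟨⟨⟨N, ⟨f⟩⟩⟩⟩ : Nonempty (Nonempty (Σ' N : ℕ, Nonempty (ι ≃ Fin N))) :=
    ⟨⟨⟨Fintype.card ι, ⟨Fintype.equivFin ι⟩⟩⟩⟩
  let p : ι → A →* A := fun i =>
    (e.symm.toMonoidHom.comp (MonoidHom.mulSingle _ i)).comp
      ((Pi.evalMonoidHom _ i).comp e.toMonoidHom)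
  have hp : ∀ a, a = ∏ i, p i a := by
    intro a
    apply e.injective
    rw [map_prod]
    simp only [p, MonoidHom.comp_apply, MulEquiv.coe_toMonoidHom, MulEquiv.apply_symm_apply,
      MonoidHom.mulSingle_apply, Pi.evalMonoidHom_apply]
    exact (Finset.univ_prod_mulSingle (e a)).symm
  have hcyc : ∀ i a b, φ (p i a) (p i b) = 1 := by
    intro i a b
    set g : A := e.symm (Pi.mulSingle i (Multiplicative.ofAdd 1)) with hg
    have key : ∀ a, ∃ k : ℕ, p i a = g ^ k := by
      intro a
      haveI : NeZero (n i) := ⟨by have := hn i; omega⟩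
      refine ⟨(Multiplicative.toAdd (e a i)).val, ?_⟩
      rw [hg, ← map_pow, ← Pi.mulSingle_pow]
      simp only [p, MonoidHom.comp_apply, MulEquiv.coe_toMonoidHom,
        MonoidHom.mulSingle_apply, Pi.evalMonoidHom_apply]
      congr 2
      rw [← ofAdd_nsmul]
      simp
    have hpow : ∀ k : ℕ, φ (g ^ k) g = 1 := by
      intro k
      induction k with
      | zero => simp [h1l]
      | succ k ih => rw [pow_succ, hmul₁, ih, halt, one_mul]
    have hpow2 : ∀ k m : ℕ, φ (g ^ k) (g ^ m) = 1 := by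
      intro k m
      induction m with
      | zero => simp [h1r]
      | succ m ih => rw [pow_succ, hmul₂, ih, hpow, one_mul]
    obtain ⟨k, hk⟩ := key a
    obtain ⟨m, hm⟩ := key b
    rw [hk, hm, hpow2]
  let φ₁ : A → A →* ℂˣ := fun a => MonoidHom.mk' (φ a) (hmul₂ a)
  let φ₂ : A → A →* ℂˣ := fun b => MonoidHom.mk' (fun a => φ a b) (fun a c => hmul₁ a c b)
  have hexp : ∀ a b, φ a b = ∏ i, ∏ j, φ (p i a) (p j b) := by
    intro a b
    have e1 : ∀ c, φ c b = ∏ j, φ c (p j b) := fun c => by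
      conv_lhs => rw [hp b]
      exact map_prod (φ₁ c) _ _
    have e2 : φ a b = ∏ i, φ (p i a) b := by
      conv_lhs => rw [hp a]
      exact map_prod (φ₂ b) _ _
    rw [e2]
    exact Finset.prod_congr rfl fun i _ => e1 _
  refine ⟨fun a b => ∏ i, ∏ j, if f i < f j then φ (p i a) (p j b) else 1, ?_, ?_, ?_⟩
  · intro a b c
    simp only [← Finset.prod_mul_distrib, map_mul, hmul₁]
    refine Finset.prod_congr rfl fun i _ => Finset.prod_congr rfl fun j _ => ?_
    split_ifs <;> simp
  · intro a b c
    simp only [← Finset.prod_mul_distrib, map_mul, hmul₂]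
    refine Finset.prod_congr rfl fun i _ => Finset.prod_congr rfl fun j _ => ?_
    split_ifs <;> simp
  · intro a b
    beta_reduce
    rw [hexp a b]
    rw [Finset.prod_comm (f := fun i j => if f i < f j then φ (p i b) (p j a) else 1)]
    simp only [← Finset.prod_mul_distrib]
    refine Finset.prod_congr rfl fun i _ => Finset.prod_congr rfl fun j _ => ?_
    rcases lt_trichotomy (f i) (f j) with h | h | h
    · rw [if_pos h, if_neg h.not_gt, mul_one]
    · have := f.injective h
      subst this
      simp [hcyc]
    · rw [if_neg h.not_gt, if_pos h, hanti]

/-- Heisenberg type group attached to a bicharacter -/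
structure Heis {A : Type*} [CommGroup A] (α : A → A → ℂˣ) where
  a : A
  z : ℂˣ

theorem exists_kappa {A : Type*} [CommGroup A] (α : A → A → ℂˣ)
    (h1 : ∀ a b c, α (a * b) c = α a c * α b c)
    (h2 : ∀ a b c, α a (b * c) = α a b * α a c)
    {S : Type*} [Group S] [IsFreeGroup S] (ρ : S →* A) :
    ∃ κ : S → ℂˣ, ∀ s t, κ (s * t) = κ s * κ t * α (ρ s) (ρ t) := by
  have h1l : ∀ a, α 1 a = 1 := fun a => by
    have := h1 1 1 a
    simpa using this
  have h1r : ∀ a, α a 1 = 1 := fun a => by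
    have := h2 a 1 1
    simpa using this
  have hinv : ∀ a b, α a⁻¹ b * α a b = 1 := fun a b => by
    rw [← h1, inv_mul_cancel, h1l]
  letI : Mul (Heis α) := ⟨fun x y => ⟨x.a * y.a, x.z * y.z * α x.a y.a⟩⟩
  letI : One (Heis α) := ⟨⟨1, 1⟩⟩
  letI : Inv (Heis α) := ⟨fun x => ⟨x.a⁻¹, x.z⁻¹ * α x.a x.a⟩⟩
  letI : Group (Heis α) := Group.ofLeftAxioms
    (by
      intro x y z
      change Heis.mk _ _ = Heis.mk _ _
      congr 1
      · exact mul_assoc _ _ _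
      · change x.z * y.z * α x.a y.a * z.z * α (x.a * y.a) z.a
          = x.z * (y.z * z.z * α y.a z.a) * α x.a (y.a * z.a)
        rw [h1, h2]
        simp only [mul_assoc, mul_comm, mul_left_comm])
    (by
      intro x
      change Heis.mk _ _ = Heis.mk _ _
      congr 1
      · exact one_mul _
      · change 1 * x.z * α 1 x.a = _
        rw [h1l]; simp)
    (by
      intro x
      change Heis.mk _ _ = Heis.mk _ _
      congr 1
      · exact inv_mul_cancel _
      · change x.z⁻¹ * α x.a x.a * x.z * α x.a⁻¹ x.a = 1
        rw [show x.z⁻¹ * α x.a x.a * x.z * α x.a⁻¹ x.a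
          = (x.z⁻¹ * x.z) * (α x.a⁻¹ x.a * α x.a x.a) by
            simp only [mul_assoc, mul_comm, mul_left_comm], hinv]
        simp)
  let pr : Heis α →* A := MonoidHom.mk' (fun x => x.a) (fun _ _ => rfl)
  let θ : S →* Heis α := IsFreeGroup.lift (fun y => ⟨ρ (IsFreeGroup.of y), 1⟩)
  have hθ : pr.comp θ = ρ := by
    apply IsFreeGroup.ext_hom
    intro y
    simp [θ, pr]
  refine ⟨fun s => (θ s).z, fun s t => ?_⟩
  have e : ∀ s, (θ s).a = ρ s := fun s => DFunLike.congr_fun hθ s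
  beta_reduce
  rw [map_mul, ← e, ← e]
  rfl

end GDA

namespace GDA
set_option linter.style.haveILetI false
set_option linter.unusedSimpArgs false

/-- unique product property of `K` modulo `N` -/
def UPmod {F : Type*} [Group F] (N : Subgroup F) [N.Normal] (K : Subgroup F) : Prop :=
  ∀ A B : Finset F, A.Nonempty → B.Nonempty → (∀ a ∈ A, a ∈ K) → (∀ b ∈ B, b ∈ K) →
    ∃ a₀ ∈ A, ∃ b₀ ∈ B, ∀ a ∈ A, ∀ b ∈ B,
      QuotientGroup.mk' N a * QuotientGroup.mk' N b
        = QuotientGroup.mk' N a₀ * QuotientGroup.mk' N b₀ →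
      QuotientGroup.mk' N a = QuotientGroup.mk' N a₀ ∧
      QuotientGroup.mk' N b = QuotientGroup.mk' N b₀

theorem UPmod.extend {F : Type*} [Group F] {N : Subgroup F} [N.Normal] {K K₁ : Subgroup F}
    (h : UPmod N K₁) (f : F → ℤ) (hf : ∀ a ∈ K, ∀ b ∈ K, f (a * b) = f a + f b)
    (hN : ∀ a ∈ K, ∀ b ∈ K, QuotientGroup.mk' N a = QuotientGroup.mk' N b → f a = f b)
    (hK : ∀ a ∈ K, f a = 0 → a ∈ K₁) : UPmod N K := by
  classical
  intro A B hA hB hAK hBK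
  obtain ⟨a₁, ha₁, hamax⟩ := A.exists_max_image f hA
  obtain ⟨b₁, hb₁, hbmax⟩ := B.exists_max_image f hB
  have f1 : f 1 = 0 := by
    have := hf 1 K.one_mem 1 K.one_mem
    simp at this; exact this
  have finv : ∀ a ∈ K, f a⁻¹ = - f a := by
    intro a ha
    have := hf a ha a⁻¹ (K.inv_mem ha)
    rw [mul_inv_cancel, f1] at this
    linarith
  set A₁ := (A.filter (fun a => f a = f a₁)).image (fun a => a₁⁻¹ * a) with hA₁
  set B₁ := (B.filter (fun b => f b = f b₁)).image (fun b => b * b₁⁻¹) with hB₁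
  obtain ⟨a', ha', b', hb', H⟩ := h A₁ B₁
    ⟨a₁⁻¹ * a₁, Finset.mem_image_of_mem _ (by simp [ha₁])⟩
    ⟨b₁ * b₁⁻¹, Finset.mem_image_of_mem (fun b => b * b₁⁻¹) (by simp [hb₁])⟩
    (by
      intro a ha
      simp only [hA₁, Finset.mem_image, Finset.mem_filter] at ha
      obtain ⟨a, ⟨ha, hfa⟩, rfl⟩ := ha
      apply hK _ (K.mul_mem (K.inv_mem (hAK _ ha₁)) (hAK _ ha))
      rw [hf _ (K.inv_mem (hAK _ ha₁)) _ (hAK _ ha), finv _ (hAK _ ha₁), hfa]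
      simp)
    (by
      intro a ha
      simp only [hB₁, Finset.mem_image, Finset.mem_filter] at ha
      obtain ⟨a, ⟨ha, hfa⟩, rfl⟩ := ha
      apply hK _ (K.mul_mem (hBK _ ha) (K.inv_mem (hBK _ hb₁)))
      rw [hf _ (hBK _ ha) _ (K.inv_mem (hBK _ hb₁)), finv _ (hBK _ hb₁), hfa]
      simp)
  simp only [hA₁, Finset.mem_image, Finset.mem_filter] at ha'
  obtain ⟨a₀, ⟨ha₀, hfa₀⟩, rfl⟩ := ha'
  simp only [hB₁, Finset.mem_image, Finset.mem_filter] at hb'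
  obtain ⟨b₀, ⟨hb₀, hfb₀⟩, rfl⟩ := hb'
  refine ⟨a₀, ha₀, b₀, hb₀, fun a ha b hb hab => ?_⟩
  have hsum : f a + f b = f a₀ + f b₀ := by
    rw [← hf _ (hAK _ ha) _ (hBK _ hb), ← hf _ (hAK _ ha₀) _ (hBK _ hb₀)]
    apply hN _ (K.mul_mem (hAK _ ha) (hBK _ hb)) _ (K.mul_mem (hAK _ ha₀) (hBK _ hb₀))
    rw [map_mul, map_mul, hab]
  have h1 := hamax a ha
  have h2 := hbmax b hb
  have hfa : f a = f a₁ := by linarith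
  have hfb : f b = f b₁ := by linarith
  have := H (a₁⁻¹ * a) (by
      simp only [hA₁, Finset.mem_image, Finset.mem_filter]; exact ⟨a, ⟨ha, hfa⟩, rfl⟩)
    (b * b₁⁻¹) (by
      simp only [hB₁, Finset.mem_image, Finset.mem_filter]; exact ⟨b, ⟨hb, hfb⟩, rfl⟩)
    (by
      simp only [map_mul]
      rw [mul_assoc, ← mul_assoc (QuotientGroup.mk' N a), hab]
      simp only [mul_assoc])
  simpa only [map_mul, mul_right_inj, mul_left_inj] using this

theorem uniqueProds_abelianization {S : Type*} [Group S] [IsFreeGroup S] :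
    UniqueProds (Abelianization S) := by
  let e : Abelianization S ≃* Abelianization (FreeGroup (IsFreeGroup.Generators S)) :=
    (IsFreeGroup.toFreeGroup S).abelianizationCongr
  rw [e.uniqueProds_iff]
  haveI : UniqueSums (FreeAbelianGroup (IsFreeGroup.Generators S)) :=
    (AddEquiv.uniqueSums_iff (FreeAbelianGroup.equivFinsupp (IsFreeGroup.Generators S))).2
      inferInstance
  exact (inferInstance : UniqueProds (Multiplicative
    (FreeAbelianGroup (IsFreeGroup.Generators S))))

theorem UPmod.base {F : Type*} [Group F] [IsFreeGroup F] (S : Subgroup F) [S.Normal] :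
    UPmod ⁅S, S⁆ S := by
  classical
  intro A B hA hB hAS hBS
  have key : ∀ a b : S, QuotientGroup.mk' ⁅S, S⁆ (a : F) = QuotientGroup.mk' ⁅S, S⁆ (b : F) ↔
      Abelianization.of a = Abelianization.of b := by
    intro a b
    rw [QuotientGroup.mk'_apply, QuotientGroup.mk'_apply, QuotientGroup.eq]
    have : (Abelianization.of a = Abelianization.of b) ↔ a⁻¹ * b ∈ commutator S :=
      QuotientGroup.eq
    rw [this, ← Subgroup.map_subtype_commutator S]
    constructor
    · rintro ⟨c, hc, hc'⟩
      have : c = a⁻¹ * b := Subtype.ext hc'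
      exact this ▸ hc
    · intro h
      exact ⟨_, h, rfl⟩
  have hup := uniqueProds_abelianization (S := S)
  let A' : Finset (Abelianization S) := (A.subtype (· ∈ S)).image Abelianization.of
  let B' : Finset (Abelianization S) := (B.subtype (· ∈ S)).image Abelianization.of
  obtain ⟨a0, ha0, b0, hb0, hu⟩ := hup.uniqueMul_of_nonempty (A := A') (B := B')
    (by
      obtain ⟨a, ha⟩ := hA
      exact ⟨_, Finset.mem_image_of_mem _ (a := ⟨a, hAS a ha⟩) (by simpa using ha)⟩)
    (by
      obtain ⟨a, ha⟩ := hB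
      exact ⟨_, Finset.mem_image_of_mem _ (a := ⟨a, hBS a ha⟩) (by simpa using ha)⟩)
  simp only [A', B', Finset.mem_image, Finset.mem_subtype] at ha0 hb0
  obtain ⟨a0, ha0, rfl⟩ := ha0
  obtain ⟨b0, hb0, rfl⟩ := hb0
  refine ⟨a0, ha0, b0, hb0, fun a ha b hb hab => ?_⟩
  have h1 := hu (a := Abelianization.of ⟨a, hAS a ha⟩) (b := Abelianization.of ⟨b, hBS b hb⟩)
    (Finset.mem_image_of_mem _ (by simpa using ha))
    (Finset.mem_image_of_mem _ (by simpa using hb))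
    (by
      rw [← map_mul, ← map_mul, ← key]
      simpa using hab)
  exact ⟨(key ⟨a, hAS a ha⟩ a0).2 h1.1, (key ⟨b, hBS b hb⟩ b0).2 h1.2⟩

theorem exists_char {B : Type*} [Group B] [Finite B] [Group.IsSolvable B] [Nontrivial B] :
    ∃ ψ : B →* ℂˣ, ∃ b, ψ b ≠ 1 := by
  have hlt := Group.IsSolvable.commutator_lt_top_of_nontrivial B
  obtain ⟨b, -, hb⟩ := SetLike.exists_of_lt hlt
  have hb' : Abelianization.of b ≠ 1 := by
    intro h
    exact hb ((QuotientGroup.eq_one_iff b).1 h)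
  haveI : Finite (Abelianization B) := Quotient.finite _
  haveI : NeZero (Monoid.exponent (Abelianization B)) :=
    ⟨Monoid.exponent_ne_zero_of_finite⟩
  haveI : HasEnoughRootsOfUnity ℂ (Monoid.exponent (Abelianization B)) := inferInstance
  obtain ⟨χ, hχ⟩ :=
    CommGroup.exists_apply_ne_one_of_hasEnoughRootsOfUnity (Abelianization B) ℂ hb'
  exact ⟨χ.comp Abelianization.of, b, hχ⟩

theorem upmod_of_solvable {F : Type*} [Group F] [IsFreeGroup F] {Q : Type*} [Group Q] [Finite Q]
    (ρ : F →* Q) (n : ℕ) : ∀ (B : Subgroup Q), Nat.card B ≤ n → Group.IsSolvable B →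
    UPmod ⁅ρ.ker, ρ.ker⁆ (B.comap ρ) := by
  classical
  induction n with
  | zero =>
    intro B hB
    have := Nat.card_pos (α := B)
    omega
  | succ n ih =>
    intro B hB hsol
    by_cases hbot : B = ⊥
    · subst hbot
      exact UPmod.base ρ.ker
    haveI : Nontrivial B := (Subgroup.nontrivial_iff_ne_bot B).2 hbot
    obtain ⟨ψ, b, hb⟩ := exists_char (B := B)
    -- the image is cyclic
    haveI : Finite ψ.range := Finite.of_surjective _ ψ.rangeRestrict_surjective
    obtain ⟨ζ, hζ⟩ := IsCyclic.exists_generator (α := ψ.range)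
    let K : Subgroup F := B.comap ρ
    let ρK : K →* B := (ρ.comp K.subtype).codRestrict B (fun x => x.2)
    have hex : ∀ y : IsFreeGroup.Generators K, ∃ k : ℤ,
        ζ ^ k = ψ.rangeRestrict (ρK (IsFreeGroup.of y)) := fun y => hζ _
    choose k hk using hex
    let χ : K →* Multiplicative ℤ := IsFreeGroup.lift (fun y => Multiplicative.ofAdd (k y))
    have hχ : (zpowersHom _ ζ).comp χ = ψ.rangeRestrict.comp ρK := by
      apply IsFreeGroup.ext_hom
      intro y
      simp [χ, ← hk, zpowersHom_apply]
    let B₁ : Subgroup Q := ψ.ker.map B.subtype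
    have hB₁B : B₁ ≤ B := by
      rintro _ ⟨c, -, rfl⟩
      exact c.2
    have hlt : B₁ < B := by
      refine lt_of_le_of_ne hB₁B fun h => ?_
      have : (b : Q) ∈ B₁ := h.ge b.2
      obtain ⟨c, hc, hcb⟩ := this
      have : c = b := Subtype.ext hcb
      exact hb (this ▸ hc)
    have hcard : Nat.card B₁ < Nat.card B := by
      have : (B₁ : Set Q).ncard < (B : Set Q).ncard :=
        Set.ncard_lt_ncard hlt (Set.toFinite _)
      simpa [← Nat.card_coe_set_eq] using this
    haveI : Group.IsSolvable B₁ :=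
      Group.isSolvable_of_isSolvable_injective (Subgroup.inclusion_injective hB₁B)
    have ih' := ih B₁ (by omega) this
    refine ih'.extend (fun x => if h : x ∈ K then Multiplicative.toAdd (χ ⟨x, h⟩) else 0) ?_ ?_ ?_
    · intro a ha c hc
      change a ∈ K at ha
      change c ∈ K at hc
      have hac := K.mul_mem ha hc
      simp only [dif_pos ha, dif_pos hc, dif_pos hac]
      rw [← toAdd_mul, ← map_mul]
      rfl
    · intro a ha c hc hac
      change a ∈ K at ha
      change c ∈ K at hc
      simp only [dif_pos ha, dif_pos hc]
      congr 1
      rw [QuotientGroup.mk'_apply, QuotientGroup.mk'_apply, QuotientGroup.eq] at hac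
      have hSK : ρ.ker ≤ K := by
        intro x hx
        change ρ x ∈ B
        rw [MonoidHom.mem_ker.1 hx]
        exact B.one_mem
      have hle : ⁅ρ.ker, ρ.ker⁆ ≤ (χ.ker).map K.subtype := by
        rw [Subgroup.commutator_le]
        intro x hx y hy
        refine ⟨(⟨x, hSK hx⟩ : K) * ⟨y, hSK hy⟩ * (⟨x, hSK hx⟩ : K)⁻¹ * (⟨y, hSK hy⟩ : K)⁻¹, ?_, rfl⟩
        change χ _ = 1
        simp only [map_mul, map_inv]
        rw [mul_inv_eq_one, mul_inv_eq_iff_eq_mul, mul_comm]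
      obtain ⟨z, hz, hz'⟩ := hle hac
      have : z = (⟨a, ha⟩ : K)⁻¹ * ⟨c, hc⟩ := Subtype.ext hz'
      have hz1 : χ z = 1 := hz
      rw [this, map_mul, map_inv, inv_mul_eq_one] at hz1
      exact hz1
    · intro a ha hfa
      change a ∈ K at ha
      simp only [dif_pos ha] at hfa
      have h0 : χ ⟨a, ha⟩ = 1 := hfa
      have := DFunLike.congr_fun hχ ⟨a, ha⟩
      simp only [MonoidHom.comp_apply, h0, map_one] at this
      have h2 : ψ (ρK ⟨a, ha⟩) = 1 := (congrArg Subtype.val this).symm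
      exact ⟨ρK ⟨a, ha⟩, h2, rfl⟩

end GDA

namespace GDA
set_option linter.style.haveILetI false
set_option linter.unusedSimpArgs false

theorem exists_faithful_aux {G : Type} [Group G] (H : Subgroup G) [H.Normal]
    (x : FreeGroup (Option G))
    (hx : FreeGroup.lift (fun o : Option G => o.elim 1 id) x ∉ H) :
    ∃ r : FreeGroup (Option G), FreeGroup.lift (fun o : Option G => o.elim 1 id) r = 1 ∧
      x * r * x⁻¹ * r⁻¹ ∉
        ⁅H.comap (FreeGroup.lift (fun o : Option G => o.elim 1 id)),
          H.comap (FreeGroup.lift (fun o : Option G => o.elim 1 id))⁆ := by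
  classical
  set π : FreeGroup (Option G) →* G := FreeGroup.lift (fun o : Option G => o.elim 1 id) with hπ
  let Q := G ⧸ H
  let δ : Q → ℤˣ := fun q => if q = 1 then -1 else 1
  let W := (Q → ℤˣ) ⋊[mulAutArrow (G := Q) (A := Q) (M := ℤˣ)] Q
  let θ : FreeGroup (Option G) →* W := FreeGroup.lift (fun o : Option G =>
    o.elim (SemidirectProduct.inl δ) (fun g => SemidirectProduct.inr (QuotientGroup.mk' H g)))
  have hright : SemidirectProduct.rightHom.comp θ = (QuotientGroup.mk' H).comp π := by
    apply FreeGroup.ext_hom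
    intro o
    cases o <;> simp [θ, hπ]
  have hr : ∀ y, (θ y).right = QuotientGroup.mk' H (π y) := fun y => DFunLike.congr_fun hright y
  have hker : ⁅H.comap π, H.comap π⁆ ≤ θ.ker := by
    rw [Subgroup.commutator_le]
    intro s hs t ht
    have hs' : (θ s).right = 1 := by
      rw [hr]; exact (QuotientGroup.eq_one_iff _).2 hs
    have ht' : (θ t).right = 1 := by
      rw [hr]; exact (QuotientGroup.eq_one_iff _).2 ht
    rw [MonoidHom.mem_ker, map_commutatorElement, commutatorElement_eq_one_iff_mul_comm]
    ext1
    · rw [SemidirectProduct.mul_left, SemidirectProduct.mul_left, hs', ht', map_one]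
      exact mul_comm _ _
    · rw [SemidirectProduct.mul_right, SemidirectProduct.mul_right, hs', ht']
  refine ⟨FreeGroup.of none, by simp [hπ], fun hmem => ?_⟩
  have h1 := hker hmem
  rw [MonoidHom.mem_ker] at h1
  simp only [map_mul, map_inv] at h1
  rw [mul_inv_eq_one, mul_inv_eq_iff_eq_mul] at h1
  have h2 := congrArg SemidirectProduct.left h1
  have h3 : θ (FreeGroup.of none) = SemidirectProduct.inl δ := by simp [θ]
  rw [h3, SemidirectProduct.mul_left, SemidirectProduct.mul_left] at h2
  simp only [SemidirectProduct.left_inl, SemidirectProduct.right_inl, map_one,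
    MulAut.one_apply] at h2
  rw [mul_comm, mul_left_inj] at h2
  have h4 := congrFun h2 1
  have h5 : ((mulAutArrow (θ x).right) δ) 1 = δ ((θ x).right⁻¹ * 1) := rfl
  rw [h5] at h4
  have h6 : (θ x).right ≠ 1 := by
    rw [hr]
    intro h
    exact hx ((QuotientGroup.eq_one_iff _).1 h)
  simp only [δ, mul_one, inv_eq_one, if_neg h6, if_true] at h4
  exact absurd h4 (by decide)

theorem exists_group_data {G : Type} [Group G] [Finite G] (H : Subgroup G) (hHn : H.Normal)
    (hHab : ∀ a ∈ H, ∀ b ∈ H, a * b = b * a)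
    (φ : H → H → ℂˣ)
    (hmul₁ : ∀ h₁ h₂ h' : H, φ (h₁ * h₂) h' = φ h₁ h' * φ h₂ h')
    (hmul₂ : ∀ h h₁ h₂ : H, φ h (h₁ * h₂) = φ h h₁ * φ h h₂)
    (halt : ∀ h : H, φ h h = 1)
    (hinv : ∀ (g : G) (h h' : H),
      φ ⟨g * h * g⁻¹, hHn.conj_mem h.1 h.2 g⟩ ⟨g * h' * g⁻¹, hHn.conj_mem h'.1 h'.2 g⟩
        = φ h h') :
    ∃ (F : Type) (_ : Group F) (π : F →* G) (N : Subgroup F) (_ : N.Normal) (lam : π.ker →* ℂˣ),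
      Function.Surjective π ∧ N ≤ π.ker ∧
      (∀ s t, π s ∈ H → π t ∈ H → s * t * s⁻¹ * t⁻¹ ∈ N) ∧
      (∀ s t (hs : π s ∈ H) (ht : π t ∈ H) (r : π.ker), (r : F) = s * t * s⁻¹ * t⁻¹ →
        lam r = φ ⟨π s, hs⟩ ⟨π t, ht⟩) ∧
      (∀ (x : F) (r : π.ker), (r : F) ∈ N → lam (MulAut.conjNormal x r) = lam r) ∧
      (∀ (p : ℕ) [Fact p.Prime] (P : Subgroup G), IsPGroup p P → UPmod N (P.comap π)) ∧
      (∀ x, π x ∉ H → ∃ r ∈ π.ker, x * r * x⁻¹ * r⁻¹ ∉ N) := by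
  letI : CommGroup H := { (inferInstance : Group H) with
    mul_comm := fun a b => Subtype.ext (hHab a a.2 b b.2) }
  obtain ⟨α, hα₁, hα₂, hα⟩ := exists_alpha φ hmul₁ hmul₂ halt
  have hα1l : ∀ a, α 1 a = 1 := fun a => by
    have := hα₁ 1 1 a
    simpa using this
  let π : FreeGroup (Option G) →* G := FreeGroup.lift (fun o : Option G => o.elim 1 id)
  let S : Subgroup (FreeGroup (Option G)) := H.comap π
  let ρ : S →* H := (π.comp S.subtype).codRestrict H (fun x => x.2)
  obtain ⟨κ, hκ⟩ := exists_kappa α hα₁ hα₂ ρ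
  have hRS : π.ker ≤ S := by
    intro x hx
    change π x ∈ H
    rw [MonoidHom.mem_ker.1 hx]
    exact H.one_mem
  have hρR : ∀ x (hx : x ∈ π.ker), ρ ⟨x, hRS hx⟩ = 1 := fun x hx => Subtype.ext hx
  let lam : π.ker →* ℂˣ := MonoidHom.mk' (fun r => κ ⟨r, hRS r.2⟩) (by
    intro a b
    have := hκ ⟨a, hRS a.2⟩ ⟨b, hRS b.2⟩
    rw [hρR _ a.2, hα1l, mul_one] at this
    exact this)
  have hcomm : ∀ s t (hs : π s ∈ H) (ht : π t ∈ H) (r : π.ker), (r : FreeGroup (Option G))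
      = s * t * s⁻¹ * t⁻¹ → lam r = φ ⟨π s, hs⟩ ⟨π t, ht⟩ := by
    intro s t hs ht r hr
    have e1 := hκ ⟨r, hRS r.2⟩ (⟨t, ht⟩ * ⟨s, hs⟩)
    rw [hρR _ r.2, hα1l, mul_one, hκ ⟨t, ht⟩ ⟨s, hs⟩] at e1
    have e2 : (⟨r, hRS r.2⟩ : S) * (⟨t, ht⟩ * ⟨s, hs⟩) = ⟨s, hs⟩ * ⟨t, ht⟩ := by
      apply Subtype.ext
      change (r : FreeGroup (Option G)) * (t * s) = s * t
      rw [hr]; group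
    rw [e2, hκ] at e1
    have e3 : ρ ⟨s, hs⟩ = ⟨π s, hs⟩ := rfl
    have e4 : ρ ⟨t, ht⟩ = ⟨π t, ht⟩ := rfl
    rw [e3, e4, hα] at e1
    change κ ⟨r, hRS r.2⟩ = _
    have e5 : κ ⟨s, hs⟩ * κ ⟨t, ht⟩ * α ⟨π t, ht⟩ ⟨π s, hs⟩ * φ ⟨π s, hs⟩ ⟨π t, ht⟩ =
      κ ⟨s, hs⟩ * κ ⟨t, ht⟩ * α ⟨π t, ht⟩ ⟨π s, hs⟩ * κ ⟨r, hRS r.2⟩ := by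
      rw [mul_assoc _ (α _ _), mul_comm (α _ _), e1]
      simp only [mul_assoc, mul_comm, mul_left_comm]
    exact (mul_left_cancel e5).symm
  have hmem : ∀ s t, π s ∈ H → π t ∈ H → s * t * s⁻¹ * t⁻¹ ∈ π.ker := by
    intro s t hs ht
    rw [MonoidHom.mem_ker]
    simp only [map_mul, map_inv]
    rw [hHab _ hs _ ht]; group
  have hNR : ⁅S, S⁆ ≤ π.ker := by
    rw [Subgroup.commutator_le]
    intro s hs t ht
    exact hmem s t hs ht
  refine ⟨FreeGroup (Option G), inferInstance, π, ⁅S, S⁆, inferInstance, lam, ?_, hNR, ?_, hcomm,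
    ?_, ?_, ?_⟩
  · intro g
    exact ⟨FreeGroup.of (some g), by simp [π]⟩
  · intro s t hs ht
    exact Subgroup.commutator_mem_commutator (H₁ := S) (H₂ := S) hs ht
  · intro x r hr
    have hle : ⁅S, S⁆ ≤ ((lam.comp (MulAut.conjNormal x).toMonoidHom).eqLocus lam).map
        π.ker.subtype := by
      rw [Subgroup.commutator_le]
      intro s hs t ht
      refine ⟨⟨s * t * s⁻¹ * t⁻¹, hmem s t hs ht⟩, ?_, rfl⟩
      change lam (MulAut.conjNormal x _) = lam _
      rw [hcomm s t hs ht ⟨_, hmem s t hs ht⟩ rfl]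
      have hs' : π (x * s * x⁻¹) ∈ H := by
        simp only [map_mul, map_inv]; exact hHn.conj_mem _ hs _
      have ht' : π (x * t * x⁻¹) ∈ H := by
        simp only [map_mul, map_inv]; exact hHn.conj_mem _ ht _
      rw [hcomm (x * s * x⁻¹) (x * t * x⁻¹) hs' ht' _ (by
        rw [MulAut.conjNormal_apply]; group)]
      rw [← hinv (π x) ⟨π s, hs⟩ ⟨π t, ht⟩]
      congr 1 <;> exact Subtype.ext (by simp)
    obtain ⟨z, hz, hz'⟩ := hle hr
    have : z = r := Subtype.ext hz'
    subst this
    exact hz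
  · intro p _ P hP
    let ρQ := (QuotientGroup.mk' H).comp π
    have hker : ρQ.ker = S := by
      ext x
      rw [MonoidHom.mem_ker]
      exact QuotientGroup.eq_one_iff _
    have hP' : IsPGroup p (P.map (QuotientGroup.mk' H)) := hP.map _
    haveI := hP'.isNilpotent
    have h1 := upmod_of_solvable ρQ _ (P.map (QuotientGroup.mk' H)) le_rfl inferInstance
    intro A B hA hB hAK hBK
    have h2 := h1 A B hA hB (fun a ha => ⟨π a, hAK a ha, rfl⟩) (fun a ha => ⟨π a, hBK a ha, rfl⟩)
    simp only [QuotientGroup.mk'_apply, ← QuotientGroup.mk_mul, QuotientGroup.eq, hker] at h2 ⊢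
    exact h2
  · intro x hx
    exact exists_faithful_aux H x hx

end GDA

namespace GDA
set_option linter.style.haveILetI false
set_option linter.unusedSimpArgs false

theorem dvd_finrank {D L : Type*} [Ring D] [Nontrivial D] [Field L] [Module L D]
    [IsScalarTower L D D] [FiniteDimensional L D] (B : Subring D) (hB : ∀ l : L, l • (1 : D) ∈ B)
    (hdom : ∀ x ∈ B, ∀ y ∈ B, x * y = 0 → x = 0 ∨ y = 0)
    (W : Submodule L D) (hW : ∀ x, x ∈ W ↔ x ∈ B) (V : Submodule D D) :
    Module.finrank L W ∣ Module.finrank L V := by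
  have hsm : ∀ (l : L) (x : D), (l • (1 : D)) * x = l • x := fun l x => by
    rw [smul_mul_assoc, one_mul]
  let j : L →+* B :=
    { toFun := fun l => ⟨l • (1 : D), hB l⟩
      map_one' := Subtype.ext (one_smul _ _)
      map_zero' := Subtype.ext (zero_smul _ _)
      map_add' := fun a b => Subtype.ext (add_smul _ _ _)
      map_mul' := fun a b => Subtype.ext (by
        change (a * b) • (1 : D) = (a • (1 : D)) * (b • (1 : D))
        rw [hsm, mul_smul]) }
  letI : Module L B := Module.compHom B j
  have hLB : ∀ (l : L) (b : B), ((l • b : B) : D) = l • (b : D) := fun l b => hsm l b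
  let e : B ≃ₗ[L] W :=
    { toFun := fun b => ⟨b.1, (hW _).2 b.2⟩
      invFun := fun w => ⟨w.1, (hW _).1 w.2⟩
      map_add' := fun a b => rfl
      map_smul' := fun l b => Subtype.ext (hLB l b)
      left_inv := fun _ => rfl
      right_inv := fun _ => rfl }
  haveI : FiniteDimensional L B := Module.Finite.equiv e.symm
  rw [← e.finrank_eq]
  have hlinv : ∀ a : B, a ≠ 0 → ∃ b : B, b * a = 1 := by
    intro a ha
    let f : B →ₗ[L] B :=
      { toFun := fun b => b * a
        map_add' := fun x y => add_mul _ _ _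
        map_smul' := fun l x => Subtype.ext (by
          simp only [RingHom.id_apply, Subring.coe_mul, hLB, smul_mul_assoc]) }
    have hinj : Function.Injective f := by
      rw [injective_iff_map_eq_zero]
      intro b hb
      have hb' : (b : D) * a = 0 := congrArg Subtype.val hb
      rcases hdom b b.2 a a.2 hb' with h | h
      · exact Subtype.ext h
      · exact absurd (Subtype.ext h) ha
    exact (LinearMap.injective_iff_surjective.1 hinj) 1
  have hunit : ∀ a : B, IsUnit a ∨ a = 0 := by
    intro a
    by_cases ha : a = 0
    · exact Or.inr ha
    · left
      obtain ⟨b, hb⟩ := hlinv a ha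
      have hb0 : b ≠ 0 := by
        rintro rfl
        rw [zero_mul] at hb
        exact zero_ne_one hb
      obtain ⟨c, hc⟩ := hlinv b hb0
      have hca : c = a := by
        calc c = c * (b * a) := by rw [hb, mul_one]
          _ = a := by rw [← mul_assoc, hc, one_mul]
      subst hca
      exact ⟨⟨c, b, hc, hb⟩, rfl⟩
  letI : DivisionRing B := DivisionRing.ofIsUnitOrEqZero hunit
  haveI : IsScalarTower L B V := ⟨fun l b v => Subtype.ext (by
    change ((l • b : B) : D) * (v : D) = l • ((b : D) * (v : D))
    rw [hLB, smul_mul_assoc])⟩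
  exact ⟨_, (Module.finrank_mul_finrank L B V).symm⟩

/-- normalized 2-cocycles -/
structure IsCoc {G L : Type*} [Group G] [CommRing L] [MulSemiringAction G L] (c : G → G → L) :
    Prop where
  one_left : ∀ g, c 1 g = 1
  one_right : ∀ g, c g 1 = 1
  coc : ∀ g h k, c g h * c (g * h) k = (g • c h k) * c g (h * k)

/-- crossed product -/
def CP {G L : Type*} [Group G] [CommRing L] [MulSemiringAction G L] {c : G → G → L}
    (_ : IsCoc c) : Type _ := G → L

section
variable {G L : Type*} [Group G] [Fintype G] [DecidableEq G] [CommRing L] [MulSemiringAction G L]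
  {c : G → G → L} (hc : IsCoc c)

instance : AddCommGroup (CP hc) := inferInstanceAs (AddCommGroup (G → L))
instance : Module L (CP hc) := inferInstanceAs (Module L (G → L))

instance : Mul (CP hc) := ⟨fun x y => fun k => ∑ g, x g * (g • y (g⁻¹ * k)) * c g (g⁻¹ * k)⟩
instance : One (CP hc) := ⟨fun k => (Pi.single 1 1 : G → L) k⟩

theorem CP.mul_def (x y : CP hc) (k : G) :
    (x * y) k = ∑ g, x g * (g • y (g⁻¹ * k)) * c g (g⁻¹ * k) := rfl

theorem CP.one_def (k : G) : (1 : CP hc) k = (Pi.single 1 1 : G → L) k := rfl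
theorem CP.add_def (x y : CP hc) (k : G) : (x + y) k = x k + y k := rfl
theorem CP.zero_def (k : G) : (0 : CP hc) k = 0 := rfl
theorem CP.smul_def (l : L) (x : CP hc) (k : G) : (l • x) k = l * x k := rfl

instance : Ring (CP hc) :=
  { (inferInstance : AddCommGroup (CP hc)), (inferInstance : Mul (CP hc)),
    (inferInstance : One (CP hc)) with
    left_distrib := fun x y z => by
      funext k
      simp only [CP.mul_def, CP.add_def, smul_add, mul_add, add_mul, Finset.sum_add_distrib]
    right_distrib := fun x y z => by
      funext k
      simp only [CP.mul_def, CP.add_def, smul_add, mul_add, add_mul, Finset.sum_add_distrib]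
    zero_mul := fun x => by
      funext k
      simp [CP.mul_def, CP.zero_def]
    mul_zero := fun x => by
      funext k
      simp [CP.mul_def, CP.zero_def]
    one_mul := fun x => by
      funext k
      rw [CP.mul_def, Finset.sum_eq_single 1]
      · simp [CP.one_def, hc.one_left]
      · intro g _ hg
        simp [CP.one_def, hg]
      · simp
    mul_one := fun x => by
      funext k
      rw [CP.mul_def, Finset.sum_eq_single k]
      · simp [CP.one_def, hc.one_right]
      · intro g _ hg
        have : g⁻¹ * k ≠ 1 := fun h => hg (by rw [inv_mul_eq_one] at h; exact h)
        simp [CP.one_def, this]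
      · simp
    mul_assoc := fun x y z => by
      funext k
      simp only [CP.mul_def, Finset.sum_mul, Finset.mul_sum, Finset.smul_sum]
      rw [Finset.sum_comm]
      refine Finset.sum_congr rfl fun g _ => ?_
      rw [← Equiv.sum_comp (Equiv.mulLeft g)]
      refine Finset.sum_congr rfl fun h _ => ?_
      have h1 : (g * h)⁻¹ * k = h⁻¹ * (g⁻¹ * k) := by group
      simp only [Equiv.coe_mulLeft, inv_mul_cancel_left, h1, smul_mul', mul_smul]
      have := hc.coc g h (h⁻¹ * (g⁻¹ * k))
      rw [mul_inv_cancel_left] at this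
      linear_combination (x g * g • y h * g • h • z (h⁻¹ * (g⁻¹ * k))) * this }

instance : IsScalarTower L (CP hc) (CP hc) := ⟨fun l x y => by
  funext k
  simp only [smul_eq_mul, CP.mul_def, CP.smul_def, Finset.mul_sum, mul_assoc]⟩

/-- the embedding of `L` -/
def CP.j : L →+* CP hc :=
  { toFun := fun l => l • (1 : CP hc)
    map_one' := one_smul _ _
    map_zero' := zero_smul _ _
    map_add' := fun a b => add_smul _ _ _
    map_mul' := fun a b => by rw [smul_mul_assoc, one_mul, mul_smul] }

theorem CP.smul_eq (l : L) (x : CP hc) : l • x = CP.j hc l * x := by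
  change _ = (l • (1 : CP hc)) * x
  rw [smul_mul_assoc, one_mul]

/-- basis elements -/
def CP.u (g : G) : CP hc := fun k => (Pi.single g 1 : G → L) k

theorem CP.u_def (g k : G) : CP.u hc g k = (Pi.single g 1 : G → L) k := rfl

theorem CP.u_one : CP.u hc 1 = 1 := rfl

/-- the basis -/
noncomputable def CP.basis : Module.Basis G L (CP hc) := Pi.basisFun L G

theorem CP.basis_apply (g : G) : CP.basis hc g = CP.u hc g := by
  change Pi.basisFun L G g = _
  rw [Pi.basisFun_apply]
  rfl

theorem CP.u_mul_apply (g : G) (y : CP hc) (k : G) :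
    (CP.u hc g * y) k = (g • y (g⁻¹ * k)) * c g (g⁻¹ * k) := by
  rw [CP.mul_def, Finset.sum_eq_single g]
  · simp [CP.u_def]
  · intro h _ hh
    simp [CP.u_def, hh]
  · simp

theorem CP.u_mul_u (g h : G) : CP.u hc g * CP.u hc h = c g h • CP.u hc (g * h) := by
  funext k
  rw [CP.u_mul_apply, CP.smul_def, CP.u_def, CP.u_def]
  by_cases hk : k = g * h
  · subst hk; simp
  · have : g⁻¹ * k ≠ h := fun hh => hk (by rw [← hh]; group)
    simp [hk, this]

theorem CP.u_mul_j (g : G) (l : L) : CP.u hc g * CP.j hc l = CP.j hc (g • l) * CP.u hc g := by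
  funext k
  rw [CP.u_mul_apply, ← CP.smul_eq, CP.smul_def, CP.u_def]
  change (g • ((l • (1 : CP hc)) (g⁻¹ * k))) * _ = _
  rw [CP.smul_def, CP.one_def]
  by_cases hk : k = g
  · subst hk; simp [hc.one_right]
  · have : g⁻¹ * k ≠ 1 := fun h => hk (by rw [inv_mul_eq_one] at h; exact h.symm)
    simp [hk, this]

/-- elements supported on a subgroup -/
def CP.supp (P : Subgroup G) : Subring (CP hc) where
  carrier := {x | ∀ g, g ∉ P → x g = 0}
  zero_mem' := fun g _ => rfl
  one_mem' := fun g hg => by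
    have : g ≠ 1 := fun h => hg (h ▸ P.one_mem)
    rw [CP.one_def]; simp [this]
  add_mem' := fun {x y} hx hy g hg => by
    rw [CP.add_def, hx g hg, hy g hg, add_zero]
  neg_mem' := fun {x} hx g hg => by
    change - x g = 0
    rw [hx g hg, neg_zero]
  mul_mem' := fun {x y} hx hy k hk => by
    rw [CP.mul_def]
    refine Finset.sum_eq_zero fun g _ => ?_
    by_cases hg : g ∈ P
    · have : g⁻¹ * k ∉ P := fun h => hk (by simpa using P.mul_mem hg h)
      rw [hy _ this, smul_zero, mul_zero, zero_mul]
    · rw [hx _ hg, zero_mul, zero_mul]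

theorem CP.mem_supp (P : Subgroup G) (x : CP hc) :
    x ∈ CP.supp hc P ↔ ∀ g, g ∉ P → x g = 0 := Iff.rfl

end

section
variable {G L : Type*} [Group G] [Fintype G] [DecidableEq G] [Field L] [MulSemiringAction G L]
  {c : G → G → L} (hc : IsCoc c)

instance : Nontrivial (CP hc) := inferInstanceAs (Nontrivial (G → L))
instance : Module.Finite L (CP hc) := inferInstanceAs (Module.Finite L (G → L))

theorem CP.finrank_supp (P : Subgroup G) (W : Submodule L (CP hc))
    (hW : ∀ x, x ∈ W ↔ x ∈ CP.supp hc P) : Module.finrank L W = Nat.card P := by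
  classical
  let e : W ≃ₗ[L] (P → L) :=
    { toFun := fun w p => (w : CP hc) p
      invFun := fun f => ⟨fun g => if h : g ∈ P then f ⟨g, h⟩ else 0, (hW _).2 (by
        intro g hg
        simp [hg])⟩
      map_add' := fun a b => rfl
      map_smul' := fun l b => rfl
      left_inv := fun w => by
        apply Subtype.ext
        funext g
        by_cases h : g ∈ P
        · simp [h]
        · simp [h, (hW _).1 w.2 g h]
      right_inv := fun f => by
        funext p
        simp }
  rw [e.finrank_eq, Module.finrank_fintype_fun_eq_card, Nat.card_eq_fintype_card]

theorem CP.exists_left_inv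
    (hdom : ∀ (p : ℕ) [Fact p.Prime] (P : Subgroup G), IsPGroup p P →
      ∀ x ∈ CP.supp hc P, ∀ y ∈ CP.supp hc P, x * y = 0 → x = 0 ∨ y = 0)
    (x : CP hc) (hx : x ≠ 0) : ∃ y, y * x = 1 := by
  let V : Submodule (CP hc) (CP hc) := Submodule.span (CP hc) {x}
  let V' : Submodule L (CP hc) := V.restrictScalars L
  have hdvd : Nat.card G ∣ Module.finrank L V := by
    rw [Nat.dvd_iff_prime_pow_dvd_dvd]
    intro p k hp hk
    haveI : Fact p.Prime := ⟨hp⟩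
    obtain ⟨P, hP⟩ := Sylow.exists_subgroup_card_pow_prime p hk
    rw [← hP]
    have hPp : IsPGroup p P := IsPGroup.of_card hP
    let W : Submodule L (CP hc) :=
      { carrier := CP.supp hc P
        add_mem' := fun ha hb => add_mem ha hb
        zero_mem' := zero_mem _
        smul_mem' := fun l y hy g hg => by
          rw [CP.smul_def, hy g hg, mul_zero] }
    have hW : ∀ y, y ∈ W ↔ y ∈ CP.supp hc P := fun y => Iff.rfl
    rw [← CP.finrank_supp hc P W hW]
    refine dvd_finrank (CP.supp hc P) (fun l => ?_) (hdom p P hPp) W hW V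
    exact (hW _).1 (W.smul_mem l (one_mem (CP.supp hc P)))
  have hle : Module.finrank L V' ≤ Nat.card G := by
    refine (Submodule.finrank_le V').trans_eq ?_
    rw [Nat.card_eq_fintype_card]
    exact Module.finrank_fintype_fun_eq_card L
  have hdvd' : Nat.card G ∣ Module.finrank L V' := hdvd
  have hpos : 0 < Module.finrank L V' := by
    haveI : Nontrivial V' := ⟨⟨⟨x, Submodule.mem_span_singleton_self x⟩, 0,
      fun h => hx (congrArg Subtype.val h)⟩⟩
    exact Module.finrank_pos
  have heq : Module.finrank L V' = Module.finrank L (CP hc) := by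
    refine (le_antisymm hle (Nat.le_of_dvd hpos hdvd')).trans ?_
    rw [Nat.card_eq_fintype_card]
    exact (Module.finrank_fintype_fun_eq_card L).symm
  have htop : V' = ⊤ := Submodule.eq_top_of_finrank_eq heq
  have h1 : (1 : CP hc) ∈ V' := by rw [htop]; trivial
  exact Submodule.mem_span_singleton.1 h1

/-- The division ring structure. -/
theorem CP.isUnit_or
    (hdom : ∀ (p : ℕ) [Fact p.Prime] (P : Subgroup G), IsPGroup p P →
      ∀ x ∈ CP.supp hc P, ∀ y ∈ CP.supp hc P, x * y = 0 → x = 0 ∨ y = 0)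
    (a : CP hc) : IsUnit a ∨ a = 0 := by
  by_cases ha : a = 0
  · exact Or.inr ha
  · left
    obtain ⟨b, hb⟩ := CP.exists_left_inv hc hdom a ha
    have hb0 : b ≠ 0 := by
      rintro rfl
      rw [zero_mul] at hb
      exact zero_ne_one hb
    obtain ⟨e, he⟩ := CP.exists_left_inv hc hdom b hb0
    have hca : e = a := by
      calc e = e * (b * a) := by rw [hb, mul_one]
        _ = a := by rw [← mul_assoc, he, one_mul]
    subst hca
    exact ⟨⟨e, b, he, hb⟩, rfl⟩

end
end GDA

namespace GDA
set_option linter.style.haveILetI false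
set_option linter.unusedSimpArgs false

/-- group-theoretic input -/
structure GD (G : Type) [Group G] where
  F : Type
  grp : Group F
  π : F →* G
  N : Subgroup F
  nor : N.Normal
  lam : π.ker →* ℂˣ
  surj : Function.Surjective π
  le : N ≤ π.ker
  comm : ∀ s t, π s = 1 → π t = 1 → s * t * s⁻¹ * t⁻¹ ∈ N
  hlam : ∀ (x : F) (r : π.ker), (r : F) ∈ N → lam (MulAut.conjNormal x r) = lam r
  up : ∀ (p : ℕ) [Fact p.Prime] (P : Subgroup G), IsPGroup p P → UPmod N (P.comap π)

namespace GD
variable {G : Type} [Group G] (X : GD G)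

instance : Group X.F := X.grp
instance : X.N.Normal := X.nor

/-- relation module -/
abbrev M : Type := X.π.ker ⧸ X.N.subgroupOf X.π.ker

instance : CommGroup X.M :=
  { (inferInstance : Group X.M) with
    mul_comm := fun a b => by
      induction a using QuotientGroup.induction_on with | _ a => ?_
      induction b using QuotientGroup.induction_on with | _ b => ?_
      rw [← QuotientGroup.mk_mul, ← QuotientGroup.mk_mul, QuotientGroup.eq,
        Subgroup.mem_subgroupOf]
      have := X.comm (b : X.F)⁻¹ (a : X.F)⁻¹ (by rw [map_inv, b.2, inv_one])
        (by rw [map_inv, a.2, inv_one])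
      have h2 : (((a * b)⁻¹ * (b * a) : X.π.ker) : X.F)
        = (b : X.F)⁻¹ * (a : X.F)⁻¹ * (b : X.F)⁻¹⁻¹ * (a : X.F)⁻¹⁻¹ := by
        push_cast; group
      rw [h2]; exact this }

theorem mk_eq (a b : X.π.ker) : (a : X.M) = (b : X.M) ↔
    QuotientGroup.mk' X.N (a : X.F) = QuotientGroup.mk' X.N (b : X.F) := by
  rw [QuotientGroup.eq, Subgroup.mem_subgroupOf, QuotientGroup.mk'_apply, QuotientGroup.mk'_apply,
    QuotientGroup.eq]
  rfl

instance : UniqueProds X.M := by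
  classical
  refine ⟨fun {A B} hA hB => ?_⟩
  haveI : Fact (Nat.Prime 2) := ⟨Nat.prime_two⟩
  have hup := X.up 2 ⊥ IsPGroup.of_bot
  let r : X.M → X.F := fun m => (m.out : X.F)
  have hr : ∀ m, ∀ h : r m ∈ X.π.ker, ((⟨r m, h⟩ : X.π.ker) : X.M) = m := fun m h => m.out_eq'
  have hk : ∀ m, r m ∈ X.π.ker := fun m => m.out.2
  obtain ⟨a₀, ha₀, b₀, hb₀, h⟩ := hup (A.image r) (B.image r) (hA.image r) (hB.image r)
    (by
      intro a ha
      obtain ⟨m, _, rfl⟩ := Finset.mem_image.1 ha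
      exact hk m)
    (by
      intro a ha
      obtain ⟨m, _, rfl⟩ := Finset.mem_image.1 ha
      exact hk m)
  obtain ⟨m₀, hm₀, rfl⟩ := Finset.mem_image.1 ha₀
  obtain ⟨n₀, hn₀, rfl⟩ := Finset.mem_image.1 hb₀
  refine ⟨m₀, hm₀, n₀, hn₀, fun m n hm hn e => ?_⟩
  have := h (r m) (Finset.mem_image_of_mem _ hm) (r n) (Finset.mem_image_of_mem _ hn) (by
    rw [← hr m (hk m), ← hr n (hk n), ← hr m₀ (hk m₀), ← hr n₀ (hk n₀), ← QuotientGroup.mk_mul,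
      ← QuotientGroup.mk_mul, mk_eq] at e
    rw [← map_mul, ← map_mul]
    exact e)
  rw [← hr m (hk m), ← hr n (hk n), ← hr m₀ (hk m₀), ← hr n₀ (hk n₀), mk_eq, mk_eq]
  exact this

/-- the group algebra of the relation module -/
abbrev A : Type := MonoidAlgebra ℂ X.M

instance : IsDomain X.A := NoZeroDivisors.to_isDomain _

/-- twisted monomials -/
noncomputable def w : X.π.ker →* X.A where
  toFun r := MonoidAlgebra.single (r : X.M) (X.lam r : ℂ)
  map_one' := by simp [MonoidAlgebra.one_def]
  map_mul' a b := by simp [MonoidAlgebra.single_mul_single]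

theorem w_def (r : X.π.ker) : X.w r = MonoidAlgebra.single (r : X.M) (X.lam r : ℂ) := rfl

theorem w_ne_zero (r : X.π.ker) : X.w r ≠ 0 := by
  rw [w_def]
  intro h
  rw [MonoidAlgebra.single_eq_zero] at h
  exact (X.lam r).ne_zero h

theorem w_mem (r : X.π.ker) (hr : (r : X.F) ∈ X.N) :
    X.w r = algebraMap ℂ X.A (X.lam r : ℂ) := by
  have : (r : X.M) = 1 := (QuotientGroup.eq_one_iff r).2 hr
  rw [w_def, this]; rfl

theorem single_eq (r : X.π.ker) (z : ℂ) :
    (MonoidAlgebra.single (r : X.M) z : X.A) = (z * (X.lam r : ℂ)⁻¹) • X.w r := by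
  rw [w_def, MonoidAlgebra.smul_single, smul_eq_mul, inv_mul_cancel_right₀ (X.lam r).ne_zero]

theorem algHom_ext {f g : X.A →ₐ[ℂ] X.A} (h : ∀ r, f (X.w r) = g (X.w r)) : f = g := by
  refine MonoidAlgebra.algHom_ext (fun m => ?_) (by ext)
  induction m using QuotientGroup.induction_on with | _ r => ?_
  rw [single_eq, map_smul, map_smul, h]

/-- conjugation action of `F` -/
noncomputable def act (x : X.F) : X.A →ₐ[ℂ] X.A :=
  MonoidAlgebra.lift ℂ X.A X.M (QuotientGroup.lift _
    ({ toFun := fun r => ((X.lam r : ℂ)⁻¹) • X.w (MulAut.conjNormal x r)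
       map_one' := by simp
       map_mul' := fun a b => by
        simp only [map_mul, Units.val_mul, mul_inv, smul_mul_smul_comm] } : X.π.ker →* X.A)
    (by
      intro r hr
      rw [Subgroup.mem_subgroupOf] at hr
      rw [MonoidHom.mem_ker]
      change ((X.lam r : ℂ)⁻¹) • X.w (MulAut.conjNormal x r) = 1
      rw [w_mem, X.hlam x r hr, Algebra.algebraMap_eq_smul_one, smul_smul,
        inv_mul_cancel₀ (X.lam r).ne_zero, one_smul]
      rw [MulAut.conjNormal_apply]
      exact X.nor.conj_mem _ hr _))

theorem act_w (x : X.F) (r : X.π.ker) : X.act x (X.w r) = X.w (MulAut.conjNormal x r) := by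
  rw [w_def, act, MonoidAlgebra.lift_single]
  change (X.lam r : ℂ) • ((X.lam r : ℂ)⁻¹) • X.w (MulAut.conjNormal x r) = _
  rw [smul_smul, mul_inv_cancel₀ (X.lam r).ne_zero, one_smul]

theorem act_one : X.act 1 = AlgHom.id ℂ _ := X.algHom_ext fun r => by
  rw [act_w]; simp

theorem act_mul (x y : X.F) : X.act (x * y) = (X.act x).comp (X.act y) := X.algHom_ext fun r => by
  rw [AlgHom.comp_apply, act_w, act_w, act_w, map_mul]; rfl

theorem act_id (x : X.F) (h : ∀ r : X.π.ker, ∃ h : x * r * x⁻¹ * (r : X.F)⁻¹ ∈ X.N,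
    X.lam ⟨_, X.le h⟩ = 1) : X.act x = AlgHom.id ℂ _ := X.algHom_ext fun r => by
  obtain ⟨h1, h2⟩ := h r
  have : MulAut.conjNormal x r = ⟨_, X.le h1⟩ * r := Subtype.ext (by
    rw [MulAut.conjNormal_apply]; simp)
  rw [act_w, this, map_mul, w_mem _ _ h1, h2, Units.val_one, map_one, one_mul]
  rfl

theorem act_ker (x : X.F) (hx : x ∈ X.π.ker) : X.act x = AlgHom.id ℂ _ := by
  refine X.act_id x fun r => ⟨X.comm _ _ hx r.2, ?_⟩
  have : (⟨_, X.le (X.comm _ _ hx r.2)⟩ : X.π.ker) = ⟨x, hx⟩ * r * ⟨x, hx⟩⁻¹ * r⁻¹ :=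
    Subtype.ext (by simp)
  rw [this, map_mul, map_mul, map_mul, map_inv, map_inv]
  rw [mul_inv_cancel_comm, mul_inv_cancel]

theorem act_congr {x y : X.F} (h : X.π x = X.π y) : X.act x = X.act y := by
  have h1 : x = (x * y⁻¹) * y := by group
  rw [h1, act_mul, act_ker X (x * y⁻¹) (by rw [MonoidHom.mem_ker, map_mul, map_inv, h,
    mul_inv_cancel])]
  rfl

open Classical in
/-- section -/
noncomputable def sec (g : G) : X.F := if g = 1 then 1 else Function.surjInv X.surj g

theorem sec_one : X.sec 1 = 1 := by simp [sec]
theorem π_sec (g : G) : X.π (X.sec g) = g := by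
  by_cases h : g = 1
  · simp [sec, h]
  · simp [sec, h, Function.surjInv_eq]

noncomputable instance : MulSemiringAction G X.A where
  smul g a := X.act (X.sec g) a
  one_smul a := by
    change X.act _ a = a
    rw [sec_one, act_one]; rfl
  mul_smul g h a := by
    change X.act _ a = X.act _ (X.act _ a)
    rw [X.act_congr (y := X.sec g * X.sec h) (by simp only [map_mul, π_sec]), act_mul]; rfl
  smul_zero g := map_zero _
  smul_add g := map_add _
  smul_one g := map_one _
  smul_mul g := map_mul _

theorem smul_def (g : G) (a : X.A) : g • a = X.act (X.sec g) a := rfl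

theorem π_smul (f : X.F) (a : X.A) : X.π f • a = X.act f a := by
  rw [smul_def, X.act_congr (X.π_sec _)]

theorem smul_algebraMap (g : G) (z : ℂ) : g • (algebraMap ℂ X.A z) = algebraMap ℂ X.A z := by
  rw [smul_def]; exact AlgHom.commutes _ _

/-- part of `f` in the kernel -/
noncomputable def kp (f : X.F) : X.π.ker := ⟨f * (X.sec (X.π f))⁻¹, by
  rw [MonoidHom.mem_ker, map_mul, map_inv, π_sec, mul_inv_cancel]⟩

/-- cocycle -/
noncomputable def c (g h : G) : X.A := X.w (X.kp (X.sec g * X.sec h))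

theorem kp_coe (f : X.F) : (X.kp f : X.F) = f * (X.sec (X.π f))⁻¹ := rfl

theorem kp_sec (g : G) : X.kp (X.sec g) = 1 := Subtype.ext (by
  rw [kp_coe, π_sec, mul_inv_cancel]; rfl)

/-- multiplicativity -/
theorem key (f f' : X.F) :
    X.w (X.kp f) * (X.π f • X.w (X.kp f')) * X.c (X.π f) (X.π f') = X.w (X.kp (f * f')) := by
  rw [smul_def, act_w, c, ← map_mul, ← map_mul]
  congr 1
  apply Subtype.ext
  simp only [Subgroup.coe_mul, MulAut.conjNormal_apply, kp_coe, map_mul, π_sec]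
  group

theorem isCoc : IsCoc X.c where
  one_left g := by rw [c, sec_one, one_mul, kp_sec, map_one]
  one_right g := by rw [c, sec_one, mul_one, kp_sec, map_one]
  coc g h k := by
    rw [smul_def, c, c, c, c, act_w, ← map_mul, ← map_mul]
    congr 1
    apply Subtype.ext
    simp only [Subgroup.coe_mul, MulAut.conjNormal_apply, kp_coe, map_mul, π_sec, mul_assoc]
    group

end GD
end GDA

namespace GDA
set_option linter.style.haveILetI false
set_option linter.unusedSimpArgs false
set_option linter.unusedSectionVars false
namespace GD
variable {G : Type} [Group G] [Fintype G] [DecidableEq G] (X : GD G)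

/-- lifted monomials -/
noncomputable def uh (f : X.F) : CP X.isCoc := X.w (X.kp f) • CP.u X.isCoc (X.π f)

theorem mul_smul_inv {a : X.A} (ha : ∀ g : G, g • a = a) (x y : CP X.isCoc) :
    x * (a • y) = a • (x * y) := by
  funext k
  rw [CP.mul_def, CP.smul_def, CP.mul_def, Finset.mul_sum]
  refine Finset.sum_congr rfl fun g _ => ?_
  rw [CP.smul_def, smul_mul', ha]
  ring

theorem u_mul_smul (g : G) (a : X.A) (y : CP X.isCoc) :
    CP.u X.isCoc g * (a • y) = (g • a) • (CP.u X.isCoc g * y) := by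
  rw [CP.smul_eq, ← mul_assoc, CP.u_mul_j, mul_assoc, ← CP.smul_eq]

theorem uh_mul (f f' : X.F) : X.uh f * X.uh f' = X.uh (f * f') := by
  rw [uh, uh, smul_mul_assoc, u_mul_smul, CP.u_mul_u, smul_smul, smul_smul, X.key, uh, map_mul]

/-- representative of a monomial -/
noncomputable def rep (t : Σ _ : G, X.M) : X.F := (t.2.out : X.F) * X.sec t.1

theorem π_rep (t : Σ _ : G, X.M) : X.π (X.rep t) = t.1 := by
  have : X.π (t.2.out : X.F) = 1 := t.2.out.2
  rw [rep, map_mul, π_sec, this, one_mul]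

theorem kp_rep (t : Σ _ : G, X.M) : X.kp (X.rep t) = t.2.out := by
  apply Subtype.ext
  rw [kp_coe, π_rep, rep, mul_inv_cancel_right]

theorem mk_kp {f f' : X.F} (hf : X.π f = X.π f') : ((X.kp f : X.M) = (X.kp f' : X.M)) ↔
    QuotientGroup.mk' X.N f = QuotientGroup.mk' X.N f' := by
  rw [mk_eq, kp_coe, kp_coe, hf, map_mul, map_mul, mul_left_inj]

theorem π_eq_of_mk {f f' : X.F} (h : QuotientGroup.mk' X.N f = QuotientGroup.mk' X.N f') :
    X.π f = X.π f' := by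
  rw [QuotientGroup.mk'_apply, QuotientGroup.mk'_apply, QuotientGroup.eq] at h
  have := X.le h
  rw [MonoidHom.mem_ker, map_mul, map_inv, inv_mul_eq_one] at this
  exact this

theorem rep_inj {t t' : Σ _ : G, X.M}
    (h : QuotientGroup.mk' X.N (X.rep t) = QuotientGroup.mk' X.N (X.rep t')) : t = t' := by
  have h1 := X.π_eq_of_mk h
  have h2 := (X.mk_kp h1).2 h
  rw [kp_rep, kp_rep] at h2
  have h3 : ∀ m : X.M, ((m.out : X.π.ker) : X.M) = m := fun m => m.out_eq'
  rw [h3, h3] at h2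
  rw [π_rep, π_rep] at h1
  obtain ⟨a, b⟩ := t
  obtain ⟨a', b'⟩ := t'
  simp only at h1 h2
  rw [h1, h2]

/-- coefficients -/
noncomputable def al (x : CP X.isCoc) (t : Σ _ : G, X.M) : ℂ :=
  (x t.1).coeff t.2 * (X.lam t.2.out : ℂ)⁻¹

/-- index set -/
noncomputable def T (x : CP X.isCoc) : Finset (Σ _ : G, X.M) :=
  Finset.univ.sigma (fun g => (x g).coeff.support)

theorem single_smul_u (g : G) (m : X.M) (z : ℂ) :
    (MonoidAlgebra.single m z : X.A) • CP.u X.isCoc g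
      = algebraMap ℂ X.A (z * (X.lam m.out : ℂ)⁻¹) • X.uh (X.rep ⟨g, m⟩) := by
  rw [uh, kp_rep, π_rep, smul_smul, ← Algebra.smul_def]
  congr 1
  have h3 : ((m.out : X.π.ker) : X.M) = m := m.out_eq'
  conv_lhs => rw [← h3]
  exact X.single_eq _ _

theorem expand (x : CP X.isCoc) :
    x = ∑ t ∈ X.T x, algebraMap ℂ X.A (X.al x t) • X.uh (X.rep t) := by
  have h1 : x = ∑ g, x g • CP.u X.isCoc g := by
    have := (CP.basis X.isCoc).sum_repr x
    conv_lhs => rw [← this]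
    refine Finset.sum_congr rfl fun g _ => ?_
    rw [CP.basis_apply]
    rfl
  conv_lhs => rw [h1]
  rw [T, Finset.sum_sigma]
  refine Finset.sum_congr rfl fun g _ => ?_
  have h2 : x g = ∑ m ∈ (x g).coeff.support, MonoidAlgebra.single m ((x g).coeff m) := by
    apply MonoidAlgebra.coeff_injective
    rw [MonoidAlgebra.coeff_sum]
    exact (Finsupp.sum_single (x g).coeff).symm
  conv_lhs => rw [h2]
  rw [Finset.sum_smul]
  refine Finset.sum_congr rfl fun m _ => ?_
  rw [single_smul_u]
  rfl

theorem al_ne_zero (x : CP X.isCoc) {t : Σ _ : G, X.M} (ht : t ∈ X.T x) : X.al x t ≠ 0 := by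
  rw [T, Finset.mem_sigma, Finsupp.mem_support_iff] at ht
  exact mul_ne_zero ht.2 (inv_ne_zero (Units.ne_zero _))

theorem T_nonempty (x : CP X.isCoc) (hx : x ≠ 0) : (X.T x).Nonempty := by
  rw [Finset.nonempty_iff_ne_empty]
  intro h
  apply hx
  rw [X.expand x, h, Finset.sum_empty]

theorem T_supp (P : Subgroup G) (x : CP X.isCoc) (hx : x ∈ CP.supp X.isCoc P)
    {t : Σ _ : G, X.M} (ht : t ∈ X.T x) : t.1 ∈ P := by
  by_contra h
  rw [T, Finset.mem_sigma, hx _ h] at ht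
  simp at ht

/-- coefficient functional -/
noncomputable def eps (f₀ : X.F) : CP X.isCoc →+ ℂ where
  toFun x := (x (X.π f₀)).coeff (X.kp f₀ : X.M)
  map_zero' := rfl
  map_add' _ _ := rfl

theorem eps_uh_self (z : ℂ) (f : X.F) :
    X.eps f (algebraMap ℂ X.A z • X.uh f) = z * X.lam (X.kp f) := by
  change ((algebraMap ℂ X.A z • X.uh f : CP X.isCoc) (X.π f)).coeff (X.kp f : X.M) = _
  rw [CP.smul_def, ← Algebra.smul_def, MonoidAlgebra.coeff_smul, uh, CP.smul_def, CP.u_def,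
    Pi.single_eq_same, mul_one, w_def, MonoidAlgebra.coeff_single]
  simp

theorem eps_uh_ne (z : ℂ) {f f₀ : X.F}
    (h : QuotientGroup.mk' X.N f ≠ QuotientGroup.mk' X.N f₀) :
    X.eps f₀ (algebraMap ℂ X.A z • X.uh f) = 0 := by
  change ((algebraMap ℂ X.A z • X.uh f : CP X.isCoc) (X.π f₀)).coeff (X.kp f₀ : X.M) = _
  rw [CP.smul_def, ← Algebra.smul_def, MonoidAlgebra.coeff_smul, uh, CP.smul_def, CP.u_def]
  by_cases h1 : X.π f = X.π f₀
  · have h2 : (X.kp f : X.M) ≠ (X.kp f₀ : X.M) := fun h2 => h ((X.mk_kp h1).1 h2)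
    rw [← h1, Pi.single_eq_same, mul_one, w_def, MonoidAlgebra.coeff_single]
    rw [Finsupp.smul_apply, Finsupp.single_eq_of_ne h2.symm, smul_zero]
  · rw [Pi.single_eq_of_ne (Ne.symm h1), mul_zero]
    simp

theorem dom (p : ℕ) [Fact p.Prime] (P : Subgroup G) (hP : IsPGroup p P)
    (x : CP X.isCoc) (hx : x ∈ CP.supp X.isCoc P) (y : CP X.isCoc) (hy : y ∈ CP.supp X.isCoc P)
    (hx0 : x ≠ 0) (hy0 : y ≠ 0) : x * y ≠ 0 := by
  classical
  intro hxy
  obtain ⟨a₀, ha₀, b₀, hb₀, h⟩ := X.up p P hP ((X.T x).image X.rep) ((X.T y).image X.rep)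
    ((X.T_nonempty x hx0).image _) ((X.T_nonempty y hy0).image _)
    (by
      intro a ha
      obtain ⟨m, hm, rfl⟩ := Finset.mem_image.1 ha
      rw [Subgroup.mem_comap, π_rep]
      exact X.T_supp P x hx hm)
    (by
      intro a ha
      obtain ⟨m, hm, rfl⟩ := Finset.mem_image.1 ha
      rw [Subgroup.mem_comap, π_rep]
      exact X.T_supp P y hy hm)
  obtain ⟨t₀, ht₀, rfl⟩ := Finset.mem_image.1 ha₀
  obtain ⟨s₀, hs₀, rfl⟩ := Finset.mem_image.1 hb₀
  have h1 : x * y = ∑ t ∈ X.T x, ∑ s ∈ X.T y,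
      algebraMap ℂ X.A (X.al x t * X.al y s) • X.uh (X.rep t * X.rep s) := by
    conv_lhs => rw [X.expand x, X.expand y]
    rw [Finset.sum_mul_sum]
    refine Finset.sum_congr rfl fun t _ => Finset.sum_congr rfl fun s _ => ?_
    rw [smul_mul_assoc, X.mul_smul_inv (fun g => X.smul_algebraMap g _), uh_mul, smul_smul,
      map_mul]
  have h2 := congrArg (X.eps (X.rep t₀ * X.rep s₀)) h1
  rw [hxy, map_zero, map_sum, Finset.sum_eq_single t₀, map_sum, Finset.sum_eq_single s₀,
    eps_uh_self] at h2
  · refine mul_ne_zero (mul_ne_zero (X.al_ne_zero x ht₀) (X.al_ne_zero y hs₀))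
      (Units.ne_zero _) h2.symm
  · intro s hs hne
    apply X.eps_uh_ne
    intro e
    rw [map_mul, map_mul] at e
    exact hne (X.rep_inj (h _ (Finset.mem_image_of_mem _ ht₀) _ (Finset.mem_image_of_mem _ hs) e).2)
  · exact fun h => absurd hs₀ h
  · intro t ht hne
    rw [map_sum]
    refine Finset.sum_eq_zero fun s hs => ?_
    apply X.eps_uh_ne
    intro e
    rw [map_mul, map_mul] at e
    exact hne (X.rep_inj (h _ (Finset.mem_image_of_mem _ ht) _ (Finset.mem_image_of_mem _ hs) e).1)
  · exact fun h => absurd ht₀ h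

end GD

/-- The transfer to the fraction field. -/
theorem dom_frac {G A L : Type*} [Group G] [Fintype G] [DecidableEq G] [CommRing A] [IsDomain A]
    [Field L] [Algebra A L] [IsFractionRing A L] [MulSemiringAction G A] [MulSemiringAction G L]
    (hs : ∀ (g : G) (a : A), algebraMap A L (g • a) = g • algebraMap A L a)
    {c : G → G → A} (hc : IsCoc c) {c' : G → G → L} (hc' : IsCoc c')
    (hcc : ∀ g h, c' g h = algebraMap A L (c g h)) (P : Subgroup G)
    (hdom : ∀ x ∈ CP.supp hc P, ∀ y ∈ CP.supp hc P, x ≠ 0 → y ≠ 0 → x * y ≠ 0)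
    (x : CP hc') (hx : x ∈ CP.supp hc' P) (y : CP hc') (hy : y ∈ CP.supp hc' P)
    (hxy : x * y = 0) : x = 0 ∨ y = 0 := by
  by_contra hcon
  push Not at hcon
  obtain ⟨hx0, hy0⟩ := hcon
  obtain ⟨b, hb⟩ := IsLocalization.exist_integer_multiples_of_finite (nonZeroDivisors A)
    (fun g => x g)
  obtain ⟨d, hd⟩ := IsLocalization.exist_integer_multiples_of_finite (nonZeroDivisors A)
    (fun g => g⁻¹ • y g)
  choose X hX using hb
  choose Y hY using hd
  have inj : Function.Injective (algebraMap A L) := IsFractionRing.injective A L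
  have hb0 : algebraMap A L b ≠ 0 := by
    rw [Ne, map_eq_zero_iff _ inj]; exact nonZeroDivisors.ne_zero b.2
  have hd0 : algebraMap A L d ≠ 0 := by
    rw [Ne, map_eq_zero_iff _ inj]; exact nonZeroDivisors.ne_zero d.2
  simp only [Algebra.smul_def] at hX hY
  let X' : CP hc := X
  let Y' : CP hc := fun g => g • Y g
  have hY' : ∀ g, algebraMap A L (Y' g) = g • algebraMap A L d * y g := fun g => by
    change algebraMap A L (g • Y g) = _
    rw [hs, hY, smul_mul', smul_inv_smul]
  have hsm : ∀ g : G, g • algebraMap A L d ≠ 0 := fun g h => hd0 (by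
    have := congrArg (fun t => g⁻¹ • t) h
    simpa using this)
  refine hdom X' (fun g hg => inj ?_) Y' (fun g hg => inj ?_) ?_ ?_ ?_
  · change algebraMap A L (X g) = _
    rw [hX, hx g hg, mul_zero, map_zero]
  · rw [hY', hy g hg, mul_zero, map_zero]
  · intro h
    apply hx0
    funext g
    have h1 : algebraMap A L (X g) = 0 := by
      have : X g = 0 := congrFun h g
      rw [this, map_zero]
    rw [hX] at h1
    exact (mul_eq_zero.1 h1).resolve_left hb0
  · intro h
    apply hy0
    funext g
    have h1 : algebraMap A L (Y' g) = 0 := by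
      have : Y' g = 0 := congrFun h g
      rw [this, map_zero]
    rw [hY'] at h1
    exact (mul_eq_zero.1 h1).resolve_left (hsm g)
  · funext k
    apply inj
    have h0 : (x * y) k = 0 := by rw [hxy]; rfl
    rw [CP.mul_def] at h0 ⊢
    rw [map_sum, CP.zero_def, map_zero]
    have : ∀ g : G, algebraMap A L (X' g * g • Y' (g⁻¹ * k) * c g (g⁻¹ * k))
        = (algebraMap A L b * k • algebraMap A L d)
          * (x g * g • y (g⁻¹ * k) * c' g (g⁻¹ * k)) := fun g => by
      have hXg : algebraMap A L (X' g) = algebraMap A L b * x g := hX g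
      rw [map_mul, map_mul, hXg, hs, hY', hcc, smul_mul', smul_smul, mul_inv_cancel_left]
      ring
    rw [Finset.sum_congr rfl fun g _ => this g, ← Finset.mul_sum, h0, mul_zero]

end GDA

namespace GDA
set_option linter.style.haveILetI false
set_option linter.unusedSimpArgs false
set_option linter.unusedSectionVars false

theorem exists_crossed {G : Type} [Group G] [Finite G] (H : Subgroup G) (hHn : H.Normal)
    (hHab : ∀ a ∈ H, ∀ b ∈ H, a * b = b * a)
    (φ : H → H → ℂˣ)
    (hmul₁ : ∀ h₁ h₂ h' : H, φ (h₁ * h₂) h' = φ h₁ h' * φ h₂ h')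
    (hmul₂ : ∀ h h₁ h₂ : H, φ h (h₁ * h₂) = φ h h₁ * φ h h₂)
    (halt : ∀ h : H, φ h h = 1)
    (hinv : ∀ (g : G) (h h' : H),
      φ ⟨g * h * g⁻¹, hHn.conj_mem h.1 h.2 g⟩ ⟨g * h' * g⁻¹, hHn.conj_mem h'.1 h'.2 g⟩
        = φ h h') :
    ∃ (D : Type) (_ : DivisionRing D) (L : Type) (_ : Field L) (_ : MulSemiringAction G L)
      (_ : Module L D) (j : L →+* D) (u : Module.Basis G L D) (c : G → G → L) (ι : ℂ →+* L),
      (∀ (l : L) (x : D), l • x = j l * x) ∧ u 1 = 1 ∧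
      (∀ g h, u g * u h = j (c g h) * u (g * h)) ∧
      (∀ g l, u g * j l = j (g • l) * u g) ∧
      (∀ (g : G) z, g • ι z = ι z) ∧
      (∀ g : G, g ∈ H ↔ ∀ l : L, g • l = l) ∧
      (∀ h h' : H, u h * u h' = j (ι (φ h h' : ℂ)) * (u h' * u h)) := by
  classical
  letI : Fintype G := Fintype.ofFinite G
  have hφ1 : ∀ h, φ h 1 = 1 := fun h => by
    have := hmul₂ h 1 1
    simpa using this
  obtain ⟨X, hN, hlam, hfaith⟩ : ∃ X : GD G,
      (∀ s t, X.π s ∈ H → X.π t ∈ H → s * t * s⁻¹ * t⁻¹ ∈ X.N) ∧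
      (∀ s t (hs : X.π s ∈ H) (ht : X.π t ∈ H) (r : X.π.ker), (r : X.F) = s * t * s⁻¹ * t⁻¹ →
        X.lam r = φ ⟨X.π s, hs⟩ ⟨X.π t, ht⟩) ∧
      (∀ x, X.π x ∉ H → ∃ r ∈ X.π.ker, x * r * x⁻¹ * r⁻¹ ∉ X.N) := by
    obtain ⟨F, gF, π, N, nN, lam, surj, le, hN, hlam, hconj, hup, hfaith⟩ :=
      exists_group_data H hHn hHab φ hmul₁ hmul₂ halt hinv
    exact ⟨⟨F, gF, π, N, nN, lam, surj, le,
      fun s t hs ht => hN s t (by rw [hs]; exact H.one_mem) (by rw [ht]; exact H.one_mem),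
      hconj, hup⟩, hN, hlam, hfaith⟩
  let L := FractionRing X.A
  letI : MulSemiringAction G L := IsFractionRing.mulSemiringAction G X.A L
  have hs : ∀ (g : G) (a : X.A), algebraMap X.A L (g • a) = g • algebraMap X.A L a :=
    fun g a => algebraMap.coe_smul' g a L
  let c' : G → G → L := fun g h => algebraMap X.A L (X.c g h)
  have hc' : IsCoc c' :=
    { one_left := fun g => by
        change algebraMap X.A L _ = 1
        rw [X.isCoc.one_left, map_one]
      one_right := fun g => by
        change algebraMap X.A L _ = 1
        rw [X.isCoc.one_right, map_one]
      coc := fun g h k => by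
        change algebraMap X.A L _ * algebraMap X.A L _ = g • algebraMap X.A L _ * algebraMap X.A L _
        rw [← hs, ← map_mul, ← map_mul, X.isCoc.coc] }
  have hdom : ∀ (p : ℕ) [Fact p.Prime] (P : Subgroup G), IsPGroup p P →
      ∀ x ∈ CP.supp hc' P, ∀ y ∈ CP.supp hc' P, x * y = 0 → x = 0 ∨ y = 0 := by
    intro p _ P hP x hx y hy hxy
    exact dom_frac hs X.isCoc hc' (fun _ _ => rfl) P
      (fun x hx y hy hx0 hy0 => X.dom p P hP x hx y hy hx0 hy0) x hx y hy hxy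
  letI : DivisionRing (CP hc') := DivisionRing.ofIsUnitOrEqZero (CP.isUnit_or hc' hdom)
  have inj : Function.Injective (algebraMap X.A L) := IsFractionRing.injective X.A L
  let ι : ℂ →+* L := (algebraMap X.A L).comp (algebraMap ℂ X.A)
  refine ⟨CP hc', inferInstance, L, inferInstance, inferInstance, inferInstance, CP.j hc',
    CP.basis hc', c', ι, CP.smul_eq hc', ?_, ?_, ?_, ?_, ?_, ?_⟩
  · rw [CP.basis_apply, CP.u_one]
  · intro g h
    rw [CP.basis_apply, CP.basis_apply, CP.basis_apply, CP.u_mul_u, CP.smul_eq]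
  · intro g l
    rw [CP.basis_apply, CP.u_mul_j]
  · intro g z
    change g • algebraMap X.A L (algebraMap ℂ X.A z) = algebraMap X.A L (algebraMap ℂ X.A z)
    rw [← hs, X.smul_algebraMap]
  · intro g
    constructor
    · intro hg
      have hA : ∀ a : X.A, g • a = a := by
        intro a
        have hid : X.act (X.sec g) = AlgHom.id ℂ _ := by
          refine X.act_id _ fun r => ?_
          have h1 : X.π (X.sec g) ∈ H := by
            have : X.π (X.sec g) = g := X.π_sec g
            rw [this]; exact hg
          have hr : X.π (r : X.F) = 1 := r.2
          have h2 : X.π (r : X.F) ∈ H := by rw [hr]; exact H.one_mem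
          refine ⟨hN _ _ h1 h2, ?_⟩
          refine (hlam _ _ h1 h2 _ rfl).trans ?_
          have h3 : (⟨X.π (r : X.F), h2⟩ : H) = 1 := Subtype.ext hr
          rw [h3, hφ1]
        rw [X.smul_def, hid]; rfl
      intro l
      obtain ⟨a, b, _, rfl⟩ := IsFractionRing.div_surjective X.A l
      rw [smul_div₀', ← hs, ← hs, hA, hA]
    · intro h
      by_contra hg
      obtain ⟨r, hr, hrN⟩ := hfaith (X.sec g) (by
        have : X.π (X.sec g) = g := X.π_sec g
        rw [this]; exact hg)
      have h1 := h (algebraMap X.A L (X.w ⟨r, hr⟩))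
      rw [← hs] at h1
      have h2 := inj h1
      rw [X.smul_def, X.act_w, X.w_def, X.w_def] at h2
      have h3 := congrArg MonoidAlgebra.coeff h2
      rw [MonoidAlgebra.coeff_single, MonoidAlgebra.coeff_single] at h3
      rw [Finsupp.single_eq_single_iff] at h3
      rcases h3 with h3 | h3
      · have h4 := h3.1.symm
        rw [QuotientGroup.eq, Subgroup.mem_subgroupOf] at h4
        apply hrN
        have h5 := X.nor.conj_mem _ h4 r
        have h6 : r * ((⟨r, hr⟩ : X.π.ker)⁻¹ * MulAut.conjNormal (X.sec g) (⟨r, hr⟩ : X.π.ker) :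
            X.π.ker) * r⁻¹ = X.sec g * r * (X.sec g)⁻¹ * r⁻¹ := by
          rw [Subgroup.coe_mul, MulAut.conjNormal_apply, Subgroup.coe_inv]
          change r * (r⁻¹ * (X.sec g * r * (X.sec g)⁻¹)) * r⁻¹ = _
          rw [mul_inv_cancel_left]
        exact h6 ▸ h5
      · exact (Units.ne_zero _) h3.1
  · intro h h'
    simp only [CP.basis_apply]
    rw [CP.u_mul_u, CP.u_mul_u, CP.smul_eq, CP.smul_eq, ← mul_assoc, ← map_mul,
      hHab _ h.2 _ h'.2]
    congr 2
    change algebraMap X.A L (X.c h h') =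
      algebraMap X.A L (algebraMap ℂ X.A (φ h h' : ℂ)) * algebraMap X.A L (X.c h' h)
    rw [← map_mul]
    congr 1
    have h1 : X.π (X.sec h) = h := X.π_sec h
    have h1' : X.π (X.sec h') = h' := X.π_sec h'
    have hh : X.π (X.sec h) ∈ H := by rw [h1]; exact h.2
    have hh' : X.π (X.sec h') ∈ H := by rw [h1']; exact h'.2
    have hmem := hN _ _ hh hh'
    have h2 : X.kp (X.sec h * X.sec h') = (⟨_, X.le hmem⟩ : X.π.ker) * X.kp (X.sec h' * X.sec h) := by
      apply Subtype.ext
      rw [Subgroup.coe_mul, X.kp_coe, X.kp_coe, map_mul, map_mul, X.π_sec, X.π_sec,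
        hHab _ h.2 _ h'.2]
      change _ = X.sec h * X.sec h' * (X.sec h)⁻¹ * (X.sec h')⁻¹ * _
      group
    have h3 : X.lam ⟨_, X.le hmem⟩ = φ h h' := by
      refine (hlam _ _ hh hh' _ rfl).trans ?_
      congr 1 <;> exact Subtype.ext (by assumption)
    rw [GD.c, GD.c, h2, map_mul, X.w_mem _ hmem, h3]
end GDA

namespace GDA
set_option linter.style.haveILetI false
set_option linter.unusedSimpArgs false
set_option linter.unusedSectionVars false

section
variable {G' : Type} [Group G'] [Fintype G'] {Γ : Type*} [Group Γ] (p : G' →* Γ)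
  {E L : Type} [DivisionRing E] [Field L] [Module L E] (u : Module.Basis G' L E)

/-- the coarsened grading -/
def gr (g : Γ) : AddSubgroup E where
  carrier := {x | ∀ a, p a ≠ g → u.repr x a = 0}
  zero_mem' := fun a _ => by simp
  add_mem' := fun {x y} hx hy a ha => by simp [hx a ha, hy a ha]
  neg_mem' := fun {x} hx a ha => by simp [hx a ha]

theorem mem_gr (g : Γ) (x : E) : x ∈ gr p u g ↔ ∀ a, p a ≠ g → u.repr x a = 0 := Iff.rfl

theorem smul_u_mem (l : L) (a : G') : l • u a ∈ gr p u (p a) := by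
  intro b hb
  have : b ≠ a := fun h => hb (by rw [h])
  simp [Finsupp.single_apply, this.symm]

theorem gr_isInternal [DecidableEq Γ] : DirectSum.IsInternal (gr p u) := by
  constructor
  · rw [injective_iff_map_eq_zero]
    intro f hf
    have key : ∀ a, u.repr (DirectSum.coeAddMonoidHom (gr p u) f) a = u.repr (f (p a) : E) a := by
      intro a
      clear hf
      induction f using DirectSum.induction_on with
      | zero => simp
      | of g x =>
        rw [DirectSum.coeAddMonoidHom_of]
        by_cases h : g = p a
        · subst h; rw [DirectSum.of_eq_same]
        · rw [DirectSum.of_eq_of_ne _ _ _ (Ne.symm h), x.2 a (Ne.symm h)]; simp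
      | add x y hx hy => rw [map_add, map_add, Finsupp.add_apply, hx, hy]; simp
    apply DFinsupp.ext
    intro g
    apply Subtype.ext
    apply u.repr.injective
    ext a
    by_cases h : p a = g
    · subst h
      have := key a
      rw [hf] at this
      simp only [map_zero] at this
      rw [← this]; simp
    · rw [(f g).2 a h]; simp
  · intro x
    refine ⟨∑ a, DirectSum.of (fun g => gr p u g) (p a) ⟨u.repr x a • u a, smul_u_mem p u _ a⟩, ?_⟩
    rw [map_sum]
    simp only [DirectSum.coeAddMonoidHom_of]
    exact u.sum_repr x

variable [MulSemiringAction G' L] (j : L →+* E) (hj : ∀ (l : L) (x : E), l • x = j l * x)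
  (c : G' → G' → L)
  (huu : ∀ g h, u g * u h = j (c g h) * u (g * h))
  (huj : ∀ g l, u g * j l = j (g • l) * u g) (h1 : u 1 = 1)

include hj in
theorem expd (x : E) : x = ∑ a, j (u.repr x a) * u a := by
  conv_lhs => rw [← u.sum_repr x]
  exact Finset.sum_congr rfl fun a _ => hj _ _

include hj huu huj h1 in
theorem gr_faithful [DecidableEq Γ] (hp : Function.Surjective p) : IsFaithfulGrading (gr p u) where
  one_mem := by
    have := smul_u_mem p u 1 1
    rwa [one_smul, map_one, h1] at this
  mul_mem := by
    intro g h x y hx hy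
    rw [expd u j hj x, expd u j hj y, Finset.sum_mul_sum]
    refine sum_mem fun a _ => sum_mem fun b _ => ?_
    by_cases ha : p a = g
    · by_cases hb : p b = h
      · subst ha hb
        have : j (u.repr x a) * u a * (j (u.repr y b) * u b)
            = (u.repr x a * (a • u.repr y b) * c a b) • u (a * b) := by
          rw [hj, map_mul, map_mul, mul_assoc, mul_assoc, mul_assoc, ← huu, ← mul_assoc (u a), huj,
            mul_assoc]
        rw [this, ← map_mul]
        exact smul_u_mem p u _ _
      · rw [hy b hb]; simp
    · rw [hx a ha]; simp
  isInternal := gr_isInternal p u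
  faithful := by
    intro g h
    obtain ⟨a, rfl⟩ := hp g
    have := smul_u_mem p u 1 a
    rw [h, AddSubgroup.mem_bot, one_smul] at this
    exact u.ne_zero a this

include hj huj in
theorem comm_j (l : L) (y : E) (h : ∀ g, u.repr y g ≠ 0 → g • l = l) : y * j l = j l * y := by
  rw [expd u j hj y, Finset.sum_mul, Finset.mul_sum]
  refine Finset.sum_congr rfl fun a _ => ?_
  by_cases ha : u.repr y a = 0
  · simp [ha]
  · rw [mul_assoc, huj, h a ha, ← mul_assoc, ← mul_assoc, ← map_mul, ← map_mul, mul_comm]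

include hj huj in
theorem finite_center : Module.Finite (Subring.center E) E := by
  haveI : Module.Finite L E := Module.Finite.of_basis u
  haveI : Module.Finite (FixedPoints.subfield G' L) E := Module.Finite.trans L E
  obtain ⟨S, hS⟩ := (Module.Finite.fg_top : (⊤ : Submodule (FixedPoints.subfield G' L) E).FG)
  refine ⟨⟨S, ?_⟩⟩
  rw [eq_top_iff]
  intro x _
  have hx : x ∈ Submodule.span (FixedPoints.subfield G' L) (S : Set E) := by rw [hS]; trivial
  induction hx using Submodule.span_induction with
  | mem x h => exact Submodule.subset_span h
  | zero => exact zero_mem _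
  | add x y _ _ hx hy => exact add_mem (hx trivial) (hy trivial)
  | smul a x _ hx =>
    have hc : j (a : L) ∈ Subring.center E := by
      rw [Subring.mem_center_iff]
      intro y
      exact comm_j u j hj huj _ _ fun g _ => a.2 g
    have : a • x = (⟨j (a : L), hc⟩ : Subring.center E) • x := hj _ _
    rw [this]
    exact Submodule.smul_mem _ _ (hx trivial)

variable (H : Subgroup Γ) (hH : ∀ a : G', p a ∈ H ↔ ∀ l : L, a • l = l)
  (φ' : (H.comap p) → (H.comap p) → L)
  (hφ : ∀ h h' : H.comap p, u h * u h' = j (φ' h h') * (u h' * u h))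
  (hnd : ∀ k : H.comap p, p k = 1 → k ≠ 1 → ∃ k' : H.comap p, p k' = 1 ∧ φ' k k' ≠ 1)

include hj huj hH h1 in
theorem j_mem_Lset (l : L) : j l ∈ Lset (gr p u) := by
  refine ⟨?_, fun y hy => (comm_j u j hj huj l y fun g hg => ?_).symm⟩
  · have := smul_u_mem p u l 1
    rwa [hj, map_one, h1, mul_one] at this
  · have : p g = 1 := by
      by_contra h
      exact hg (hy g h)
    exact (hH g).1 (by rw [this]; exact H.one_mem) l

include hj huj hH h1 hφ hnd in
theorem Lset_eq (x : E) (hx : x ∈ Lset (gr p u)) : x = j (u.repr x 1) := by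
  classical
  have hz : ∀ k, k ≠ 1 → u.repr x k = 0 := by
    intro k hk
    by_cases hpk : p k = 1
    · have hkH : k ∈ H.comap p := by rw [Subgroup.mem_comap, hpk]; exact H.one_mem
      obtain ⟨k', hk', hne⟩ := hnd ⟨k, hkH⟩ hpk (fun h => hk (congrArg Subtype.val h))
      have hku : u k' ∈ gr p u 1 := by
        have := smul_u_mem p u 1 (k' : G')
        rwa [one_smul, hk'] at this
      have hcom := hx.2 _ hku
      let ψ : G' → L := fun a => if h : a ∈ H.comap p then φ' ⟨a, h⟩ k' else 1
      have hcalc : x * u k' = u k' * ∑ a, (u.repr x a * ψ a) • u a := by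
        conv_lhs => rw [expd u j hj x]
        rw [Finset.sum_mul, Finset.mul_sum]
        refine Finset.sum_congr rfl fun a _ => ?_
        by_cases ha : p a = 1
        · have haH : a ∈ H.comap p := by rw [Subgroup.mem_comap, ha]; exact H.one_mem
          have hψ : ψ a = φ' ⟨a, haH⟩ k' := by simp only [ψ]; rw [dif_pos haH]
          have := hφ ⟨a, haH⟩ k'
          simp only at this
          rw [hj, hψ, mul_assoc, this, ← mul_assoc (u k'), huj, (hH k').1 k'.2, map_mul]
          simp only [mul_assoc]
        · rw [hx.1 a ha]; simp
      rw [hcom] at hcalc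
      have hx' := mul_left_cancel₀ (u.ne_zero _) hcalc
      have h2 := congrArg (fun t => u.repr t k) hx'
      rw [u.repr_sum_self] at h2
      have hψ : ψ k = φ' ⟨k, hkH⟩ k' := by simp only [ψ]; rw [dif_pos hkH]
      rw [hψ] at h2
      by_contra h0
      apply hne
      have : u.repr x k * (φ' ⟨k, hkH⟩ k') = u.repr x k * 1 := by rw [mul_one]; exact h2.symm
      exact mul_left_cancel₀ h0 this
    · exact hx.1 k hpk
  conv_lhs => rw [expd u j hj x]
  rw [Finset.sum_eq_single 1, h1, mul_one]
  · intro b _ hb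
    rw [hz b hb]; simp
  · simp

include hj huj hH h1 hφ hnd in
theorem dim_eq [DecidableEq Γ] (hG : IsFaithfulGrading (gr p u)) :
    dimLDe (gr p u) hG = Nat.card p.ker := by
  classical
  unfold dimLDe
  letI : Module ↥(Lring (gr p u) hG) ↥(De (gr p u) hG) :=
    (Subring.inclusion (Lring_le_De (gr p u) hG)).toModule
  let f : De (gr p u) hG →+ (p.ker → L) :=
    { toFun := fun x k => u.repr (x : E) k
      map_zero' := by funext k; simp
      map_add' := fun x y => by funext k; simp }
  have hf : Function.Bijective f := by
    constructor
    · rw [injective_iff_map_eq_zero]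
      intro x hx
      apply Subtype.ext
      apply u.repr.injective
      ext a
      by_cases ha : p a = 1
      · have : u.repr (x : E) a = 0 := congrFun hx ⟨a, ha⟩
        rw [this]; simp
      · have : u.repr (x : E) a = 0 := x.2 a ha
        rw [this]; simp
    · intro F
      let F' : G' → L := fun a => if h : a ∈ p.ker then F ⟨a, h⟩ else 0
      refine ⟨⟨∑ a, F' a • u a, ?_⟩, ?_⟩
      · change _ ∈ gr p u 1
        intro a ha
        rw [u.repr_sum_self]
        exact dif_neg ha
      · funext k
        change u.repr (∑ a, F' a • u a) k = F k
        rw [u.repr_sum_self]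
        exact dif_pos k.2
  let e := AddEquiv.ofBijective f hf
  let i : L → Lring (gr p u) hG := fun l => ⟨j l, j_mem_Lset p u j hj huj h1 H hH l⟩
  have hi : Function.Bijective i := by
    constructor
    · intro a b hab
      exact j.injective (congrArg Subtype.val hab)
    · intro x
      exact ⟨u.repr (x : E) 1,
        Subtype.ext (Lset_eq p u j hj huj h1 H hH φ' hφ hnd x x.2).symm⟩
  have hr := rank_eq_of_equiv_equiv i e.symm hi (fun r m => by
    rw [AddEquiv.symm_apply_eq]
    funext k
    change r * m k = u.repr (j r * (e.symm m : De (gr p u) hG)) k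
    rw [← hj, map_smul, Finsupp.smul_apply, smul_eq_mul]
    congr 1
    have : e (e.symm m) k = m k := by rw [AddEquiv.apply_symm_apply]
    exact this.symm)
  rw [Module.finrank, ← hr, Nat.card_eq_fintype_card]
  exact Module.finrank_fintype_fun_eq_card L

include hj huj hH h1 hφ hnd in
theorem Hset_eq (hp : Function.Surjective p) (g : Γ) : g ∈ H ↔ g ∈ Hset (gr p u) := by
  constructor
  · intro hg x hx l hl
    rw [Lset_eq p u j hj huj h1 H hH φ' hφ hnd l hl]
    refine comm_j u j hj huj _ _ fun a ha => ?_
    have : p a = g := by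
      by_contra h
      exact ha (hx a h)
    exact (hH a).1 (this ▸ hg) _
  · intro h
    obtain ⟨a, rfl⟩ := hp g
    rw [hH]
    intro l
    have hua := smul_u_mem p u 1 a
    rw [one_smul] at hua
    have := h _ hua _ (j_mem_Lset p u j hj huj h1 H hH l)
    rw [huj] at this
    exact j.injective (mul_right_cancel₀ (u.ne_zero a) this)

include hj huj hH hφ in
theorem central (s : H.comap p) (hs : ∀ k : H.comap p, p k = 1 → φ' s k = 1) (x : E)
    (hx : x ∈ gr p u 1) : u s * x = x * u s := by
  rw [expd u j hj x, Finset.sum_mul, Finset.mul_sum]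
  refine Finset.sum_congr rfl fun a _ => ?_
  by_cases ha : p a = 1
  · have haH : a ∈ H.comap p := by rw [Subgroup.mem_comap, ha]; exact H.one_mem
    have := hφ s ⟨a, haH⟩
    rw [hs _ ha, map_one, one_mul] at this
    rw [← mul_assoc, huj, (hH s).1 s.2, mul_assoc, mul_assoc, this]
  · rw [hx a ha]; simp

end
end GDA

namespace GDA

theorem exists_omega (d : ℕ) (hd : 0 < d) :
    ∃ ω : Multiplicative (ZMod d × ZMod d) → Multiplicative (ZMod d × ZMod d) → ℂˣ,
      (∀ a b c, ω (a * b) c = ω a c * ω b c) ∧ (∀ a b c, ω a (b * c) = ω a b * ω a c) ∧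
      (∀ a, ω a a = 1) ∧ (∀ a, a ≠ 1 → ∃ b, ω a b ≠ 1) := by
  haveI : NeZero d := ⟨hd.ne'⟩
  let χ : Multiplicative (ZMod d) →* ℂˣ :=
    MonoidHom.toHomUnits (AddChar.toMonoidHom (ZMod.stdAddChar (N := d)))
  have hχ : ∀ a : ZMod d, χ (Multiplicative.ofAdd a) = 1 → a = 0 := by
    intro a ha
    have h2 : ZMod.stdAddChar (N := d) a = 1 := congrArg Units.val ha
    apply ZMod.injective_stdAddChar (N := d)
    rw [h2, AddChar.map_zero_eq_one]
  refine ⟨fun a b => χ (Multiplicative.ofAdd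
    (a.toAdd.1 * b.toAdd.2 - b.toAdd.1 * a.toAdd.2)), ?_, ?_, ?_, ?_⟩
  · intro a b c
    beta_reduce
    rw [← map_mul, ← ofAdd_add]
    congr 2
    simp only [toAdd_mul, Prod.fst_add, Prod.snd_add]
    ring
  · intro a b c
    beta_reduce
    rw [← map_mul, ← ofAdd_add]
    congr 2
    simp only [toAdd_mul, Prod.fst_add, Prod.snd_add]
    ring
  · intro a
    beta_reduce
    rw [sub_self, ofAdd_zero, map_one]
  · intro a ha
    by_contra hcon
    push Not at hcon
    apply ha
    have e1 := hχ _ (hcon (Multiplicative.ofAdd (0, 1)))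
    have e2 := hχ _ (hcon (Multiplicative.ofAdd (1, 0)))
    simp at e1 e2
    have : a.toAdd = 0 := Prod.ext e1 e2
    exact this

end GDA

theorem exists_graded_division_algebra_realizing_data
    [Finite G] (H : Subgroup G) (hHn : H.Normal)
    (hHab : ∀ a ∈ H, ∀ b ∈ H, a * b = b * a)
    (d : ℕ) (hd : 0 < d)
    (φ : ↥H → ↥H → ℂˣ)
    (hmul₁ : ∀ h₁ h₂ h' : ↥H, φ (h₁ * h₂) h' = φ h₁ h' * φ h₂ h')
    (hmul₂ : ∀ h h₁ h₂ : ↥H, φ h (h₁ * h₂) = φ h h₁ * φ h h₂)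
    (halt : ∀ h : ↥H, φ h h = 1)
    (hinv : ∀ (g : G) (h h' : ↥H),
      φ ⟨g * h * g⁻¹, hHn.conj_mem h.1 h.2 g⟩ ⟨g * h' * g⁻¹, hHn.conj_mem h'.1 h'.2 g⟩
        = φ h h') :
    ∃ (D : Type) (_ : DivisionRing D) (_ : CharZero D)
      (𝒜 : G → AddSubgroup D) (hG : IsFaithfulGrading 𝒜) (ι : ℂ →+* D),
      -- `D` is finite dimensional over its center `K`
      Module.Finite ↥(Subring.center D) D ∧
      -- the image of `ι` is contained in `K ∩ D_e`
      (∀ z : ℂ, ι z ∈ Subring.center D ∧ ι z ∈ 𝒜 1) ∧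
      -- (i) `dim_L D_e = d²`
      dimLDe 𝒜 hG = d ^ 2 ∧
      -- (ii) `H` is the kernel of the conjugation action of `G` on `L`
      (∀ g : G, g ∈ H ↔ g ∈ Hset 𝒜) ∧
      -- (iii) `φ` is realized by commutators of homogeneous elements centralizing `D_e`
      (∀ h h' : ↥H, ∃ x : D, x ≠ 0 ∧ x ∈ 𝒜 (h : G) ∧ (∀ a ∈ 𝒜 1, x * a = a * x) ∧
        ∃ y : D, y ≠ 0 ∧ y ∈ 𝒜 (h' : G) ∧ (∀ a ∈ 𝒜 1, y * a = a * y) ∧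
          x * y = ι (φ h h' : ℂ) * (y * x)) := by
  classical
  obtain ⟨ω, hω₁, hω₂, hωa, hωn⟩ := GDA.exists_omega d hd
  haveI : NeZero d := ⟨hd.ne'⟩
  haveI : Finite (Shrink.{0} G) := Finite.of_equiv G (equivShrink.{0} G)
  let e : Shrink.{0} G ≃* G := Shrink.mulEquiv
  letI : Fintype (Shrink.{0} G × Multiplicative (ZMod d × ZMod d)) := Fintype.ofFinite _
  let p : Shrink.{0} G × Multiplicative (ZMod d × ZMod d) →* G :=
    e.toMonoidHom.comp (MonoidHom.fst _ _)
  have hpdef : ∀ a, p a = e a.1 := fun _ => rfl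
  have hp : Function.Surjective p := fun g => ⟨(e.symm g, 1), e.apply_symm_apply g⟩
  have hφ1 : ∀ h, φ 1 h = 1 := fun h => by
    have := hmul₁ 1 1 h
    simpa using this
  have hφ1' : ∀ h, φ h 1 = 1 := fun h => by
    have := hmul₂ h 1 1
    simpa using this
  have hω1 : ∀ a, ω a 1 = 1 := fun a => by
    have := hω₂ a 1 1
    simpa using this
  have hω1' : ∀ a, ω 1 a = 1 := fun a => by
    have := hω₁ 1 1 a
    simpa using this
  let φ' : H.comap p → H.comap p → ℂˣ := fun a b =>
    φ ⟨p a, a.2⟩ ⟨p b, b.2⟩ * ω a.1.2 b.1.2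
  have hφ'def : ∀ a b, φ' a b = φ ⟨p a, a.2⟩ ⟨p b, b.2⟩ * ω a.1.2 b.1.2 := fun _ _ => rfl
  have hn' : (H.comap p).Normal := hHn.comap p
  obtain ⟨D, iD, L, iL, iA, iM, j, u, c, ι, hj, h1, huu, huj, hι, hH, hcom⟩ :=
    GDA.exists_crossed (H.comap p) hn'
      (by
        intro a ha b hb
        refine Prod.ext (e.injective ?_) (mul_comm _ _)
        rw [Prod.fst_mul, Prod.fst_mul, map_mul, map_mul]
        exact hHab _ ha _ hb)
      φ'
      (by
        intro a b x
        rw [hφ'def, hφ'def, hφ'def, mul_mul_mul_comm, ← hmul₁, ← hω₁]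
        congr 2
        exact Subtype.ext (map_mul p _ _))
      (by
        intro a b x
        rw [hφ'def, hφ'def, hφ'def, mul_mul_mul_comm, ← hmul₂, ← hω₂]
        congr 2
        exact Subtype.ext (map_mul p _ _))
      (by
        intro a
        rw [hφ'def, halt, hωa, one_mul])
      (by
        intro g a b
        rw [hφ'def, hφ'def, ← hinv (p g) ⟨p a, a.2⟩ ⟨p b, b.2⟩]
        congr 1
        · congr 1 <;> exact Subtype.ext (by simp only [map_mul, map_inv])
        · congr 1 <;> simp [mul_inv_cancel_comm])
  have hH' : ∀ a, p a ∈ H ↔ ∀ l : L, a • l = l := fun a => hH a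
  have hnd : ∀ k : H.comap p, p k = 1 → k ≠ 1 →
      ∃ k' : H.comap p, p k' = 1 ∧ ι (φ' k k' : ℂ) ≠ 1 := by
    intro k hk hne
    have h2 : k.1.2 ≠ 1 := by
      intro h
      apply hne
      refine Subtype.ext (Prod.ext ?_ h)
      exact e.injective (hk.trans (map_one e).symm)
    obtain ⟨b, hb⟩ := hωn _ h2
    have hb1 : p (1, b) = 1 := map_one e
    refine ⟨⟨(1, b), by rw [Subgroup.mem_comap, hb1]; exact H.one_mem⟩, hb1, ?_⟩
    intro h
    apply hb
    have h3 := ι.injective (h.trans (map_one ι).symm)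
    rw [Units.val_eq_one, hφ'def] at h3
    have h4 : (⟨p k, k.2⟩ : H) = 1 := Subtype.ext hk
    rw [h4, hφ1, one_mul] at h3
    exact h3
  have hG := GDA.gr_faithful p u j hj c huu huj h1 hp
  have hιc : ∀ z : ℂ, j (ι z) ∈ Subring.center D := by
    intro z
    rw [Subring.mem_center_iff]
    intro y
    exact GDA.comm_j u j hj huj _ _ fun g _ => hι g z
  have hCZ : CharZero D := charZero_of_injective_ringHom (j.comp ι).injective
  refine ⟨D, iD, hCZ, GDA.gr p u, hG, j.comp ι, GDA.finite_center u j hj huj, ?_, ?_, ?_, ?_⟩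
  · intro z
    exact ⟨hιc z, (GDA.j_mem_Lset p u j hj huj h1 H hH' (ι z)).1⟩
  · rw [GDA.dim_eq p u j hj huj h1 H hH' (fun a b => ι (φ' a b : ℂ)) hcom hnd hG]
    let q : p.ker ≃ Multiplicative (ZMod d × ZMod d) :=
      { toFun := fun k => k.1.2
        invFun := fun v => ⟨(1, v), map_one e⟩
        left_inv := fun k => Subtype.ext (Prod.ext
          (e.injective ((map_one e).trans (k.2 : e k.1.1 = 1).symm)) rfl)
        right_inv := fun _ => rfl }
    rw [Nat.card_congr q, Nat.card_congr Multiplicative.toAdd, Nat.card_prod, Nat.card_zmod, sq]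
  · exact GDA.Hset_eq p u j hj huj h1 H hH' (fun a b => ι (φ' a b : ℂ)) hcom hnd hp
  · have hps : ∀ h : G, p (e.symm h, 1) = h := fun h => e.apply_symm_apply h
    have hmem : ∀ h : H, (e.symm (h : G), 1) ∈ H.comap p := fun h => by
      rw [Subgroup.mem_comap, hps]; exact h.2
    have hgr : ∀ h : H, u (e.symm (h : G), 1) ∈ GDA.gr p u (h : G) := fun h => by
      have := GDA.smul_u_mem p u 1 (e.symm (h : G), 1)
      rwa [one_smul, hps] at this
    have hce : ∀ (h : H), ∀ a ∈ GDA.gr p u (1 : G),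
        u (e.symm (h : G), 1) * a = a * u (e.symm (h : G), 1) := by
      intro h a ha
      refine GDA.central p u j hj huj H hH' (fun a b => ι (φ' a b : ℂ)) hcom
        ⟨_, hmem h⟩ (fun k hk => ?_) a ha
      have h4 : (⟨p k, k.2⟩ : H) = 1 := Subtype.ext hk
      have h5 : φ' ⟨_, hmem h⟩ k = 1 := by
        rw [hφ'def, h4, hφ1', hω1', one_mul]
      beta_reduce
      rw [h5, Units.val_one, map_one]
    intro h h'
    refine ⟨u (e.symm (h : G), 1), u.ne_zero _, hgr h, hce h,
      u (e.symm (h' : G), 1), u.ne_zero _, hgr h', hce h', ?_⟩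
    have h6 := hcom ⟨_, hmem h⟩ ⟨_, hmem h'⟩
    have h7 : φ' ⟨_, hmem h⟩ ⟨_, hmem h'⟩ = φ h h' := by
      rw [hφ'def, hω1, mul_one]
      congr 1 <;> exact Subtype.ext (hps _)
    rw [h7] at h6
    exact h6
end

section
/- Let G be a finite group and H an abelian normal subgroup of G. Then there exists a division ring D of characteristic zero, finite-dimensional as a vector space over its center K, equipped with a faithful G-grading, such that: D_e is a field L; every homogeneous component D_g is a one-dimensional left L-vector space; the subring D_H = ⊕_{h ∈ H} D_h is commutative (hence a field); H = {g ∈ G : x·l = l·x for every x ∈ D_g and every l ∈ L}; and dim_K D = [G:H]² (so D is a crossed-product division algebra of degree [G:H]). -/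
variable {G : Type*} [Group G] [DecidableEq G] {D : Type*} [DivisionRing D]

/-- `D_N`, the sum `⊕_{n ∈ N} D_n` of the homogeneous components over a subset `N` of
`G`, as an additive subgroup of `D`. -/
def DN (𝒜 : G → AddSubgroup D) (N : Set G) : AddSubgroup D := ⨆ g : N, 𝒜 (g : G)

set_option linter.unusedSectionVars false


namespace CPDA
open MvPolynomial

section Poly
variable {σ T k : Type*} [Field k]

/-- decomposition into a finite sum of weighted components -/
lemma sum_comp_image [AddCommGroup T] [DecidableEq T] (w : σ → T) (a : MvPolynomial σ k) :
    a = ∑ s ∈ a.support.image (Finsupp.weight w), weightedHomogeneousComponent w s a := by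
  ext d
  rw [coeff_sum]
  simp only [coeff_weightedHomogeneousComponent]
  by_cases h : coeff d a = 0
  · simp [h]
  · rw [Finset.sum_ite_eq, if_pos]
    exact Finset.mem_image_of_mem _ (mem_support_iff.2 h)

lemma comp_ne_zero [AddCommGroup T] [DecidableEq T] (w : σ → T) (a : MvPolynomial σ k) (s : T)
    (hs : s ∈ a.support.image (Finsupp.weight w)) : weightedHomogeneousComponent w s a ≠ 0 := by
  obtain ⟨d, hd, rfl⟩ := Finset.mem_image.1 hs
  intro h
  have := congrArg (coeff d) h
  rw [coeff_weightedHomogeneousComponent, if_pos rfl, coeff_zero] at this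
  exact (mem_support_iff.1 hd) this

lemma comp_mul_of_unique [AddCommGroup T] [DecidableEq T] (w : σ → T) (a b : MvPolynomial σ k)
    (s t : T) (hs : s ∈ a.support.image (Finsupp.weight w))
    (ht : t ∈ b.support.image (Finsupp.weight w))
    (hu : UniqueAdd (a.support.image (Finsupp.weight w)) (b.support.image (Finsupp.weight w)) s t) :
    weightedHomogeneousComponent w (s + t) (a * b) =
      weightedHomogeneousComponent w s a * weightedHomogeneousComponent w t b := by
  conv_lhs => rw [sum_comp_image w a, sum_comp_image w b, Finset.sum_mul_sum]
  simp only [map_sum]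
  rw [Finset.sum_eq_single_of_mem s hs, Finset.sum_eq_single_of_mem t ht]
  · exact ((weightedHomogeneousComponent_isWeightedHomogeneous _ _).mul
      (weightedHomogeneousComponent_isWeightedHomogeneous _ _)).weightedHomogeneousComponent_same
  · intro t' ht' hne
    refine ((weightedHomogeneousComponent_isWeightedHomogeneous s a).mul
      (weightedHomogeneousComponent_isWeightedHomogeneous t' b)).weightedHomogeneousComponent_ne _ ?_
    intro h
    exact hne (hu hs ht' h.symm).2
  · intro s' hs' hne
    refine Finset.sum_eq_zero fun t' ht' => ?_
    refine ((weightedHomogeneousComponent_isWeightedHomogeneous s' a).mul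
      (weightedHomogeneousComponent_isWeightedHomogeneous t' b)).weightedHomogeneousComponent_ne _ ?_
    intro h
    exact hne (hu hs' ht' h.symm).1

/-- factors of weighted homogeneous polynomials are weighted homogeneous -/
lemma homog_factor [AddCommGroup T] [TwoUniqueSums T] (w : σ → T) (a b : MvPolynomial σ k)
    (n : T) (hab : IsWeightedHomogeneous w (a * b) n) (h0 : a * b ≠ 0) :
    ∃ s, IsWeightedHomogeneous w a s := by
  classical
  have ha : a ≠ 0 := left_ne_zero_of_mul h0
  have hb : b ≠ 0 := right_ne_zero_of_mul h0
  set A := a.support.image (Finsupp.weight w) with hA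
  set B := b.support.image (Finsupp.weight w) with hB
  have hA0 : A.Nonempty := by simpa [hA] using ha
  have hB0 : B.Nonempty := by simpa [hB] using hb
  have key : ∀ s ∈ A, ∀ t ∈ B, UniqueAdd A B s t → s + t = n := by
    intro s hs t ht hu
    by_contra hne
    have h1 := comp_mul_of_unique w a b s t hs ht hu
    rw [hab.weightedHomogeneousComponent_ne _ hne] at h1
    exact mul_ne_zero (comp_ne_zero w a s hs) (comp_ne_zero w b t ht) h1.symm
  have hcard : ¬ (1 < A.card * B.card) := by
    intro h
    obtain ⟨p1, h1, p2, h2, hne, u1, u2⟩ := TwoUniqueSums.uniqueAdd_of_one_lt_card h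
    rw [Finset.mem_product] at h1 h2
    have e1 := key _ h1.1 _ h1.2 u1
    have e2 := key _ h2.1 _ h2.2 u2
    have := u1 h2.1 h2.2 (e2.trans e1.symm)
    exact hne (Prod.ext this.1.symm this.2.symm)
  have hA1 : A.card = 1 := by
    have h1 := hA0.card_pos
    have h2 := hB0.card_pos
    nlinarith
  obtain ⟨s, hs⟩ := Finset.card_eq_one.1 hA1
  refine ⟨s, fun d hd => ?_⟩
  have : Finsupp.weight w d ∈ A := Finset.mem_image_of_mem _ (mem_support_iff.2 hd)
  rw [hs] at this
  simpa using this

/-- pushing weights along a hom -/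
lemma homog_map {T' : Type*} [AddCommGroup T] [AddCommGroup T'] (f : T →+ T') (w : σ → T)
    (w' : σ → T') (hw : ∀ i, w' i = f (w i)) (a : MvPolynomial σ k) (n : T)
    (h : IsWeightedHomogeneous w a n) : IsWeightedHomogeneous w' a (f n) := by
  intro d hd
  rw [← h hd]
  simp [Finsupp.weight_apply, Finsupp.sum, hw]

lemma homog_rename {T' : Type*} [AddCommGroup T] [AddCommGroup T'] (f : T →+ T') (w : σ → T)
    (w' : σ → T') (e : σ ≃ σ) (hw : ∀ i, w' (e i) = f (w i)) (a : MvPolynomial σ k) (n : T)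
    (h : IsWeightedHomogeneous w a n) : IsWeightedHomogeneous w' (rename e a) (f n) := by
  intro d hd
  obtain ⟨u, hu, hc⟩ := coeff_rename_ne_zero _ _ _ hd
  rw [← h hc, ← hu]
  rw [Finsupp.weight_apply, Finsupp.weight_apply, Finsupp.sum_mapDomain_index (by simp)
    (by intros; rw [add_smul])]
  simp [Finsupp.sum, hw]

end Poly

section UFD
variable {R : Type*} [CommRing R] [IsDomain R] [UniqueFactorizationMonoid R]

def NFree (N : ℕ) (f : R) : Prop := ∀ p, Prime p → ¬ p ^ N ∣ f

lemma exists_nfree (N : ℕ) (hN : 0 < N) (f : R) (hf : f ≠ 0) :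
    ∃ f0 f1, f = f0 * f1 ^ N ∧ NFree N f0 := by
  revert hf
  refine WellFounded.induction (wellFounded_dvdNotUnit (α := R)) (C := fun f =>
    f ≠ 0 → ∃ f0 f1, f = f0 * f1 ^ N ∧ NFree N f0) f ?_
  · intro f ih hf
    by_cases h : NFree N f
    · exact ⟨f, 1, by simp, h⟩
    · simp only [NFree, not_forall, not_not] at h
      obtain ⟨p, hp, f', rfl⟩ := h
      obtain ⟨f0, f1, h1, h2⟩ := ih f' ⟨right_ne_zero_of_mul hf, p ^ N, by
        rw [isUnit_pow_iff hN.ne']; exact hp.not_isUnit, mul_comm _ _⟩ (right_ne_zero_of_mul hf)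
      exact ⟨f0, p * f1, by rw [h1]; ring, h2⟩

lemma nfree_dvd (N : ℕ) (a b s t : R) (ha : NFree N a) (hb : NFree N b) (ha0 : a ≠ 0) (hb0 : b ≠ 0)
    (hs : s ≠ 0) (ht : t ≠ 0) (h : a * s ^ N = b * t ^ N) : a ∣ b := by
  rw [UniqueFactorizationMonoid.dvd_iff_emultiplicity_le ha0]
  intro p hp
  have fin : ∀ x : R, x ≠ 0 → FiniteMultiplicity p x := fun x hx =>
    FiniteMultiplicity.of_prime_left hp hx
  have h' := congrArg (emultiplicity p) h
  rw [emultiplicity_mul hp, emultiplicity_mul hp, emultiplicity_pow hp, emultiplicity_pow hp,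
    (fin a ha0).emultiplicity_eq_multiplicity, (fin b hb0).emultiplicity_eq_multiplicity,
    (fin s hs).emultiplicity_eq_multiplicity, (fin t ht).emultiplicity_eq_multiplicity] at h'
  rw [(fin a ha0).emultiplicity_eq_multiplicity, (fin b hb0).emultiplicity_eq_multiplicity]
  have h1 : multiplicity p a < N := (fin a ha0).multiplicity_lt_iff_not_dvd.2 (ha p hp)
  have h2 : multiplicity p b < N := (fin b hb0).multiplicity_lt_iff_not_dvd.2 (hb p hp)
  norm_cast at h' ⊢
  have := congrArg (· % N) h'
  simp only [Nat.add_mul_mod_self_left, Nat.mod_eq_of_lt h1, Nat.mod_eq_of_lt h2] at this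
  exact this.le

end UFD
set_option linter.unusedSectionVars false

section Frac
variable {σ T : Type*} [AddCommGroup T] {E : Type*} [Field E] [Algebra (MvPolynomial σ ℚ) E]
  [IsFractionRing (MvPolynomial σ ℚ) E]

local notation "RR" => MvPolynomial σ ℚ

lemma am_ne {a : RR} (h : a ≠ 0) : algebraMap RR E a ≠ 0 :=
  IsFractionRing.to_map_ne_zero_of_mem_nonZeroDivisors (mem_nonZeroDivisors_of_ne_zero h)

variable (E) in
/-- homogeneous fractions of degree `t`. -/
def HF (w : σ → T) (t : T) : AddSubgroup E where
  carrier := {e | ∃ (a b : RR) (s : T), b ≠ 0 ∧ IsWeightedHomogeneous w a (s + t) ∧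
    IsWeightedHomogeneous w b s ∧ e = algebraMap RR E a / algebraMap RR E b}
  zero_mem' := ⟨0, 1, 0, one_ne_zero, isWeightedHomogeneous_zero _ _ _,
    isWeightedHomogeneous_one _ _, by simp⟩
  add_mem' := by
    rintro _ _ ⟨a, b, s, hb, ha', hb', rfl⟩ ⟨c, d, u, hd, hc', hd', rfl⟩
    refine ⟨a * d + c * b, b * d, s + u, mul_ne_zero hb hd, ?_, hb'.mul hd', ?_⟩
    · refine IsWeightedHomogeneous.add ?_ ?_
      · convert ha'.mul hd' using 1; abel
      · convert hc'.mul hb' using 1; abel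
    · have h1 := am_ne (E := E) hb
      have h2 := am_ne (E := E) hd
      rw [map_add, map_mul, map_mul, map_mul]
      field_simp
  neg_mem' := by
    rintro _ ⟨a, b, s, hb, ha', hb', rfl⟩
    exact ⟨-a, b, s, hb, ha'.neg, hb', by rw [map_neg, neg_div]⟩

lemma HF_mul {w : σ → T} {t u : T} {e f : E} (he : e ∈ HF E w t) (hf : f ∈ HF E w u) :
    e * f ∈ HF E w (t + u) := by
  obtain ⟨a, b, s, hb, ha', hb', rfl⟩ := he
  obtain ⟨c, d, v, hd, hc', hd', rfl⟩ := hf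
  refine ⟨a * c, b * d, s + v, mul_ne_zero hb hd, ?_, hb'.mul hd', ?_⟩
  · convert ha'.mul hc' using 1; abel
  · rw [map_mul, map_mul, div_mul_div_comm]

lemma HF_inv {w : σ → T} {t : T} {e : E} (he : e ∈ HF E w t) :
    e⁻¹ ∈ HF E w (-t) := by
  obtain ⟨a, b, s, hb, ha', hb', rfl⟩ := he
  by_cases ha : a = 0
  · simp [ha, (HF E w (-t)).zero_mem]
  refine ⟨b, a, s + t, ha, ?_, ha', ?_⟩
  · convert hb' using 1; abel
  · rw [inv_div]

lemma HF_one (w : σ → T) : (1 : E) ∈ HF E w 0 :=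
  ⟨1, 1, 0, one_ne_zero, by simpa using isWeightedHomogeneous_one _ _,
    isWeightedHomogeneous_one _ _, by simp⟩

lemma HF_poly {w : σ → T} {t : T} {a : RR} (h : IsWeightedHomogeneous w a t) :
    algebraMap RR E a ∈ HF E w t :=
  ⟨a, 1, 0, one_ne_zero, by simpa using h, isWeightedHomogeneous_one _ _, by simp⟩

lemma HF_X (w : σ → T) (i : σ) : algebraMap RR E (X i) ∈ HF E w (w i) :=
  HF_poly (isWeightedHomogeneous_X _ _ _)

lemma HF_pow {w : σ → T} {t : T} {e : E} (he : e ∈ HF E w t) (n : ℕ) :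
    e ^ n ∈ HF E w (n • t) := by
  induction n with
  | zero => simpa using HF_one w
  | succ n ih => rw [pow_succ, succ_nsmul]; exact HF_mul ih he

lemma HF_prod {ι : Type*} (S : Finset ι) {w : σ → T} (t : ι → T) (e : ι → E)
    (he : ∀ i ∈ S, e i ∈ HF E w (t i)) : ∏ i ∈ S, e i ∈ HF E w (∑ i ∈ S, t i) := by
  classical
  induction S using Finset.induction_on with
  | empty => simpa using HF_one w
  | insert i S hi ih =>
    rw [Finset.prod_insert hi, Finset.sum_insert hi]
    exact HF_mul (he i (by simp)) (ih fun j hj => he j (by simp [hj]))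

lemma HF_map {T' : Type*} [AddCommGroup T'] (f : T →+ T') (w : σ → T)
    (w' : σ → T') (hw : ∀ i, w' i = f (w i)) {t : T} {e : E} (he : e ∈ HF E w t) :
    e ∈ HF E w' (f t) := by
  obtain ⟨a, b, s, hb, ha', hb', rfl⟩ := he
  exact ⟨a, b, f s, hb, by simpa using homog_map f w w' hw _ _ ha', homog_map f w w' hw _ _ hb', rfl⟩

lemma HF_rename {T' : Type*} [AddCommGroup T'] (f : T →+ T') (w : σ → T)
    (w' : σ → T') (e : σ ≃ σ) (hw : ∀ i, w' (e i) = f (w i)) (φ : E →+* E)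
    (hφ : ∀ a, φ (algebraMap RR E a) = algebraMap RR E (rename e a))
    {t : T} {y : E} (he : y ∈ HF E w t) : φ y ∈ HF E w' (f t) := by
  obtain ⟨a, b, s, hb, ha', hb', rfl⟩ := he
  refine ⟨rename e a, rename e b, f s, ?_, by simpa using homog_rename f w w' e hw _ _ ha',
    homog_rename f w w' e hw _ _ hb', ?_⟩
  · exact fun h => hb (rename_injective e e.injective (by rw [h, map_zero]))
  · rw [map_div₀, hφ, hφ]

/-- independence of homogeneous fractions of distinct degrees. -/
lemma HF_indep {ι : Type*} (S : Finset ι) (w : σ → T) (t : ι → T) (ht : Set.InjOn t S)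
    (e : ι → E) (he : ∀ i ∈ S, e i ∈ HF E w (t i)) (h0 : ∑ i ∈ S, e i = 0) :
    ∀ i ∈ S, e i = 0 := by
  classical
  have hcd : ∃ (B : RR) (s : T), B ≠ 0 ∧ IsWeightedHomogeneous w B s ∧ ∀ i ∈ S, ∃ a : RR,
      IsWeightedHomogeneous w a (s + t i) ∧ e i = algebraMap RR E a / algebraMap RR E B := by
    clear h0 ht
    induction S using Finset.induction_on with
    | empty => exact ⟨1, 0, one_ne_zero, isWeightedHomogeneous_one _ _, by simp⟩
    | insert i S hi ih =>
      obtain ⟨B, s, hB, hB', h⟩ := ih fun j hj => he j (by simp [hj])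
      obtain ⟨a, b, u, hb, ha', hb', hab⟩ := he i (by simp)
      have h1 := am_ne (E := E) hb
      have h2 := am_ne (E := E) hB
      refine ⟨B * b, s + u, mul_ne_zero hB hb, hB'.mul hb', fun j hj => ?_⟩
      rcases Finset.mem_insert.1 hj with rfl | hj
      · refine ⟨B * a, ?_, ?_⟩
        · rw [add_assoc]; exact hB'.mul ha'
        · rw [hab, map_mul, map_mul]; field_simp
      · obtain ⟨c, hc, hc'⟩ := h j hj
        refine ⟨c * b, ?_, ?_⟩
        · convert hc.mul hb' using 1; abel
        · rw [hc', map_mul, map_mul]; field_simp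
  obtain ⟨B, s, hB, hB', h⟩ := hcd
  have h2 := am_ne (E := E) hB
  choose! a ha ha' using h
  have hsum : ∑ i ∈ S, a i = 0 := by
    apply IsFractionRing.injective RR E
    rw [map_sum, map_zero]
    have : ∑ i ∈ S, algebraMap RR E (a i) = (∑ i ∈ S, e i) * algebraMap RR E B := by
      rw [Finset.sum_mul]
      refine Finset.sum_congr rfl fun i hi => ?_
      rw [ha' i hi]; field_simp
    rw [this, h0, zero_mul]
  intro i hi
  have h3 := congrArg (weightedHomogeneousComponent w (s + t i)) hsum
  rw [map_sum, map_zero, Finset.sum_eq_single_of_mem i hi,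
    (ha i hi).weightedHomogeneousComponent_same] at h3
  · rw [ha' i hi, h3]; simp
  · intro j hj hne
    apply (ha j hj).weightedHomogeneousComponent_ne
    intro h
    exact hne (ht hj hi (add_left_cancel h).symm)

end Frac

/-- the combinatorial data behind the construction -/
structure Dat (Γ Q T : Type) [Group Γ] [Group Q] [DecidableEq Q] [AddCommGroup T] where
  π : Γ →* Q
  surj : Function.Surjective π
  ρ : Q →* AddMonoid.End T
  t : Γ → T
  ht : ∀ g h, t (g * h) = t g + ρ (π g) (t h)
  hinj : ∀ g h, π g = π h → t g = t h → g = h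
  p1 : T →+ (Q → ℤ)
  hp1 : ∀ g, p1 (t g) = Pi.single (π g) 1 - Pi.single 1 1
  hp1ρ : ∀ q x r, p1 (ρ q x) r = p1 x (q⁻¹ * r)

namespace Dat
variable {Γ Q T : Type} [Group Γ] [Group Q] [DecidableEq Q] [AddCommGroup T] (A : Dat Γ Q T)

def w (i : Γ × Q) : T := A.ρ i.2 (A.t i.1)
def w1 (i : Γ × Q) : Q → ℤ := A.p1 (A.w i)

def shift (q : Q) : (Q → ℤ) →+ (Q → ℤ) where
  toFun f := fun r => f (q⁻¹ * r)
  map_zero' := rfl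
  map_add' _ _ := rfl

def eqv (Γ : Type) (q : Q) : Γ × Q ≃ Γ × Q := (Equiv.refl Γ).prodCongr (Equiv.mulLeft q)

lemma w_eqv (q : Q) (i : Γ × Q) : A.w (eqv Γ q i) = A.ρ q (A.w i) := by
  simp [w, eqv]

lemma w1_eqv (q : Q) (i : Γ × Q) : A.w1 (eqv Γ q i) = shift q (A.w1 i) := by
  ext r
  simp [w1, w_eqv, hp1ρ, shift]

lemma w1_one (g : Γ) : A.w1 (g, 1) = Pi.single (A.π g) 1 - Pi.single 1 1 := by
  simp [w1, w, A.hp1]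

lemma w1_sum [Fintype Q] (i : Γ × Q) : ∑ r, A.w1 i r = 0 := by
  have : ∀ r, A.w1 i r = A.p1 (A.t i.1) (i.2⁻¹ * r) := by
    intro r; simp [w1, w, A.hp1ρ]
  simp only [this]
  refine (Equiv.sum_comp (Equiv.mulLeft i.2⁻¹) (fun r => A.p1 (A.t i.1) r)).trans ?_
  simp [A.hp1]

lemma deg_sum [Fintype Q] (f : MvPolynomial (Γ × Q) ℚ) (hf : f ≠ 0) (τ : Q → ℤ)
    (h : IsWeightedHomogeneous A.w1 f τ) : ∑ r, τ r = 0 := by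
  obtain ⟨d, hd⟩ := exists_coeff_ne_zero hf
  rw [← h hd]
  simp only [Finsupp.weight_apply, Finsupp.sum, Finset.sum_apply, Pi.smul_apply]
  rw [Finset.sum_comm]
  refine Finset.sum_eq_zero fun i _ => ?_
  rw [← Finset.smul_sum, w1_sum, smul_zero]

/-- invariant-up-to-`N`th-powers homogeneous polynomials have degree divisible by `N`. -/
lemma deg_dvd [Fintype Q] (N : ℕ) (hN : 0 < N) (f : MvPolynomial (Γ × Q) ℚ) (hf : f ≠ 0) (δ : Q → ℤ)
    (h : IsWeightedHomogeneous A.w1 f δ)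
    (hinv : ∀ q, ∃ s u : MvPolynomial (Γ × Q) ℚ, s ≠ 0 ∧ u ≠ 0 ∧
      rename (eqv Γ q) f * s ^ N = f * u ^ N) :
    ∃ ε : Q → ℤ, δ = N • ε := by
  obtain ⟨f0, f1, hff, hfree⟩ := exists_nfree N hN f hf
  have hf0 : f0 ≠ 0 := by rintro rfl; simp at hff; exact hf hff
  have hf1 : f1 ^ N ≠ 0 := by intro h; simp [h] at hff; exact hf hff
  have hf1' : f1 ≠ 0 := by rintro rfl; simp [hN.ne'] at hf1
  obtain ⟨τ, hτ⟩ := homog_factor A.w1 f0 (f1 ^ N) δ (hff ▸ h) (hff ▸ hf)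
  obtain ⟨ε, hε⟩ : ∃ ε, IsWeightedHomogeneous A.w1 f1 ε := by
    obtain ⟨n, rfl⟩ : ∃ n, N = n + 1 := ⟨N - 1, by omega⟩
    have e : f1 * (f0 * f1 ^ n) = f := by rw [hff]; ring
    refine homog_factor A.w1 f1 (f0 * f1 ^ n) δ ?_ ?_
    · rw [e]; exact h
    · rw [e]; exact hf
  have hδ : δ = τ + N • ε := by
    refine IsWeightedHomogeneous.inj_right hf h ?_
    rw [hff]; exact hτ.mul (hε.pow N)
  have hτinv : ∀ q, shift q τ = τ := by
    intro q
    let φ : MvPolynomial (Γ × Q) ℚ ≃+* MvPolynomial (Γ × Q) ℚ := (renameEquiv ℚ (eqv Γ q)).toRingEquiv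
    have hφ : ∀ a, φ a = rename (eqv Γ q) a := fun a => rfl
    have hφ0 : φ f0 ≠ 0 := by simpa using hf0
    have hφfree : NFree N (φ f0) := by
      intro p hp hd
      have h1 : Prime (φ.symm p) := (MulEquiv.prime_iff φ.symm.toMulEquiv).2 hp
      apply hfree _ h1
      have := map_dvd φ.symm hd
      simpa using this
    obtain ⟨s, u, hs, hu, hsu⟩ := hinv q
    have hE : φ f0 * (φ f1 * s) ^ N = f0 * (f1 * u) ^ N := by
      rw [← hφ, hff] at hsu
      rw [mul_pow, mul_pow, ← map_pow, ← mul_assoc, ← map_mul, ← mul_assoc]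
      exact hsu
    have hφ1 : φ f1 ≠ 0 := by simpa using hf1'
    have d1 := nfree_dvd N _ _ _ _ hφfree hfree hφ0 hf0 (mul_ne_zero hφ1 hs) (mul_ne_zero hf1' hu) hE
    have d2 := nfree_dvd N _ _ _ _ hfree hφfree hf0 hφ0 (mul_ne_zero hf1' hu) (mul_ne_zero hφ1 hs) hE.symm
    obtain ⟨v, hv⟩ := associated_of_dvd_dvd d2 d1
    obtain ⟨c, -, hc⟩ := isUnit_iff_eq_C_of_isReduced.1 v.isUnit
    have h3 : IsWeightedHomogeneous A.w1 (φ f0) τ := by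
      rw [← hv, hc]
      simpa using hτ.mul (isWeightedHomogeneous_C A.w1 c)
    have h4 : IsWeightedHomogeneous A.w1 (φ f0) (shift q τ) :=
      homog_rename (shift q) A.w1 A.w1 (eqv Γ q) (A.w1_eqv q) f0 τ hτ
    exact IsWeightedHomogeneous.inj_right hφ0 h4 h3
  have hτ0 : τ = 0 := by
    have hconst : ∀ r, τ r = τ 1 := by
      intro r
      have := congrFun (hτinv r) r
      simpa [shift] using this.symm
    have hs := A.deg_sum f0 hf0 τ hτ
    simp only [hconst, Finset.sum_const, Finset.card_univ, smul_eq_zero, Fintype.card_ne_zero,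
      false_or] at hs
    ext r; rw [hconst, hs]; rfl
  exact ⟨ε, by rw [hδ, hτ0, zero_add]⟩

variable {E : Type*} [Field E] [Algebra (MvPolynomial (Γ × Q) ℚ) E]
  [IsFractionRing (MvPolynomial (Γ × Q) ℚ) E] [MulSemiringAction Q E]

local notation "RR" => MvPolynomial (Γ × Q) ℚ

variable (Γ Q E) in
def Compat : Prop := ∀ (q : Q) (a : RR), q • algebraMap RR E a = algebraMap RR E (rename (eqv Γ q) a)

variable (Q E) in
noncomputable def x (g : Γ) : E := algebraMap RR E (X (g, 1))

lemma x_ne (g : Γ) : x Q E g ≠ 0 := am_ne (X_ne_zero _)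

lemma smul_ne (q : Q) {e : E} (h : e ≠ 0) : q • e ≠ 0 := (smul_ne_zero_iff_ne q).2 h

lemma smul_div₀' (q : Q) (a b : E) : q • (a / b) = (q • a) / (q • b) :=
  map_div₀ (MulSemiringAction.toRingHom Q E q) a b

theorem key [Fintype Q] [Fintype Γ] (hcomp : Compat Γ Q E) (r : ℕ) (c : Γ → E) (hc0 : ∀ g, c g ≠ 0)
    (hc : ∀ g, c g ∈ HF E A.w1 0)
    (hcoc : ∀ g h, (x Q E g * (A.π g • x Q E h) / x Q E (g * h)) ^ r * c (g * h) =
      (A.π g • c h) * c g) : Fintype.card Q ∣ r := by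
  set N := Fintype.card Γ with hNdef
  have hN : 0 < N := Fintype.card_pos
  let z : Γ → E := fun g => c g / x Q E g ^ r
  have hz0 : ∀ g, z g ≠ 0 := fun g => div_ne_zero (hc0 g) (pow_ne_zero _ (x_ne g))
  have hz : ∀ g h, z g * (A.π g • z h) = z (g * h) := by
    intro g h
    have h1 := x_ne (Q := Q) (E := E) g
    have h2 := smul_ne (A.π g) (x_ne (Q := Q) (E := E) h)
    have h3 := x_ne (Q := Q) (E := E) (g * h)
    simp only [z, smul_div₀', smul_pow']
    have := hcoc g h
    rw [div_pow, mul_pow] at this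
    field_simp at this ⊢
    linear_combination -this
  let y : E := ∏ g, z g
  have hy0 : y ≠ 0 := Finset.prod_ne_zero_iff.2 fun g _ => hz0 g
  have hy : ∀ g, (A.π g • y) * z g ^ N = y := by
    intro g
    have : y = ∏ h, z (g * h) := (Equiv.prod_comp (Equiv.mulLeft g) z).symm
    conv_rhs => rw [this]
    simp only [← hz, Finset.prod_mul_distrib, Finset.prod_const, Finset.card_univ]
    simp only [y]
    rw [Finset.smul_prod', mul_comm]
  have hyH : y ∈ HF E A.w1 (∑ g, -(r • A.w1 (g, 1))) := by
    refine HF_prod _ _ _ fun g _ => ?_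
    have := HF_mul (hc g) (HF_inv (HF_pow (HF_X (E := E) A.w1 (g, 1)) r))
    rw [zero_add] at this
    simp only [z, div_eq_mul_inv, x]
    exact this
  obtain ⟨a, b, s, hb, ha', hb', hyab⟩ := hyH
  have hbE := am_ne (E := E) hb
  have ha : a ≠ 0 := by rintro rfl; simp at hyab; exact hy0 hyab
  set f := a * b ^ (N - 1) with hf
  have hf0 : f ≠ 0 := mul_ne_zero ha (pow_ne_zero _ hb)
  have hfE : algebraMap RR E f = y * algebraMap RR E b ^ N := by
    obtain ⟨n, hn⟩ : ∃ n, N = n + 1 := ⟨N - 1, by omega⟩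
    rw [hf, hyab, hn, map_mul, map_pow, Nat.add_sub_cancel]
    field_simp
    ring
  have hfw := ha'.mul (hb'.pow (N - 1))
  rw [← hf] at hfw
  clear_value f
  have hinv : ∀ q, ∃ s u : MvPolynomial (Γ × Q) ℚ, s ≠ 0 ∧ u ≠ 0 ∧
      rename (eqv Γ q) f * s ^ N = f * u ^ N := by
    intro q
    obtain ⟨g, rfl⟩ := A.surj q
    obtain ⟨u, v, hv, huv⟩ := IsFractionRing.div_surjective (A := RR) (z g * algebraMap RR E b /
      algebraMap RR E (rename (eqv Γ (A.π g)) b))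
    have hb2 : rename (eqv Γ (A.π g)) b ≠ 0 := fun h => hb
      (rename_injective _ (eqv Γ (A.π g)).injective (by rw [h, map_zero]))
    have hb2E := am_ne (E := E) hb2
    have hv0 : v ≠ 0 := nonZeroDivisors.ne_zero hv
    have hvE := am_ne (E := E) hv0
    refine ⟨u, v, ?_, hv0, ?_⟩
    · rintro rfl
      rw [map_zero, zero_div] at huv
      exact div_ne_zero (mul_ne_zero (hz0 g) hbE) hb2E huv.symm
    · apply IsFractionRing.injective RR E
      rw [map_mul (algebraMap RR E), map_mul (algebraMap RR E), map_pow, map_pow, ← hcomp, hfE, smul_mul', smul_pow', hcomp]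
      have hu : algebraMap RR E u = z g * algebraMap RR E b /
        algebraMap RR E (rename (eqv Γ (A.π g)) b) * algebraMap RR E v := by
        rw [← huv]; field_simp
      rw [hu]
      conv_rhs => rw [← hy g]
      rw [div_mul_eq_mul_div, div_pow, mul_pow, mul_pow]
      field_simp
  obtain ⟨ε, hε⟩ := A.deg_dvd N hN f hf0 _ hfw hinv
  by_cases hQ : ∃ q : Q, q ≠ 1
  · obtain ⟨q, hq⟩ := hQ
    have h1 := congrFun hε q
    have hs : (∑ g, -(r • A.w1 (g, 1))) q = -(r * (Fintype.card {g : Γ // A.π g = q} : ℤ)) := by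
      simp only [Finset.sum_apply, w1_one, Pi.neg_apply, Pi.smul_apply, Pi.sub_apply]
      simp only [Pi.single_apply, hq, if_false, sub_zero, Finset.sum_neg_distrib, ← Finset.smul_sum]
      rw [Fintype.card_subtype, Finset.card_filter]
      simp [eq_comm]
    have hcard : Fintype.card Γ = Fintype.card Q * Fintype.card {g : Γ // A.π g = q} := by
      have hfib : ∀ q', Fintype.card {g : Γ // A.π g = q'} = Fintype.card {g : Γ // A.π g = q} := by
        intro q'
        obtain ⟨g0, hg0⟩ := A.surj (q * q'⁻¹)
        refine Fintype.card_congr ⟨fun g => ⟨g0 * g.1, ?_⟩, fun g => ⟨g0⁻¹ * g.1, ?_⟩, ?_, ?_⟩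
        · rw [map_mul, hg0, g.2]; group
        · rw [map_mul, map_inv, hg0, g.2]; group
        · intro g; simp
        · intro g; simp
      rw [← Fintype.card_congr (Equiv.sigmaFiberEquiv A.π), Fintype.card_sigma]
      simp [hfib]
    rw [Pi.add_apply, Pi.add_apply, hs, Pi.smul_apply, Pi.smul_apply] at h1
    simp only [nsmul_eq_mul] at h1
    have hF : (0:ℤ) < Fintype.card {g : Γ // A.π g = q} := by
      obtain ⟨g, hg⟩ := A.surj q
      have : 0 < Fintype.card {g : Γ // A.π g = q} := Fintype.card_pos_iff.2 ⟨⟨g, hg⟩⟩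
      exact_mod_cast this
    have hN1 : ((N - 1 : ℕ) : ℤ) = N - 1 := by omega
    rw [hN1] at h1
    have h2 : (r : ℤ) * (Fintype.card {g : Γ // A.π g = q} : ℤ) =
      N * (s q - ε q) := by linear_combination -h1
    have h3 : (r : ℤ) = Fintype.card Q * (s q - ε q) := by
      apply mul_right_cancel₀ hF.ne'
      rw [h2, hNdef, hcard]; push_cast; ring
    exact Int.natCast_dvd_natCast.1 ⟨_, h3⟩
  · push Not at hQ
    have : Fintype.card Q = 1 := Fintype.card_eq_one_iff.2 ⟨1, hQ⟩
    rw [this]; exact one_dvd _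

end Dat

section Skew
variable {E Q : Type} [Field E] [Group Q] [Fintype Q] [MulSemiringAction Q E]

lemma coeff_mul_single (s : SkewMonoidAlgebra E Q) (q : Q) (y : E) (r : Q) :
    (s * SkewMonoidAlgebra.single q y).coeff r = s.coeff (r * q⁻¹) * (r * q⁻¹) • y := by
  classical
  induction s using SkewMonoidAlgebra.induction_on with
  | zero => simp
  | single g a =>
    rw [SkewMonoidAlgebra.single_mul_single, SkewMonoidAlgebra.coeff_single,
      SkewMonoidAlgebra.coeff_single, Finsupp.single_apply, Finsupp.single_apply]
    by_cases h : g * q = r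
    · subst h; simp
    · rw [if_neg h, if_neg, zero_mul]
      rintro rfl; simp at h
  | add f g hf hg => simp [add_mul, hf, hg]

lemma coeff_mul (s t : SkewMonoidAlgebra E Q) (r : Q) :
    (s * t).coeff r = ∑ a, s.coeff a * a • t.coeff (a⁻¹ * r) := by
  classical
  induction t using SkewMonoidAlgebra.induction_on with
  | zero => simp
  | single g y =>
    rw [coeff_mul_single, Finset.sum_eq_single (r * g⁻¹)]
    · simp
    · intro a _ ha
      rw [SkewMonoidAlgebra.coeff_single, Finsupp.single_apply, if_neg]
      · simp
      · rintro rfl; simp at ha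
    · simp
  | add f g hf hg => simp [mul_add, hf, hg, Finset.sum_add_distrib]

lemma coeff_single_mul (s : SkewMonoidAlgebra E Q) (q : Q) (y : E) (r : Q) :
    (SkewMonoidAlgebra.single q y * s).coeff r = y * q • s.coeff (q⁻¹ * r) := by
  classical
  rw [coeff_mul, Finset.sum_eq_single q]
  · simp
  · intro a _ ha
    rw [SkewMonoidAlgebra.coeff_single, Finsupp.single_apply, if_neg ha.symm, zero_mul]
  · simp

lemma smul_ne2 (q : Q) {e : E} (h : e ≠ 0) : q • e ≠ 0 := (smul_ne_zero_iff_ne q).2 h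

lemma smul_div2 (q : Q) (a b : E) : q • (a / b) = (q • a) / (q • b) :=
  map_div₀ (MulSemiringAction.toRingHom Q E q) a b

end Skew

section Generic
variable {Γ Q M S : Type} [Group Γ] [Group Q] [Field M] [MulSemiringAction Q M]
  [Ring S] [Module M S]

theorem gen_left_inv [Module.Finite M S] (π : Γ →* Q) (j : M →+* S)
    (hsm : ∀ (m : M) (s : S), m • s = j m * s) (u : Γ → S) (β : Γ → Γ → M)
    (hβ0 : ∀ g h, β g h ≠ 0)
    (huj : ∀ g m, u g * j m = j (π g • m) * u g)
    (huu : ∀ g h, u g * u h = j (β g h) * u (g * h))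
    (x1 : M) (hx1 : x1 ≠ 0) (hu1 : u 1 = j x1) (n : ℕ) (hn : Module.finrank M S = n)
    (key : ∀ (r : ℕ) (c : Γ → M), (∀ g, c g ≠ 0) →
      (∀ g h, β g h ^ r * c (g * h) = (π g • c h) * c g) → n ∣ r)
    (d : S) (hd : d ≠ 0) : ∃ s, s * d = 1 := by
  classical
  let φ : S →ₗ[M] S :=
    { toFun := fun s => s * d
      map_add' := fun a b => add_mul a b d
      map_smul' := fun m a => by simp [hsm, mul_assoc] }
  let I := LinearMap.range φ
  have hI : ∀ (s : S) {y}, y ∈ I → s * y ∈ I := by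
    rintro s _ ⟨y, rfl⟩
    exact ⟨s * y, mul_assoc _ _ _⟩
  set r := Module.finrank M I with hr
  let b : Module.Basis (Fin r) M I := Module.finBasis M I
  have hr0 : 0 < r := by
    have : Nontrivial I := ⟨⟨⟨d, 1, one_mul d⟩, 0, fun h => hd (congrArg Subtype.val h)⟩⟩
    exact Module.finrank_pos
  let C : Γ → Matrix (Fin r) (Fin r) M := fun g i k => b.repr ⟨u g * b i, hI _ (b i).2⟩ k
  have hC : ∀ g i, u g * (b i : S) = ∑ k, C g i k • (b k : S) := by
    intro g i
    have := congrArg Subtype.val (b.sum_repr ⟨u g * b i, hI _ (b i).2⟩)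
    rw [Submodule.coe_sum] at this
    exact this.symm
  have huniq : ∀ c c' : Fin r → M, ∑ k, c k • (b k : S) = ∑ k, c' k • (b k : S) → c = c' := by
    intro c c' h
    have h' : ∑ k, c k • b k = ∑ k, c' k • b k := Subtype.ext (by simpa using h)
    have := congrArg (fun v => (b.repr v : Fin r → M)) h'
    beta_reduce at this
    rw [b.repr_sum_self, b.repr_sum_self] at this
    exact this
  have hmul : ∀ g h, β g h • C (g * h) = ((C h).map (fun m => π g • m)) * C g := by
    intro g h
    funext i
    apply huniq
    have e1 : u g * (u h * (b i : S)) = ∑ k, (β g h • C (g * h)) i k • (b k : S) := by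
      rw [← mul_assoc, huu, mul_assoc, hC, ← hsm, Finset.smul_sum]
      simp [smul_smul]
    have e2 : u g * (u h * (b i : S)) =
        ∑ k, (((C h).map (fun m => π g • m)) * C g) i k • (b k : S) := by
      rw [hC, Finset.mul_sum]
      have e3 : ∀ k, u g * (C h i k • (b k : S)) = (π g • C h i k) • (u g * (b k : S)) := by
        intro k
        rw [hsm, hsm, ← mul_assoc, huj, mul_assoc]
      simp only [e3, hC, Finset.smul_sum, smul_smul]
      rw [Finset.sum_comm]
      simp only [Matrix.mul_apply, Finset.sum_smul, Matrix.map_apply]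
    rw [← e1, e2]
  have hdet : ∀ g h, β g h ^ r * (C (g * h)).det = (π g • (C h).det) * (C g).det := by
    intro g h
    have := congrArg Matrix.det (hmul g h)
    rw [Matrix.det_smul, Fintype.card_fin, Matrix.det_mul] at this
    rw [this]
    congr 1
    exact ((MulSemiringAction.toRingHom Q M (π g)).map_det (C h)).symm
  have h1 : (C 1).det ≠ 0 := by
    have : C 1 = Matrix.diagonal (fun _ => x1) := by
      funext i
      apply huniq
      rw [← hC, hu1, ← hsm]
      simp [Matrix.diagonal_apply, ite_smul]
    rw [this, Matrix.det_diagonal]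
    refine Finset.prod_ne_zero_iff.2 fun i _ => hx1
  have hdvd : n ∣ r := by
    refine key r (fun g => (C g).det) ?_ hdet
    intro g h0
    have := hdet g g⁻¹
    rw [h0, mul_zero, mul_inv_cancel] at this
    exact mul_ne_zero (pow_ne_zero _ (hβ0 _ _)) h1 this
  have hle : r ≤ n := by
    rw [← hn]; exact Submodule.finrank_le I
  have heq : r = n := le_antisymm hle (Nat.le_of_dvd hr0 hdvd)
  have htop : I = ⊤ := Submodule.eq_top_of_finrank_eq (by rw [hn, ← heq])
  have : (1 : S) ∈ I := htop ▸ Submodule.mem_top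
  obtain ⟨s, hs⟩ := this
  exact ⟨s, hs⟩


theorem gen_center [Fintype Q] [FaithfulSMul Q M] (j : M →+* S) (hj : Function.Injective j)
    (hsm : ∀ (m : M) (s : S), m • s = j m * s) (n : ℕ) (hf : Module.Finite M S)
    (hn : Module.finrank M S = n)
    (hc : ∀ s, s ∈ Subring.center S ↔ ∃ m : M, (∀ q : Q, q • m = m) ∧ s = j m) :
    Module.finrank (Subring.center S) S = Fintype.card Q * n ∧
      Module.Finite (Subring.center S) S := by
  let i : FixedPoints.subfield Q M → Subring.center S := fun k =>
    ⟨j k.1, (hc _).2 ⟨k.1, k.2, rfl⟩⟩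
  have hsm' : ∀ (k : FixedPoints.subfield Q M) (s : S), k • s = i k • s := fun k s => hsm k.1 s
  have hi : Function.Bijective i := by
    constructor
    · intro k k' h
      exact Subtype.ext (hj (congrArg Subtype.val h))
    · rintro ⟨s, hs⟩
      obtain ⟨m, hm, rfl⟩ := (hc _).1 hs
      exact ⟨⟨m, hm⟩, rfl⟩
  constructor
  · have := lift_rank_eq_of_equiv_equiv i (AddEquiv.refl S) hi hsm'
    rw [Cardinal.lift_id, Cardinal.lift_id] at this
    have h2 : Module.finrank (FixedPoints.subfield Q M) S = Module.finrank (Subring.center S) S :=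
      congrArg Cardinal.toNat this
    rw [← h2, ← Module.finrank_mul_finrank (FixedPoints.subfield Q M) M S,
      FixedPoints.finrank_eq_card, hn]
  · have : Module.Finite (FixedPoints.subfield Q M) S := Module.Finite.trans M S
    obtain ⟨t, ht⟩ := this.fg_top
    refine ⟨⟨t, ?_⟩⟩
    rw [eq_top_iff]
    intro s _
    have hs : s ∈ Submodule.span (FixedPoints.subfield Q M) (t : Set S) := ht ▸ Submodule.mem_top
    induction hs using Submodule.span_induction with
    | mem x h => exact Submodule.subset_span h
    | zero => exact Submodule.zero_mem _
    | add x y _ _ hx hy => exact Submodule.add_mem _ (hx trivial) (hy trivial)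
    | smul k x _ hx => rw [hsm']; exact Submodule.smul_mem _ _ (hx trivial)

end Generic

/-- crossed product data over the maximal subfield `M`. -/
structure XM (Γ Q E : Type) [Group Γ] [Group Q] [Fintype Q] [Field E]
    [MulSemiringAction Q E] where
  π : Γ →* Q
  surj : Function.Surjective π
  M : Subfield E
  hM : ∀ q : Q, ∀ m ∈ M, q • m ∈ M
  x : Γ → E
  x0 : ∀ g, x g ≠ 0
  hβ : ∀ g h, x g * (π g • x h) / x (g * h) ∈ M
  hx : ∀ g k, π g = π k → x g / x k ∈ M
  ell : E
  hell : ell ∈ M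
  hellq : ∀ q : Q, q • ell = ell → q = 1
  key : ∀ (r : ℕ) (c : Γ → E), (∀ g, c g ≠ 0) → (∀ g, c g ∈ M) →
    (∀ g h, (x g * (π g • x h) / x (g * h)) ^ r * c (g * h) = (π g • c h) * c g) →
    Fintype.card Q ∣ r

namespace XM
variable {Γ Q E : Type} [Group Γ] [Group Q] [Fintype Q] [Field E]
    [MulSemiringAction Q E] (A : XM Γ Q E)

instance : MulSemiringAction Q A.M where
  smul q m := ⟨q • (m : E), A.hM q m m.2⟩
  one_smul m := Subtype.ext (one_smul Q (m : E))
  mul_smul q q' m := Subtype.ext (mul_smul q q' (m : E))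
  smul_zero q := Subtype.ext (smul_zero q)
  smul_add q m m' := Subtype.ext (smul_add q (m : E) m')
  smul_one q := Subtype.ext (smul_one q)
  smul_mul q m m' := Subtype.ext (smul_mul' q (m : E) m')

lemma coe_smul (q : Q) (m : A.M) : ((q • m : A.M) : E) = q • (m : E) := rfl

instance : FaithfulSMul Q A.M where
  eq_of_smul_eq_smul {q q'} h := by
    have h1 := congrArg Subtype.val (h ⟨A.ell, A.hell⟩)
    simp only [coe_smul] at h1
    have h2 : q'⁻¹ * q = 1 := A.hellq _ (by rw [mul_smul, h1, inv_smul_smul])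
    rw [inv_mul_eq_one] at h2
    exact h2.symm

lemma hx1 : A.x 1 ∈ A.M := by
  have := A.hβ 1 1
  rw [map_one, one_smul, mul_one] at this
  rwa [mul_div_assoc, div_self (A.x0 1), mul_one] at this

/-- the crossed product -/
def S : Subring (SkewMonoidAlgebra E Q) where
  carrier := {s | ∀ g, s.coeff (A.π g) / A.x g ∈ A.M}
  zero_mem' := by intro g; simp
  add_mem' := by
    intro a b ha hb g
    rw [SkewMonoidAlgebra.coeff_add, Finsupp.add_apply, add_div]
    exact A.M.add_mem (ha g) (hb g)
  neg_mem' := by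
    intro a ha g
    rw [SkewMonoidAlgebra.coeff_neg, Finsupp.neg_apply, neg_div]
    exact A.M.neg_mem (ha g)
  one_mem' := by
    classical
    intro g
    rw [SkewMonoidAlgebra.coeff_one, Finsupp.single_apply]
    split_ifs with h
    · have := A.M.mul_mem (A.hx 1 g (by rw [← h, map_one])) (A.M.inv_mem A.hx1)
      convert this using 1
      have := A.x0 1
      have := A.x0 g
      field_simp
    · simp
  mul_mem' := by
    intro s t hs ht g
    rw [coeff_mul, Finset.sum_div]
    refine A.M.sum_mem fun a _ => ?_
    obtain ⟨k, rfl⟩ := A.surj a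
    have h1 := hs k
    have h2 := A.hM (A.π k) _ (ht (k⁻¹ * g))
    have h3 := A.hβ k (k⁻¹ * g)
    rw [map_mul, map_inv] at h2
    rw [mul_inv_cancel_left] at h3
    have := A.M.mul_mem (A.M.mul_mem h1 h2) h3
    convert this using 1
    have e1 := A.x0 k
    have e2 := A.x0 g
    have e3 := smul_ne2 (A.π k) (A.x0 (k⁻¹ * g))
    rw [smul_div2]
    field_simp

lemma mem_S {s : SkewMonoidAlgebra E Q} : s ∈ A.S ↔ ∀ g, s.coeff (A.π g) / A.x g ∈ A.M := Iff.rfl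

lemma single_mem {q : Q} {y : E} (g : Γ) (hg : A.π g = q) (h : y / A.x g ∈ A.M) :
    SkewMonoidAlgebra.single q y ∈ A.S := by
  classical
  intro k
  rw [SkewMonoidAlgebra.coeff_single, Finsupp.single_apply]
  split_ifs with hk
  · have := A.M.mul_mem h (A.hx g k (hg.trans hk))
    convert this using 1
    have := A.x0 k
    have := A.x0 g
    field_simp
  · simp

noncomputable def u (g : Γ) : A.S := ⟨SkewMonoidAlgebra.single (A.π g) (A.x g), A.single_mem g rfl (by
  rw [div_self (A.x0 g)]; exact A.M.one_mem)⟩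

noncomputable def j : A.M →+* A.S where
  toFun m := ⟨SkewMonoidAlgebra.single 1 (m : E), A.single_mem 1 (map_one _)
    (A.M.div_mem m.2 A.hx1)⟩
  map_one' := rfl
  map_zero' := Subtype.ext (by simp)
  map_add' a b := Subtype.ext (by simp [SkewMonoidAlgebra.single_add])
  map_mul' a b := Subtype.ext (by simp [SkewMonoidAlgebra.single_mul_single])

@[simp] lemma coe_j (m : A.M) : (A.j m : SkewMonoidAlgebra E Q) = SkewMonoidAlgebra.single 1 (m : E) := rfl
@[simp] lemma coe_u (g : Γ) : (A.u g : SkewMonoidAlgebra E Q) = SkewMonoidAlgebra.single (A.π g) (A.x g) := rfl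

noncomputable instance modM : Module A.M A.S := Module.compHom A.S A.j

lemma smul_def (m : A.M) (s : A.S) : m • s = A.j m * s := rfl

lemma coeff_smul (m : A.M) (s : A.S) (q : Q) :
    ((m • s : A.S) : SkewMonoidAlgebra E Q).coeff q = m * (s : SkewMonoidAlgebra E Q).coeff q := by
  rw [smul_def, Subring.coe_mul, coe_j, coeff_single_mul]; simp

lemma u_j (g : Γ) (m : A.M) : A.u g * A.j m = A.j (A.π g • m) * A.u g := by
  apply Subtype.ext
  simp [SkewMonoidAlgebra.single_mul_single, coe_smul, mul_comm]

def β (g h : Γ) : A.M := ⟨_, A.hβ g h⟩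

lemma u_u (g h : Γ) : A.u g * A.u h = A.j (A.β g h) * A.u (g * h) := by
  apply Subtype.ext
  simp only [Subring.coe_mul, coe_u, coe_j, SkewMonoidAlgebra.single_mul_single, one_mul, one_smul,
    map_mul, β]
  rw [div_mul_cancel₀ _ (A.x0 _)]

noncomputable def coord : A.S ≃ₗ[A.M] (Q → A.M) where
  toFun s := fun q => ⟨(s : SkewMonoidAlgebra E Q).coeff q / A.x (Function.surjInv A.surj q), by
    have := s.2 (Function.surjInv A.surj q)
    rwa [Function.surjInv_eq A.surj] at this⟩
  map_add' a b := by
    funext q; apply Subtype.ext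
    simp [add_div]
  map_smul' m b := by
    funext q; apply Subtype.ext
    simp [coeff_smul, mul_div_assoc]
  invFun f := ⟨∑ q, SkewMonoidAlgebra.single q (f q * A.x (Function.surjInv A.surj q)),
    sum_mem fun q _ => A.single_mem (Function.surjInv A.surj q) (Function.surjInv_eq A.surj q) (by
      rw [mul_div_assoc, div_self (A.x0 _), mul_one]; exact (f q).2)⟩
  left_inv s := by
    classical
    apply Subtype.ext
    simp only
    have : ∀ q, (s : SkewMonoidAlgebra E Q).coeff q / A.x (Function.surjInv A.surj q) * A.x (Function.surjInv A.surj q) = (s : SkewMonoidAlgebra E Q).coeff q := fun q => div_mul_cancel₀ _ (A.x0 _)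
    simp only [this]
    apply SkewMonoidAlgebra.ext
    intro q
    have h2 : (∑ r, SkewMonoidAlgebra.single r ((s : SkewMonoidAlgebra E Q).coeff r)).coeff =
      ∑ r, (SkewMonoidAlgebra.single r ((s : SkewMonoidAlgebra E Q).coeff r)).coeff := 
        map_sum (SkewMonoidAlgebra.coeffAddEquiv) _ _
    rw [h2, Finsupp.finsetSum_apply]
    simp [SkewMonoidAlgebra.coeff_single, Finsupp.single_apply]
  right_inv f := by
    classical
    funext q
    apply Subtype.ext
    have h2 : (∑ r, SkewMonoidAlgebra.single r ((f r : E) * A.x (Function.surjInv A.surj r))).coeff =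
      ∑ r, (SkewMonoidAlgebra.single r ((f r : E) * A.x (Function.surjInv A.surj r))).coeff := 
        map_sum (SkewMonoidAlgebra.coeffAddEquiv) _ _
    simp only
    rw [h2, Finsupp.finsetSum_apply]
    simp only [SkewMonoidAlgebra.coeff_single, Finsupp.single_apply, Finset.sum_ite_eq', Finset.mem_univ, if_true]
    rw [mul_div_assoc, div_self (A.x0 _), mul_one]

instance finM : Module.Finite A.M A.S := Module.Finite.equiv A.coord.symm

lemma finrank_M : Module.finrank A.M A.S = Fintype.card Q := by
  rw [A.coord.finrank_eq, Module.finrank_fintype_fun_eq_card]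

instance : Nontrivial A.S := inferInstance

lemma j_inj : Function.Injective A.j := by
  intro m m' h
  have h1 := congrArg (fun t : A.S => (t : SkewMonoidAlgebra E Q)) h
  exact Subtype.ext (SkewMonoidAlgebra.single_injective 1 h1)

lemma β_ne (g h : Γ) : A.β g h ≠ 0 := fun e => by
  have := congrArg Subtype.val e
  exact div_ne_zero (mul_ne_zero (A.x0 g) (smul_ne2 _ (A.x0 h))) (A.x0 _) this

theorem left_inv (d : A.S) (hd : d ≠ 0) : ∃ s, s * d = 1 := by
  refine gen_left_inv A.π A.j A.smul_def A.u A.β A.β_ne A.u_j A.u_u ⟨A.x 1, A.hx1⟩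
    (fun h => A.x0 1 (congrArg Subtype.val h)) (Subtype.ext (by simp)) (Fintype.card Q)
    A.finrank_M ?_ d hd
  intro r c hc0 hc
  refine A.key r (fun g => (c g : A.M)) (fun g h => hc0 g (Subtype.ext h)) (fun g => (c g).2) ?_
  intro g h
  exact congrArg Subtype.val (hc g h)

theorem unit_or_zero (d : A.S) : IsUnit d ∨ d = 0 := by
  by_cases hd : d = 0
  · exact Or.inr hd
  left
  obtain ⟨s, hs⟩ := A.left_inv d hd
  have hs0 : s ≠ 0 := by rintro rfl; simp at hs
  obtain ⟨t, ht⟩ := A.left_inv s hs0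
  have : t = d := by
    calc t = t * (s * d) := by rw [hs, mul_one]
    _ = d := by rw [← mul_assoc, ht, one_mul]
  exact ⟨⟨d, s, this ▸ ht, hs⟩, rfl⟩

noncomputable instance divS : DivisionRing A.S := DivisionRing.ofIsUnitOrEqZero A.unit_or_zero

lemma center_iff (s : A.S) : s ∈ Subring.center A.S ↔ ∃ m : A.M, (∀ q : Q, q • m = m) ∧ s = A.j m := by
  classical
  rw [Subring.mem_center_iff]
  constructor
  · intro h
    have h0 : ∀ q, q ≠ 1 → (s : SkewMonoidAlgebra E Q).coeff q = 0 := by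
      intro q hq
      have := congrArg (fun t : A.S => (t : SkewMonoidAlgebra E Q).coeff q) (h (A.j ⟨A.ell, A.hell⟩))
      simp only [Subring.coe_mul, coe_j, coeff_single_mul, coeff_mul_single] at this
      simp only [inv_one, one_mul, mul_one, one_smul] at this
      by_contra hne
      apply hq
      apply A.hellq
      apply mul_left_cancel₀ hne
      rw [← this, mul_comm]
    have hm : (s : SkewMonoidAlgebra E Q).coeff 1 ∈ A.M := by
      have := A.M.mul_mem (s.2 1) A.hx1
      rwa [div_mul_cancel₀ _ (A.x0 _), map_one] at this
    have hs : s = A.j ⟨_, hm⟩ := by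
      apply Subtype.ext
      apply SkewMonoidAlgebra.ext
      intro q
      rw [coe_j, SkewMonoidAlgebra.coeff_single, Finsupp.single_apply]
      split_ifs with hq
      · subst hq; rfl
      · exact h0 q (Ne.symm hq)
    refine ⟨⟨_, hm⟩, ?_, hs⟩
    intro q
    obtain ⟨g, rfl⟩ := A.surj q
    have := h (A.u g)
    rw [hs, u_j] at this
    have := congrArg (fun t : A.S => (t : SkewMonoidAlgebra E Q).coeff (A.π g)) this
    simp only [Subring.coe_mul, coe_j, coe_u, SkewMonoidAlgebra.single_mul_single, one_mul, one_smul,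
      SkewMonoidAlgebra.coeff_single, Finsupp.single_eq_same] at this
    exact Subtype.ext (mul_right_cancel₀ (A.x0 g) this)
  · rintro ⟨m, hm, rfl⟩ t
    apply Subtype.ext
    apply SkewMonoidAlgebra.ext
    intro q
    rw [Subring.coe_mul, Subring.coe_mul, coe_j, coeff_single_mul, coeff_mul_single]
    have : q • (m : E) = m := congrArg Subtype.val (hm q)
    simp [this, mul_comm]

theorem center_fin : Module.finrank (Subring.center A.S) A.S = Fintype.card Q ^ 2 ∧
    Module.Finite (Subring.center A.S) A.S := by
  rw [sq]
  exact gen_center A.j A.j_inj A.smul_def _ A.finM A.finrank_M A.center_iff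

instance [CharZero E] : CharZero A.S := by
  have : CharZero A.M := (RingHom.charZero_iff (ϕ := A.M.subtype) Subtype.val_injective).2 inferInstance
  exact charZero_of_injective_ringHom A.j_inj

end XM

/-- graded crossed product data. -/
structure XV (Γ Q E : Type) [Group Γ] [Group Q] [Fintype Q] [Fintype Γ] [DecidableEq Q] [Field E]
    [MulSemiringAction Q E] where
  π : Γ →* Q
  surj : Function.Surjective π
  V : Γ → AddSubgroup E
  one_mem : 1 ∈ V 1
  inv_mem : ∀ a ∈ V 1, a⁻¹ ∈ V 1
  mul_mem : ∀ g h a b, a ∈ V g → b ∈ V h → a * (π g • b) ∈ V (g * h)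
  x : Γ → E
  x0 : ∀ g, x g ≠ 0
  xV : ∀ g, x g ∈ V g
  gen : ∀ g, ∀ a ∈ V g, a / x g ∈ V 1
  indep : ∀ (q : Q) (e : Γ → E), (∀ g, e g ∈ V g) → ∑ g with π g = q, e g = 0 →
    ∀ g, π g = q → e g = 0
  ell : E
  hell : ell ∈ V 1
  hellq : ∀ q : Q, q • ell = ell → q = 1
  key : ∀ (r : ℕ) (c : Γ → E), (∀ g, c g ≠ 0) → (∀ g, c g ∈ ⨆ h : π.ker, V h) →
    (∀ g h, (x g * (π g • x h) / x (g * h)) ^ r * c (g * h) = (π g • c h) * c g) →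
    Fintype.card Q ∣ r

namespace XV
variable {Γ Q E : Type} [Group Γ] [Group Q] [Fintype Q] [Fintype Γ] [DecidableEq Q] [Field E]
    [MulSemiringAction Q E] (B : XV Γ Q E)

lemma mul_mem' {g h : Γ} (hg : B.π g = 1) {a b : E} (ha : a ∈ B.V g) (hb : b ∈ B.V h) :
    a * b ∈ B.V (g * h) := by
  have := B.mul_mem g h a b ha hb
  rwa [hg, one_smul] at this

def L : Subfield E where
  carrier := B.V 1
  zero_mem' := (B.V 1).zero_mem
  one_mem' := B.one_mem
  add_mem' := (B.V 1).add_mem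
  neg_mem' := (B.V 1).neg_mem
  mul_mem' := fun ha hb => by
    have := B.mul_mem' (map_one _) ha hb
    rwa [mul_one] at this
  inv_mem' := B.inv_mem

lemma mem_L {a : E} : a ∈ B.L ↔ a ∈ B.V 1 := Iff.rfl

lemma L_mul {g : Γ} {a b : E} (ha : a ∈ B.L) (hb : b ∈ B.V g) : a * b ∈ B.V g := by
  have := B.mul_mem' (map_one _) ha hb
  rwa [one_mul] at this

lemma div_mem {k g : Γ} (hk : B.π k = 1) {a : E} (ha : a ∈ B.V (k * g)) : a / B.x g ∈ B.V k := by
  have h1 : a / B.x (k * g) ∈ B.L := B.gen _ _ ha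
  have h2 : B.x k * B.x g / B.x (k * g) ∈ B.L := B.gen _ _ (B.mul_mem' hk (B.xV k) (B.xV g))
  have h3 := B.L_mul (B.L.div_mem h1 h2) (B.xV k)
  convert h3 using 1
  have := B.x0 k
  have := B.x0 g
  have := B.x0 (k * g)
  field_simp

def M0 : AddSubgroup E := ⨆ h : B.π.ker, B.V h

lemma V_le_M0 {h : Γ} (hh : B.π h = 1) {a : E} (ha : a ∈ B.V h) : a ∈ B.M0 :=
  AddSubgroup.mem_iSup_of_mem (⟨h, hh⟩ : B.π.ker) ha

lemma M0_induction {C : E → Prop} (mem : ∀ h, B.π h = 1 → ∀ a ∈ B.V h, C a) (zero : C 0)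
    (hadd : ∀ a b, C a → C b → C (a + b)) {a : E} (ha : a ∈ B.M0) : C a :=
  AddSubgroup.iSup_induction _ (C := C) ha (fun i x hx => mem i i.2 x hx) zero hadd

lemma M0_mul {a b : E} (ha : a ∈ B.M0) (hb : b ∈ B.M0) : a * b ∈ B.M0 := by
  refine B.M0_induction (C := fun a => a * b ∈ B.M0) ?_ ?_ ?_ ha
  · intro h hh a ha
    refine B.M0_induction (C := fun b => a * b ∈ B.M0) ?_ ?_ ?_ hb
    · intro h' hh' b hb
      exact B.V_le_M0 (by rw [map_mul, hh, hh', one_mul]) (B.mul_mem' hh ha hb)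
    · simp [B.M0.zero_mem]
    · intro b c hb hc; rw [mul_add]; exact B.M0.add_mem hb hc
  · simp [B.M0.zero_mem]
  · intro b c hb hc; rw [add_mul]; exact B.M0.add_mem hb hc

def MA : Subalgebra B.L E where
  carrier := B.M0
  zero_mem' := B.M0.zero_mem
  one_mem' := B.V_le_M0 (map_one _) B.one_mem
  add_mem' := B.M0.add_mem
  mul_mem' := B.M0_mul
  algebraMap_mem' := fun l => B.V_le_M0 (map_one _) l.2

lemma MA_fg : (Subalgebra.toSubmodule B.MA).FG := by
  have : Subalgebra.toSubmodule B.MA =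
      Submodule.span B.L (Set.range fun h : B.π.ker => B.x h) := by
    apply le_antisymm
    · intro a ha
      refine B.M0_induction (C := fun a => a ∈ Submodule.span B.L (Set.range fun h : B.π.ker => B.x h)) ?_
        (Submodule.zero_mem _) (fun a b => Submodule.add_mem _) ha
      intro h hh a ha
      have : a = (⟨a / B.x h, B.gen h a ha⟩ : B.L) • B.x h := by
        change a = a / B.x h * B.x h
        rw [div_mul_cancel₀ _ (B.x0 h)]
      rw [this]
      exact Submodule.smul_mem _ _ (Submodule.subset_span ⟨⟨h, hh⟩, rfl⟩)
    · rw [Submodule.span_le]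
      rintro _ ⟨h, rfl⟩
      exact B.V_le_M0 h.2 (B.xV h)
  rw [this]
  exact Submodule.fg_span (Set.finite_range _)

def M : Subfield E where
  carrier := B.M0
  zero_mem' := B.M0.zero_mem
  one_mem' := B.V_le_M0 (map_one _) B.one_mem
  add_mem' := B.M0.add_mem
  neg_mem' := B.M0.neg_mem
  mul_mem' := B.M0_mul
  inv_mem' := fun a ha => by
    have h1 : IsIntegral B.L a := IsIntegral.of_mem_of_fg B.MA B.MA_fg a ha
    exact B.MA.inv_mem_of_algebraic (x := ⟨a, ha⟩) h1.isAlgebraic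

lemma smul_V (g : Γ) {h : Γ} (hh : B.π h = 1) {a : E} (ha : a ∈ B.V h) :
    B.π g • a ∈ B.V (g * h * g⁻¹) := by
  have h1 := B.mul_mem g h _ _ (B.xV g) ha
  have h2 := B.div_mem (k := g * h * g⁻¹) (g := g) (by simp [hh]) (a := B.x g * B.π g • a) (by simpa using h1)
  rwa [mul_div_cancel_left₀ _ (B.x0 g)] at h2

def toXM : XM Γ Q E where
  π := B.π
  surj := B.surj
  M := B.M
  hM q m hm := by
    obtain ⟨g, rfl⟩ := B.surj q
    refine B.M0_induction (C := fun a => B.π g • a ∈ B.M0) ?_ (by simp [B.M0.zero_mem]) ?_ hm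
    · intro h hh a ha
      exact B.V_le_M0 (by simp [hh]) (B.smul_V g hh ha)
    · intro a b ha hb
      rw [smul_add]; exact B.M0.add_mem ha hb
  x := B.x
  x0 := B.x0
  hβ g h := B.V_le_M0 (map_one _) (B.gen _ _ (B.mul_mem g h _ _ (B.xV g) (B.xV h)))
  hx g k hgk := B.V_le_M0 (h := g * k⁻¹) (by simp [hgk])
    (B.div_mem (by simp [hgk]) (by simpa using B.xV g))
  ell := B.ell
  hell := B.V_le_M0 (map_one _) B.hell
  hellq := B.hellq
  key := B.key

abbrev S := B.toXM.S

/-- the homogeneous components. -/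
def comp (g : Γ) : AddSubgroup B.S where
  carrier := {s | ∃ a ∈ B.V g, (s : SkewMonoidAlgebra E Q) = SkewMonoidAlgebra.single (B.π g) a}
  zero_mem' := ⟨0, (B.V g).zero_mem, by simp⟩
  add_mem' := by
    rintro s t ⟨a, ha, hs⟩ ⟨b, hb, ht⟩
    exact ⟨a + b, (B.V g).add_mem ha hb, by rw [Subring.coe_add, hs, ht, SkewMonoidAlgebra.single_add]⟩
  neg_mem' := by
    rintro s ⟨a, ha, hs⟩
    exact ⟨-a, (B.V g).neg_mem ha, by rw [Subring.coe_neg, hs, SkewMonoidAlgebra.single_neg]⟩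

lemma sing_mem {g : Γ} {a : E} (ha : a ∈ B.V g) : SkewMonoidAlgebra.single (B.π g) a ∈ B.S :=
  B.toXM.single_mem g rfl (B.V_le_M0 (map_one _) (B.gen g a ha))

noncomputable def sing (g : Γ) (a : E) (ha : a ∈ B.V g) : B.S := ⟨_, B.sing_mem ha⟩

lemma sing_comp (g : Γ) (a : E) (ha : a ∈ B.V g) : B.sing g a ha ∈ B.comp g := ⟨a, ha, rfl⟩

lemma comp_sing {g : Γ} {s : B.S} (hs : s ∈ B.comp g) : ∃ a ha, s = B.sing g a ha := by
  obtain ⟨a, ha, h⟩ := hs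
  exact ⟨a, ha, Subtype.ext h⟩

lemma coeff_sum_S {ι : Type*} (t : Finset ι) (f : ι → B.S) (q : Q) :
    ((∑ i ∈ t, f i : B.S) : SkewMonoidAlgebra E Q).coeff q =
      ∑ i ∈ t, (f i : SkewMonoidAlgebra E Q).coeff q := by
  let φ : B.S →+ E :=
    { toFun := fun s => (s : SkewMonoidAlgebra E Q).coeff q
      map_zero' := by simp
      map_add' := fun a b => by simp }
  exact map_sum φ f t

/-- independence of the homogeneous components -/
lemma comp_indep (f : Γ → B.S) (hf : ∀ g, f g ∈ B.comp g) (h0 : ∑ g, f g = 0) : ∀ g, f g = 0 := by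
  choose a ha hfa using hf
  intro g
  have key := B.indep (B.π g) a ha (by
    have h1 := B.coeff_sum_S Finset.univ f (B.π g)
    rw [h0] at h1
    simp only [hfa, SkewMonoidAlgebra.coeff_single, Finsupp.single_apply] at h1
    rw [Finset.sum_filter, ← h1]
    simp) g rfl
  apply Subtype.ext
  rw [hfa, key]
  simp

lemma comp_span (R : AddSubgroup B.S) (hR : ∀ g, B.comp g ≤ R) (s : B.S) : s ∈ R := by
  have h1 : ∀ g m, m ∈ B.M0 → ∃ r ∈ R, (r : SkewMonoidAlgebra E Q) =
      SkewMonoidAlgebra.single (B.π g) (m * B.x g) := by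
    intro g m hm
    refine B.M0_induction (C := fun m => ∃ r ∈ R, (r : SkewMonoidAlgebra E Q) =
      SkewMonoidAlgebra.single (B.π g) (m * B.x g)) ?_ ⟨0, R.zero_mem, by simp⟩ ?_ hm
    · intro h hh a ha
      have := B.mul_mem' hh ha (B.xV g)
      refine ⟨_, hR _ (B.sing_comp _ _ this), ?_⟩
      simp [sing, hh]
    · rintro a b ⟨r, hr, hr'⟩ ⟨t, ht, ht'⟩
      exact ⟨r + t, R.add_mem hr ht, by rw [Subring.coe_add, hr', ht', add_mul, SkewMonoidAlgebra.single_add]⟩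
  have h2 : ∀ q, ∃ r ∈ R, (r : SkewMonoidAlgebra E Q) =
      SkewMonoidAlgebra.single q ((s : SkewMonoidAlgebra E Q).coeff q) := by
    intro q
    obtain ⟨g, rfl⟩ := B.surj q
    obtain ⟨r, hr, hr'⟩ := h1 g _ (s.2 g)
    refine ⟨r, hr, ?_⟩
    rw [hr']
    congr 1
    exact div_mul_cancel₀ _ (B.x0 g)
  choose r hr hr' using h2
  have : s = ∑ q, r q := by
    apply Subtype.ext
    apply SkewMonoidAlgebra.ext
    intro q
    rw [coeff_sum_S]
    simp [hr', SkewMonoidAlgebra.coeff_single, Finsupp.single_apply]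
  rw [this]
  exact R.sum_mem fun q _ => hr q

lemma internal {G' : Type*} [DecidableEq G'] [Fintype G'] (e : G' ≃ Γ) :
    DirectSum.IsInternal (fun g => B.comp (e g)) := by
  classical
  constructor
  · rw [injective_iff_map_eq_zero]
    intro f hf
    rw [DirectSum.coeAddMonoidHom_eq_dfinsuppSum, DFinsupp.sum_eq_sum_fintype _ (by simp)] at hf
    have h2 : ∑ γ, (f (e.symm γ) : B.S) = 0 := by
      rw [← hf]
      exact Equiv.sum_comp e.symm (fun g => (f g : B.S))
    have h3 := B.comp_indep (fun γ => (f (e.symm γ) : B.S)) (fun γ => by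
      have := (f (e.symm γ)).2
      simpa using this) h2
    ext g : 1
    apply Subtype.ext
    obtain ⟨γ, rfl⟩ := e.symm.surjective g
    exact h3 γ
  · intro s
    refine B.comp_span (AddMonoidHom.range (DirectSum.coeAddMonoidHom (fun g => B.comp (e g)))) ?_ s
    intro γ y hy
    refine ⟨DirectSum.of (fun g => B.comp (e g)) (e.symm γ) ⟨y, by simpa using hy⟩, ?_⟩
    rw [DirectSum.coeAddMonoidHom_of]

lemma sing_mul (g h : Γ) (a b : E) (ha : a ∈ B.V g) (hb : b ∈ B.V h) :
    B.sing g a ha * B.sing h b hb = B.sing (g * h) (a * B.π g • b) (B.mul_mem g h a b ha hb) := by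
  apply Subtype.ext
  simp [sing, SkewMonoidAlgebra.single_mul_single]

lemma sing_one : B.sing 1 1 B.one_mem = 1 := by
  apply Subtype.ext
  simp [sing]

lemma sing_eq (g h : Γ) (a b : E) (ha : a ∈ B.V g) (hb : b ∈ B.V h) (hg : B.π g = B.π h) (h1 : a = b) :
    B.sing g a ha = B.sing h b hb := by
  apply Subtype.ext
  simp [sing, hg, h1]

lemma sing_inj (g : Γ) (a b : E) (ha : a ∈ B.V g) (hb : b ∈ B.V g) (h : B.sing g a ha = B.sing g b hb) :
    a = b :=
  SkewMonoidAlgebra.single_injective _ (congrArg Subtype.val h)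

theorem main [CharZero E] {G' : Type*} [Group G'] [DecidableEq G'] [Finite G'] (e : G' ≃* Γ)
    (H : Subgroup G') (hH : ∀ g, g ∈ H ↔ B.π (e g) = 1) (hidx : H.index = Fintype.card Q) :
    ∃ (D : Type) (_ : DivisionRing D) (_ : CharZero D)
      (𝒜 : G' → AddSubgroup D) (_ : IsFaithfulGrading 𝒜),
      Module.Finite ↥(Subring.center D) D ∧
      (∀ x ∈ 𝒜 1, ∀ y ∈ 𝒜 1, x * y = y * x) ∧
      (∀ x ∈ 𝒜 1, x⁻¹ ∈ 𝒜 1) ∧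
      (∀ g : G', ∃ x : D, x ≠ 0 ∧ x ∈ 𝒜 g ∧ ∀ y ∈ 𝒜 g, ∃ l ∈ 𝒜 1, y = l * x) ∧
      (∀ x ∈ DN 𝒜 (H : Set G'), ∀ y ∈ DN 𝒜 (H : Set G'), x * y = y * x) ∧
      (∀ g : G', g ∈ H ↔ ∀ x ∈ 𝒜 g, ∀ l ∈ 𝒜 1, x * l = l * x) ∧
      Module.finrank ↥(Subring.center D) D = H.index ^ 2 := by
  have := Fintype.ofFinite G'
  have hcomm : ∀ g h, B.π g = 1 → B.π h = 1 → ∀ s ∈ B.comp g, ∀ t ∈ B.comp h, s * t = t * s := by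
    intro g h hg hh s hs t ht
    obtain ⟨a, ha, rfl⟩ := B.comp_sing hs
    obtain ⟨b, hb, rfl⟩ := B.comp_sing ht
    rw [sing_mul, sing_mul]
    apply sing_eq
    · simp [hg, hh]
    · rw [hg, hh, one_smul, one_smul, mul_comm]
  have hx0 : ∀ g, B.sing g _ (B.xV g) ≠ 0 := fun g h => B.x0 g
    (SkewMonoidAlgebra.single_injective (B.π g) ((congrArg Subtype.val h).trans (by simp)))
  refine ⟨B.S, B.toXM.divS, inferInstanceAs (CharZero B.toXM.S), fun g => B.comp (e g),
    ⟨?_, ?_, B.internal e.toEquiv, ?_⟩, B.toXM.center_fin.2, ?_, ?_, ?_, ?_, ?_, ?_⟩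
  · beta_reduce
    rw [map_one]
    exact B.sing_one ▸ B.sing_comp 1 1 B.one_mem
  · intro g h s t hs ht
    obtain ⟨a, ha, rfl⟩ := B.comp_sing hs
    obtain ⟨b, hb, rfl⟩ := B.comp_sing ht
    have := B.sing_comp _ _ (B.mul_mem _ _ a b ha hb)
    rw [← sing_mul] at this
    beta_reduce
    rw [map_mul]
    exact this
  · intro g h
    have h1 := B.sing_comp _ _ (B.xV (e g))
    rw [h] at h1
    exact hx0 _ h1
  · beta_reduce
    rw [map_one]
    exact hcomm 1 1 (map_one _) (map_one _)
  · beta_reduce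
    rw [map_one]
    intro s hs
    obtain ⟨a, ha, rfl⟩ := B.comp_sing hs
    by_cases h0 : a = 0
    · have : B.sing 1 a ha = 0 := Subtype.ext (by simp [sing, h0])
      rw [this, inv_zero]
      exact (B.comp 1).zero_mem
    · have : (B.sing 1 a ha)⁻¹ = B.sing 1 a⁻¹ (B.inv_mem a ha) := by
        apply inv_eq_of_mul_eq_one_right
        refine (B.sing_mul _ _ _ _ _ _).trans ?_
        rw [← sing_one]
        apply sing_eq
        · simp
        · simp [h0]
      rw [this]
      exact B.sing_comp _ _ _
  · intro g
    refine ⟨B.sing _ _ (B.xV (e g)), hx0 _, B.sing_comp _ _ _, ?_⟩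
    intro y hy
    obtain ⟨a, ha, rfl⟩ := B.comp_sing hy
    beta_reduce
    rw [map_one]
    refine ⟨B.sing 1 _ (B.gen _ a ha), B.sing_comp _ _ _, ?_⟩
    refine Eq.trans ?_ (B.sing_mul _ _ _ _ _ _).symm
    apply sing_eq
    · simp
    · simp [div_mul_cancel₀ _ (B.x0 _)]
  · intro s hs t ht
    refine AddSubgroup.iSup_induction _ (C := fun s => s * t = t * s) hs ?_ (by simp) ?_
    · intro i s hs
      refine AddSubgroup.iSup_induction _ (C := fun t => s * t = t * s) ht ?_ (by simp) ?_
      · intro k t ht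
        exact hcomm _ _ ((hH _).1 i.2) ((hH _).1 k.2) s hs t ht
      · intro a b ha hb; rw [mul_add, add_mul, ha, hb]
    · intro a b ha hb; rw [mul_add, add_mul, ha, hb]
  · intro g
    beta_reduce
    rw [map_one, hH]
    constructor
    · intro hg
      exact hcomm _ _ hg (map_one _)
    · intro h
      have h1 : B.sing _ _ (B.xV (e g)) * B.sing _ _ B.hell = B.sing _ _ B.hell * B.sing _ _ (B.xV (e g)) :=
        h _ (B.sing_comp _ _ (B.xV (e g))) _ (B.sing_comp _ _ B.hell)
      have h2 := congrArg (fun s : B.S => (s : SkewMonoidAlgebra E Q).coeff (B.π (e g))) h1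
      simp [sing, SkewMonoidAlgebra.single_mul_single, SkewMonoidAlgebra.coeff_single] at h2
      apply B.hellq
      apply mul_left_cancel₀ (B.x0 (e g))
      rw [h2, mul_comm]
  · rw [hidx]
    exact B.toXM.center_fin.1

end XV

namespace Dat
variable {Γ Q T : Type} [Group Γ] [Group Q] [DecidableEq Q] [AddCommGroup T] (A : Dat Γ Q T)
  [Fintype Γ] [Fintype Q]
  {E : Type} [Field E] [Algebra (MvPolynomial (Γ × Q) ℚ) E]
  [IsFractionRing (MvPolynomial (Γ × Q) ℚ) E] [MulSemiringAction Q E]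

lemma t_one : A.t 1 = 0 := by
  have := A.ht 1 1
  simpa using this

lemma x_mem (g : Γ) : x Q E g ∈ HF E A.w (A.t g) := by
  have := HF_X (E := E) A.w (g, 1)
  simp only [w, map_one] at this
  exact this

lemma V_le (g : Γ) (hg : A.π g = 1) : HF E A.w (A.t g) ≤ HF E A.w1 0 := by
  intro a ha
  have := HF_map A.p1 A.w A.w1 (fun _ => rfl) ha
  rwa [A.hp1, hg, sub_self] at this

/-- the graded crossed product data attached to a weight datum. -/
noncomputable def toXV (hc : Compat Γ Q E) : XV Γ Q E where
  π := A.π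
  surj := A.surj
  V g := HF E A.w (A.t g)
  one_mem := by rw [t_one]; exact HF_one _
  inv_mem a ha := by
    rw [t_one] at ha ⊢
    simpa using HF_inv ha
  mul_mem g h a b ha hb := by
    rw [A.ht]
    exact HF_mul ha (HF_rename (A.ρ (A.π g)) A.w A.w (eqv Γ (A.π g)) (A.w_eqv _)
      (MulSemiringAction.toRingHom Q E (A.π g)) (hc _) hb)
  x := x Q E
  x0 := x_ne
  xV := A.x_mem
  gen g a ha := by
    have := HF_mul ha (HF_inv (A.x_mem (E := E) g))
    rwa [add_neg_cancel, ← div_eq_mul_inv, ← A.t_one] at this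
  indep q e he h0 g hg := by
    refine HF_indep (Finset.univ.filter fun g => A.π g = q) A.w A.t ?_ e (fun i _ => he i) h0 g
      (by simpa using hg)
    intro a ha b hb hab
    simp only [Finset.coe_filter, Finset.mem_univ, true_and, Set.mem_ofPred_eq] at ha hb
    exact A.hinj _ _ (ha.trans hb.symm) hab
  ell := x Q E 1
  hell := A.x_mem 1
  hellq q hq := by
    rw [x, hc] at hq
    have := IsFractionRing.injective (MvPolynomial (Γ × Q) ℚ) E hq
    rw [rename_X] at this
    have := X_injective this
    simpa [eqv] using this
  key r c h0 hM hcoc := A.key hc r c h0 (fun g => by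
    have : (⨆ h : A.π.ker, HF E A.w (A.t h)) ≤ HF E A.w1 0 := iSup_le fun h => A.V_le h h.2
    exact this (hM g)) hcoc

end Dat

section Act
variable (Γ Q : Type) [Group Γ] [Group Q]

/-- the action of `Q` on the polynomial ring. -/
noncomputable abbrev polyAct : MulSemiringAction Q (MvPolynomial (Γ × Q) ℚ) where
  smul q a := rename (Dat.eqv Γ q) a
  one_smul a := by
    change rename (Dat.eqv Γ 1) a = a
    have : (Dat.eqv Γ (1 : Q) : Γ × Q → Γ × Q) = id := by ext i <;> simp [Dat.eqv]
    rw [this, rename_id_apply]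
  mul_smul q r a := by
    change rename (Dat.eqv Γ (q * r)) a = rename (Dat.eqv Γ q) (rename (Dat.eqv Γ r) a)
    rw [rename_rename]
    congr 1
    congr 1
    ext i <;> simp [Dat.eqv, mul_assoc]
  smul_zero q := map_zero _
  smul_add q := map_add _
  smul_one q := map_one _
  smul_mul q := map_mul _

theorem exists_act : ∃ _ : MulSemiringAction Q (FractionRing (MvPolynomial (Γ × Q) ℚ)),
    Dat.Compat Γ Q (FractionRing (MvPolynomial (Γ × Q) ℚ)) := by
  letI := polyAct Γ Q
  refine ⟨IsFractionRing.mulSemiringAction Q (MvPolynomial (Γ × Q) ℚ) _, ?_⟩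
  intro q a
  letI := IsFractionRing.mulSemiringAction Q (MvPolynomial (Γ × Q) ℚ)
    (FractionRing (MvPolynomial (Γ × Q) ℚ))
  haveI := IsFractionRing.smulDistribClass Q (MvPolynomial (Γ × Q) ℚ)
    (FractionRing (MvPolynomial (Γ × Q) ℚ))
  have := SMulDistribClass.smul_distrib_smul q a (1 : FractionRing (MvPolynomial (Γ × Q) ℚ))
  rw [smul_one, ← Algebra.algebraMap_eq_smul_one, ← Algebra.algebraMap_eq_smul_one] at this
  exact this

end Act

section Kos
variable {Γ : Type} [Group Γ] (H : Subgroup Γ) [hn : H.Normal]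

/-- The `H`-valued cocycle. -/
noncomputable def kap (g : Γ) (r : Γ ⧸ H) : H :=
  ⟨r.out⁻¹ * g * (((g : Γ ⧸ H)⁻¹ * r : Γ ⧸ H)).out, by
    rw [← QuotientGroup.eq_one_iff]
    simp⟩

lemma kap_mul (g h : Γ) (r : Γ ⧸ H) : kap H (g * h) r = kap H g r * kap H h ((g : Γ ⧸ H)⁻¹ * r) := by
  apply Subtype.ext
  simp [kap, mul_assoc]

/-- shift action on functions. -/
def shiftHom {Q M : Type} [Group Q] [AddCommGroup M] : Q →* AddMonoid.End (Q → M) where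
  toFun q := { toFun := fun f r => f (q⁻¹ * r), map_zero' := rfl, map_add' := fun _ _ => rfl }
  map_one' := by
    ext f r
    change f (1⁻¹ * r) = f r
    simp
  map_mul' a b := by
    ext f r
    change f ((a * b)⁻¹ * r) = f (b⁻¹ * (a⁻¹ * r))
    simp [mul_assoc]

/-- product of two actions -/
def prodHom {Q M N : Type} [Group Q] [AddCommGroup M] [AddCommGroup N] (a : Q →* AddMonoid.End M)
    (b : Q →* AddMonoid.End N) : Q →* AddMonoid.End (M × N) where
  toFun q := AddMonoidHom.prodMap (a q) (b q)
  map_one' := by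
    rw [map_one, map_one]
    rfl
  map_mul' x y := by
    rw [map_mul, map_mul]
    rfl

/-- the weight datum of an abelian normal subgroup. -/
noncomputable def theDat [DecidableEq (Γ ⧸ H)] (hab : ∀ a ∈ H, ∀ b ∈ H, a * b = b * a) :
    letI : CommGroup H := { (inferInstance : Group H) with
      mul_comm := fun a b => Subtype.ext (hab a a.2 b b.2) }
    Dat Γ (Γ ⧸ H) (((Γ ⧸ H) → ℤ) × ((Γ ⧸ H) → Additive H)) :=
  letI : CommGroup H := { (inferInstance : Group H) with
      mul_comm := fun a b => Subtype.ext (hab a a.2 b b.2) }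
  { π := QuotientGroup.mk' H
    surj := QuotientGroup.mk'_surjective H
    ρ := prodHom shiftHom shiftHom
    t := fun g => (Pi.single (g : Γ ⧸ H) 1 - Pi.single 1 1, fun r => Additive.ofMul (kap H g r))
    ht := by
      intro g h
      apply Prod.ext
      · ext r
        change (Pi.single ((g * h : Γ) : Γ ⧸ H) 1 - Pi.single 1 1 : (Γ ⧸ H) → ℤ) r =
          (Pi.single (g : Γ ⧸ H) 1 - Pi.single 1 1 : (Γ ⧸ H) → ℤ) r +
          (Pi.single (h : Γ ⧸ H) 1 - Pi.single 1 1 : (Γ ⧸ H) → ℤ) ((g : Γ ⧸ H)⁻¹ * r)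
        simp [Pi.single_apply, inv_mul_eq_iff_eq_mul]
      · funext r
        exact congrArg Additive.ofMul (kap_mul H g h r)
    hinj := by
      intro g h hgh ht
      have hgh' : (g : Γ ⧸ H) = h := hgh
      have h2 := congrFun (congrArg Prod.snd ht) 1
      have h3 := congrArg Subtype.val (Additive.ofMul.injective h2)
      simpa [kap, hgh'] using h3
    p1 := AddMonoidHom.fst _ _
    hp1 := fun g => rfl
    hp1ρ := fun q x r => rfl }

theorem exists_XV [Fintype Γ] [Fintype (Γ ⧸ H)] [DecidableEq (Γ ⧸ H)]
    (hab : ∀ a ∈ H, ∀ b ∈ H, a * b = b * a) :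
    ∃ (E : Type) (_ : Field E) (_ : CharZero E) (_ : MulSemiringAction (Γ ⧸ H) E)
      (B : XV Γ (Γ ⧸ H) E), B.π = QuotientGroup.mk' H := by
  obtain ⟨act, hc⟩ := exists_act Γ (Γ ⧸ H)
  refine ⟨_, inferInstance, ?_, act, ?_⟩
  · exact charZero_of_injective_algebraMap
      (IsFractionRing.injective (MvPolynomial (Γ × (Γ ⧸ H)) ℚ) _)
  · letI : CommGroup H := { (inferInstance : Group H) with
      mul_comm := fun a b => Subtype.ext (hab a a.2 b b.2) }
    exact ⟨(theDat H hab).toXV hc, rfl⟩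

end Kos

end CPDA

/-- For every finite group `G` and abelian normal subgroup `H`, there
is a faithfully `G`-graded division ring `D` of characteristic zero, finite dimensional
over its center `K`, such that `D_e` is a field `L`, each homogeneous component is a
one-dimensional left `L`-space, `D_H` is commutative (hence a field), `H` is the kernel
of the conjugation action of `G` on `L`, and `dim_K D = [G:H]²`. -/
theorem exists_crossed_product_division_algebra
    [Finite G] (H : Subgroup G) (hHn : H.Normal)
    (hHab : ∀ a ∈ H, ∀ b ∈ H, a * b = b * a) :
    ∃ (D : Type) (_ : DivisionRing D) (_ : CharZero D)
      (𝒜 : G → AddSubgroup D) (_ : IsFaithfulGrading 𝒜),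
      -- `D` is finite dimensional over its center `K`
      Module.Finite ↥(Subring.center D) D ∧
      -- `D_e` is a field `L`
      (∀ x ∈ 𝒜 1, ∀ y ∈ 𝒜 1, x * y = y * x) ∧
      (∀ x ∈ 𝒜 1, x⁻¹ ∈ 𝒜 1) ∧
      -- every homogeneous component is a one-dimensional left `L`-vector space
      (∀ g : G, ∃ x : D, x ≠ 0 ∧ x ∈ 𝒜 g ∧ ∀ y ∈ 𝒜 g, ∃ l ∈ 𝒜 1, y = l * x) ∧
      -- `D_H = ⊕_{h ∈ H} D_h` is commutative (hence a field)
      (∀ x ∈ DN 𝒜 (H : Set G), ∀ y ∈ DN 𝒜 (H : Set G), x * y = y * x) ∧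
      -- `H` is the kernel of the conjugation action of `G` on `L = D_e`
      (∀ g : G, g ∈ H ↔ ∀ x ∈ 𝒜 g, ∀ l ∈ 𝒜 1, x * l = l * x) ∧
      -- `dim_K D = [G:H]²`
      Module.finrank ↥(Subring.center D) D = H.index ^ 2 := by
  classical
  have := Fintype.ofFinite G
  let e : G ≃* Shrink.{0} G := (equivShrink.{0} G).symm.mulEquiv.symm
  have : Finite (Shrink.{0} G) := Finite.of_equiv G e.toEquiv
  have := Fintype.ofFinite (Shrink.{0} G)
  let H' : Subgroup (Shrink.{0} G) := H.map e.toMonoidHom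
  have hn' : H'.Normal := hHn.map e.toMonoidHom e.surjective
  have hab : ∀ a ∈ H', ∀ b ∈ H', a * b = b * a := by
    rintro _ ⟨a, ha, rfl⟩ _ ⟨b, hb, rfl⟩
    rw [← map_mul, ← map_mul, hHab a ha b hb]
  have := Fintype.ofFinite (Shrink.{0} G ⧸ H')
  obtain ⟨E, _, _, _, B, hB⟩ := CPDA.exists_XV H' hab
  refine B.main e H ?_ ?_
  · intro g
    rw [hB, QuotientGroup.mk'_apply, QuotientGroup.eq_one_iff]
    exact (Subgroup.mem_map_equiv.trans (by simp)).symm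
  · rw [← Nat.card_eq_fintype_card, ← Subgroup.index]
    exact (Subgroup.index_map_equiv H e).symm
end
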